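/- arXiv:1012.0941 — 3 statements merged into one kernel-verified Lean document; each statement's English description precedes it below -/
import Mathlib

section
/- For every δ > 0 and κ > 0 there is a constant c > 0 depending only on δ and κ (one may take c = 1 − 2^{−κδ}) such that: for every finite sequence a_1,…,a_m of positive numbers there exist indices 1 ≤ p_1 < p_2 < … < p_K ≤ m satisfying (i) 2^{−δ(p_l − p)} a_p ≤ a_{p_l} for all 1 ≤ p ≤ p_l and all l = 1,…,K, and (ii) Σ_{l=1}^K a_{p_l}^κ ≥ c Σ_{p=1}^m a_p^κ. -/
/-- Among the first `n` terms of a nonnegative sequence, those that dominate the geometrically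
discounted earlier terms carry at least the proportion `1 - ρ` of the sum; the extra term `ρ * t`,
with `t` a bound for all discounted terms, makes the induction work. -/
theorem exists_discounted_bound {ρ : ℝ} (hρ₀ : 0 ≤ ρ) (hρ₁ : ρ ≤ 1) (x : ℕ → ℝ)
    (S : Finset ℕ) (n : ℕ) (hx : ∀ p ∈ Finset.Icc 1 n, 0 ≤ x p)
    (hS : ∀ p ∈ Finset.Icc 1 n, (∀ q ∈ Finset.Icc 1 p, ρ ^ (p - q) * x q ≤ x p) → p ∈ S) :
    ∃ t : ℝ, 0 ≤ t ∧ (∀ q ∈ Finset.Icc 1 n, ρ ^ (n - q) * x q ≤ t) ∧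
      (1 - ρ) * ∑ q ∈ Finset.Icc 1 n, x q + ρ * t ≤
        ∑ q ∈ Finset.Icc 1 n with q ∈ S, x q := by
  induction n with
  | zero => exact ⟨0, le_rfl, by simp, by simp⟩
  | succ n ih =>
    have hsub : Finset.Icc 1 n ⊆ Finset.Icc 1 (n + 1) := Finset.Icc_subset_Icc_right n.le_succ
    obtain ⟨t, ht₀, ht, hsum⟩ := ih (fun p hp => hx p (hsub hp)) (fun p hp => hS p (hsub hp))
    have hmem : n + 1 ∈ Finset.Icc 1 (n + 1) := by simp
    have hxn := hx _ hmem
    have hstep : ∀ q ∈ Finset.Icc 1 n, ρ ^ (n + 1 - q) * x q ≤ ρ * t := by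
      intro q hq
      rw [Nat.succ_sub (Finset.mem_Icc.1 hq).2, pow_succ', mul_assoc]
      exact mul_le_mul_of_nonneg_left (ht q hq) hρ₀
    have hbound : ∀ s, ρ * t ≤ s → x (n + 1) ≤ s →
        ∀ q ∈ Finset.Icc 1 (n + 1), ρ ^ (n + 1 - q) * x q ≤ s := by
      intro s hs hs' q hq
      rcases Nat.le_succ_iff.1 (Finset.mem_Icc.1 hq).2 with h | rfl
      · exact (hstep q (Finset.mem_Icc.2 ⟨(Finset.mem_Icc.1 hq).1, h⟩)).trans hs
      · simpa using hs'
    have hρt : 0 ≤ ρ * t := mul_nonneg hρ₀ ht₀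
    have hsplit : (∑ q ∈ Finset.Icc 1 (n + 1) with q ∈ S, x q) =
        (∑ q ∈ Finset.Icc 1 n with q ∈ S, x q) + if n + 1 ∈ S then x (n + 1) else 0 := by
      rw [Finset.sum_filter, Finset.sum_Icc_succ_top (by omega), ← Finset.sum_filter]
    rw [hsplit, Finset.sum_Icc_succ_top (by omega)]
    rcases le_total (ρ * t) (x (n + 1)) with h | h
    · refine ⟨x (n + 1), hxn, hbound _ h le_rfl, ?_⟩
      rw [if_pos (hS _ hmem (hbound _ h le_rfl))]
      linarith
    · refine ⟨ρ * t, hρt, hbound _ le_rfl h, ?_⟩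
      have hnonneg : 0 ≤ if n + 1 ∈ S then x (n + 1) else 0 := by split_ifs <;> simp [hxn]
      nlinarith [mul_le_mul_of_nonneg_left h (sub_nonneg.2 hρ₁)]

/-- Lemma 5.2: for every finite sequence `a_1, …, a_m` of positive numbers and `δ, κ > 0`
there is a subsequence `a_{p_1}, …, a_{p_K}` with `2^{-δ(p_l - p)} a_p ≤ a_{p_l}` for all
`p ≤ p_l`, and `Σ_l a_{p_l}^κ ≥ c Σ_p a_p^κ`, where `c > 0` depends only on `δ, κ`. -/
theorem statement10 (δ κ : ℝ) (hδ : 0 < δ) (hκ : 0 < κ) :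
    ∃ c : ℝ, 0 < c ∧
      ∀ (m : ℕ), 1 ≤ m → ∀ (a : ℕ → ℝ), (∀ p, 1 ≤ p → p ≤ m → 0 < a p) →
        ∃ (K : ℕ) (p : ℕ → ℕ), 1 ≤ K ∧ K ≤ m ∧
          (∀ l l', 1 ≤ l → l < l' → l' ≤ K → p l < p l') ∧
          (∀ l, 1 ≤ l → l ≤ K → 1 ≤ p l ∧ p l ≤ m) ∧
          (∀ l, 1 ≤ l → l ≤ K → ∀ q, 1 ≤ q → q ≤ p l →
            (2 : ℝ) ^ (-(δ * ((p l : ℝ) - (q : ℝ)))) * a q ≤ a (p l)) ∧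
          c * ∑ q ∈ Finset.Icc 1 m, a q ^ κ ≤ ∑ l ∈ Finset.Icc 1 K, a (p l) ^ κ := by
  have hρ₀ : (0 : ℝ) < 2 ^ (-(δ * κ)) := by positivity
  have hρ₁ : (2 : ℝ) ^ (-(δ * κ)) < 1 :=
    Real.rpow_lt_one_of_one_lt_of_neg one_lt_two (neg_lt_zero.2 (mul_pos hδ hκ))
  set ρ : ℝ := 2 ^ (-(δ * κ)) with hρ
  refine ⟨1 - ρ, sub_pos.2 hρ₁, fun m hm a ha => ?_⟩
  obtain ⟨S, hS⟩ : ∃ S : Finset ℕ, ∀ p, p ∈ S ↔ p ∈ Finset.Icc 1 m ∧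
      ∀ q ∈ Finset.Icc 1 p, ρ ^ (p - q) * a q ^ κ ≤ a p ^ κ := by
    classical
    exact ⟨Finset.filter (fun p => ∀ q ∈ Finset.Icc 1 p, ρ ^ (p - q) * a q ^ κ ≤ a p ^ κ) _,
      fun p => by convert Finset.mem_filter⟩
  obtain ⟨t, ht₀, -, hsum⟩ := exists_discounted_bound hρ₀.le hρ₁.le (fun p => a p ^ κ) S m
    (fun p hp => Real.rpow_nonneg (ha p (Finset.mem_Icc.1 hp).1 (Finset.mem_Icc.1 hp).2).le κ)
    (fun p hp h => (hS p).2 ⟨hp, h⟩)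
  have hSm : S ⊆ Finset.Icc 1 m := fun p hp => ((hS p).1 hp).1
  have hfilter : ({q ∈ Finset.Icc 1 m | q ∈ S} : Finset ℕ) = S := by
    rw [Finset.filter_mem_eq_inter, Finset.inter_eq_right.2 hSm]
  have hone : 1 ∈ S := (hS 1).2 ⟨by simp [hm], fun q hq => by
    obtain rfl : q = 1 := by simpa using hq
    simp⟩
  have hfin : (Set.ofPred (· ∈ S)).Finite := S.finite_toSet
  have hcard : hfin.toFinset.card = S.card := by
    congr 1; ext; simp
  have hnth : ∀ l, 1 ≤ l → l ≤ S.card → Nat.nth (· ∈ S) (l - 1) ∈ S := fun l hl hl' =>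
    Nat.nth_mem_of_lt_card hfin (by omega)
  have hmono : ∀ l l', 1 ≤ l → l < l' → l' ≤ S.card →
      Nat.nth (· ∈ S) (l - 1) < Nat.nth (· ∈ S) (l' - 1) := fun l l' hl hll' hl' =>
    Nat.nth_lt_nth_of_lt_card hfin (by omega) (by omega)
  refine ⟨S.card, fun l => Nat.nth (· ∈ S) (l - 1), Finset.card_pos.2 ⟨1, hone⟩,
    by simpa using Finset.card_le_card hSm, hmono,
    fun l hl hl' => Finset.mem_Icc.1 (hSm (hnth l hl hl')), fun l hl hl' q hq hqp => ?_, ?_⟩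
  · obtain ⟨hp, hrec⟩ := (hS (Nat.nth (· ∈ S) (l - 1))).1 (hnth l hl hl')
    beta_reduce at hqp ⊢
    generalize Nat.nth (· ∈ S) (l - 1) = p at *
    obtain ⟨hp₁, hpm⟩ := Finset.mem_Icc.1 hp
    have haq := ha q hq (hqp.trans hpm)
    have hpow : ((2 : ℝ) ^ (-(δ * ((p : ℝ) - q)))) ^ κ = ρ ^ (p - q) := by
      rw [hρ, ← Real.rpow_natCast, ← Real.rpow_mul zero_le_two, ← Real.rpow_mul zero_le_two,
        Nat.cast_sub hqp]
      ring_nf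
    rw [← Real.rpow_le_rpow_iff (by positivity) (ha p hp₁ hpm).le hκ,
      Real.mul_rpow (by positivity) haq.le, hpow]
    exact hrec q (Finset.mem_Icc.2 ⟨hq, hqp⟩)
  · have hsum_nth : ∑ l ∈ Finset.Icc 1 S.card, a (Nat.nth (· ∈ S) (l - 1)) ^ κ =
        ∑ q ∈ S, a q ^ κ := by
      refine Finset.sum_nbij (fun l => Nat.nth (· ∈ S) (l - 1))
        (fun l hl => hnth l (Finset.mem_Icc.1 hl).1 (Finset.mem_Icc.1 hl).2) ?_ ?_
        (fun _ _ => rfl)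
      · have : StrictMonoOn (fun l => Nat.nth (· ∈ S) (l - 1)) (Finset.Icc 1 S.card) :=
          fun l hl l' hl' hll' => hmono l l' (Finset.mem_Icc.1 hl).1 hll' (Finset.mem_Icc.1 hl').2
        exact this.injOn
      · intro q hq
        obtain ⟨k, hk, rfl⟩ := Nat.exists_lt_card_finite_nth_eq hfin hq
        exact ⟨k + 1, by simp; omega, rfl⟩
    rw [hfilter] at hsum
    rw [hsum_nth]
    linarith [mul_nonneg hρ₀.le ht₀]
end

section
/- Let λ_1,…,λ_K be positive numbers. For a vector f = (f_1,…,f_K) ∈ {−1,+1}^K set S(f) = Σ_{i=1}^K f_i λ_i. Let 𝒜 be a set of distinct vectors with 𝒜 ⊆ {f ∈ {−1,+1}^K : S(f) ≤ 0}. Then there exists a set ℬ ⊆ {f ∈ {−1,+1}^K : S(f) ≥ 0} of distinct vectors such that #𝒜 ≤ #ℬ and every vector f′ ∈ ℬ can be obtained from some vector f ∈ 𝒜 by replacing some of the −1 components of f by +1 while keeping all the +1 components of f (equivalently: there exists f ∈ 𝒜 with f_i ≤ f′_i for all i). -/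
/-- The sign `±1` encoded by a boolean. -/
def sgnB (b : Bool) : ℝ := if b then 1 else -1

open scoped FinsetFamily

lemma sgnB_mono : Monotone sgnB := by
  intro a b h
  revert h
  cases a <;> cases b <;> norm_num [sgnB]

lemma sgnB_not (b : Bool) : sgnB (!b) = -sgnB b := by
  cases b <;> simp [sgnB]

lemma sum_sgnB_mul_mono {ι : Type*} [Fintype ι] {w : ι → ℝ} (hw : ∀ i, 0 < w i) :
    Monotone fun f : ι → Bool => ∑ i, sgnB (f i) * w i := fun _ _ h =>
  Finset.sum_le_sum fun i _ => mul_le_mul_of_nonneg_right (sgnB_mono (h i)) (hw i).le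

lemma sum_sgnB_compl_mul {ι : Type*} [Fintype ι] (w : ι → ℝ) (f : ι → Bool) :
    ∑ i, sgnB (fᶜ i) * w i = -∑ i, sgnB (f i) * w i := by
  simp [sgnB_not]

/-- There are as many sign vectors with nonpositive as with nonnegative weighted sum. -/
lemma card_sum_sgnB_nonpos_eq {ι : Type*} [Fintype ι] [DecidableEq ι] (w : ι → ℝ) :
    (Finset.univ.filter fun f : ι → Bool => ∑ i, sgnB (f i) * w i ≤ 0).card =
      (Finset.univ.filter fun f : ι → Bool => 0 ≤ ∑ i, sgnB (f i) * w i).card := by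
  refine Finset.card_bij' (fun f _ => fᶜ) (fun f _ => fᶜ) ?_ ?_ ?_ ?_
  · intro f hf
    simpa only [Finset.mem_filter_univ, sum_sgnB_compl_mul, neg_nonneg] using hf
  · intro f hf
    simpa only [Finset.mem_filter_univ, sum_sgnB_compl_mul, neg_nonpos] using hf
  · exact fun f _ => compl_compl f
  · exact fun f _ => compl_compl f

/-- Lemma 5.5: let `λ_i > 0` and `S(f) = Σ f_i λ_i` for sign vectors `f ∈ {−1,+1}^K`.
If `𝒜 ⊆ {S ≤ 0}`, there is `ℬ ⊆ {S ≥ 0}` with `#𝒜 ≤ #ℬ` such that every `f' ∈ ℬ` is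
obtained from some `f ∈ 𝒜` by turning some `−1` components into `+1` (i.e. `f ≤ f'`). -/
theorem statement13 (K : ℕ) (lam : Fin K → ℝ) (hlam : ∀ i, 0 < lam i)
    (A : Finset (Fin K → Bool))
    (hA : ∀ f ∈ A, ∑ i, sgnB (f i) * lam i ≤ 0) :
    ∃ B : Finset (Fin K → Bool),
      (∀ f' ∈ B, 0 ≤ ∑ i, sgnB (f' i) * lam i) ∧
      A.card ≤ B.card ∧
      ∀ f' ∈ B, ∃ f ∈ A, ∀ i, sgnB (f i) ≤ sgnB (f' i) := by
  classical
  let L := Finset.univ.filter fun f : Fin K → Bool => ∑ i, sgnB (f i) * lam i ≤ 0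
  let G := Finset.univ.filter fun f : Fin K → Bool => 0 ≤ ∑ i, sgnB (f i) * lam i
  have hmono := sum_sgnB_mul_mono hlam
  refine ⟨A ⊻ G, ?_, ?_, ?_⟩
  · intro f' hf'
    obtain ⟨a, -, g, hg, rfl⟩ := Finset.mem_sups.1 hf'
    exact (Finset.mem_filter_univ g).1 hg |>.trans (hmono le_sup_right)
  · have hsub : A ⊼ G ⊆ L := by
      intro f hf
      obtain ⟨a, ha, g, -, rfl⟩ := Finset.mem_infs.1 hf
      exact (Finset.mem_filter_univ _).2 ((hmono inf_le_left).trans (hA a ha))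
    have hpos : 0 < G.card := Finset.card_pos.2 ⟨⊤, (Finset.mem_filter_univ _).2 <|
      Finset.sum_nonneg fun i _ => by simpa [sgnB] using (hlam i).le⟩
    have hcard : L.card = G.card := card_sum_sgnB_nonpos_eq lam
    refine Nat.le_of_mul_le_mul_left ?_ hpos
    calc G.card * A.card = A.card * G.card := mul_comm _ _
      _ ≤ (A ⊼ G).card * (A ⊻ G).card := Finset.le_card_infs_mul_card_sups A G
      _ ≤ G.card * (A ⊻ G).card :=
        Nat.mul_le_mul_right _ ((Finset.card_le_card hsub).trans hcard.le)
  · intro f' hf'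
    obtain ⟨a, ha, g, -, rfl⟩ := Finset.mem_sups.1 hf'
    exact ⟨a, ha, fun i => sgnB_mono le_sup_left⟩
end

section
/- Let d ≥ 1 be an integer and s ∈ (0,d), and let h be a measure function such that h(r)/r^d is nonincreasing. There exist constants N_0, c > 0 and C ≥ 1, depending only on d and s, with the following property: for every η > 0, every P > 0, and every N ≥ N_0, one can find a measure ν on ℝ^d which is a linear combination with positive coefficients of N Dirac point masses, with total mass ‖ν‖ = η, such that every M satisfying M ≥ M_h(Z(ν,P)) obeys M > c (‖ν‖/P) [∫_{h^{−1}(C·M/N)}^{h^{−1}(M)} (h(t)/t^s)² dt/t]^{1/2}, where h^{−1} is the inverse function of h and Z(ν,P) = {x ∈ ℝ^d : R^s_ν(x) exists and |R^s_ν(x)| > P}. -/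
open MeasureTheory Filter Metric Set
open scoped ENNReal NNReal Topology

noncomputable section

/-- The `s`-Riesz kernel `K^s(x) = x / |x|^{s+1}` in `ℝᵈ`. -/
def rieszKernel (d : ℕ) (s : ℝ) (x : EuclideanSpace ℝ (Fin d)) : EuclideanSpace ℝ (Fin d) :=
  ‖x‖ ^ (-(s + 1)) • x

/-- The `ε`-truncated `s`-Riesz transform of the measure `ν`. -/
def truncRiesz (d : ℕ) (s : ℝ) (ν : Measure (EuclideanSpace ℝ (Fin d))) (ε : ℝ)
    (x : EuclideanSpace ℝ (Fin d)) : EuclideanSpace ℝ (Fin d) :=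
  ∫ y in {y | ε < dist y x}, rieszKernel d s (y - x) ∂ν

/-- Existence of the principal value `s`-Riesz transform of `ν` at `x`. -/
def rieszExists (d : ℕ) (s : ℝ) (ν : Measure (EuclideanSpace ℝ (Fin d)))
    (x : EuclideanSpace ℝ (Fin d)) : Prop :=
  ∃ L, Tendsto (fun ε => truncRiesz d s ν ε x) (𝓝[>] (0 : ℝ)) (𝓝 L)

/-- The principal value `s`-Riesz transform of `ν` at `x` (junk value if the limit
does not exist). -/
def rieszTransform (d : ℕ) (s : ℝ) (ν : Measure (EuclideanSpace ℝ (Fin d)))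
    (x : EuclideanSpace ℝ (Fin d)) : EuclideanSpace ℝ (Fin d) :=
  limUnder (𝓝[>] (0 : ℝ)) (fun ε => truncRiesz d s ν ε x)


/-- The capacity `γ_{s,+}(E)`: the supremum of total masses of positive measures
supported on `E` whose `s`-Riesz transform exists a.e. and is bounded by `1`. -/
def gammaPlus (d : ℕ) (s : ℝ) (E : Set (EuclideanSpace ℝ (Fin d))) : ℝ :=
  sSup {t : ℝ | ∃ ν : Measure (EuclideanSpace ℝ (Fin d)), IsFiniteMeasure ν ∧
    ν Eᶜ = 0 ∧
    (∀ᵐ x : EuclideanSpace ℝ (Fin d), rieszExists d s ν x ∧ ‖rieszTransform d s ν x‖ ≤ 1) ∧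
    t = (ν univ).toReal}

/-- The Hausdorff content `M_h(G)` associated with a gauge function `h`: the infimum of
`Σ_j h(r_j)` over all countable coverings of `G` by balls of radii `r_j`. -/
def hContent (d : ℕ) (h : ℝ → ℝ) (G : Set (EuclideanSpace ℝ (Fin d))) : ℝ≥0∞ :=
  ⨅ (x : ℕ → EuclideanSpace ℝ (Fin d)) (r : ℕ → ℝ) (_ : ∀ j, 0 < r j)
    (_ : G ⊆ ⋃ j, closedBall (x j) (r j)), ∑' j, ENNReal.ofReal (h (r j))

theorem rieszKernel_neg (d : ℕ) (s : ℝ) (u : EuclideanSpace ℝ (Fin d)) :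
    rieszKernel d s (-u) = -rieszKernel d s u := by
  simp [rieszKernel]

theorem norm_rieszKernel {d : ℕ} {s : ℝ} {u : EuclideanSpace ℝ (Fin d)} (hu : 0 < ‖u‖) :
    ‖rieszKernel d s u‖ = ‖u‖ ^ (-s) := by
  rw [rieszKernel, norm_smul, Real.norm_of_nonneg (by positivity)]
  rw [show -s = -(s + 1) + 1 by ring, Real.rpow_add hu, Real.rpow_one]

theorem rpow_neg_sub_le {q a b : ℝ} (hq : 0 ≤ q) (ha : 0 < a) (hab : a ≤ b) :
    a ^ (-q) - b ^ (-q) ≤ q * a ^ (-q) * ((b - a) / a) := by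
  have hb : 0 < b := ha.trans_le hab
  have h1 : 1 - q * (b / a - 1) ≤ (b / a) ^ (-q) := by
    rw [Real.rpow_def_of_pos (by positivity)]
    have h2 := Real.add_one_le_exp (Real.log (b / a) * -q)
    have h3 := Real.log_le_sub_one_of_pos (show 0 < b / a by positivity)
    nlinarith
  have h4 : b ^ (-q) = a ^ (-q) * (b / a) ^ (-q) := by
    rw [← Real.mul_rpow ha.le (by positivity)]
    congr 1
    field_simp
  have h5 : (b - a) / a = b / a - 1 := by field_simp
  rw [h4, h5]
  have := mul_le_mul_of_nonneg_left h1 (Real.rpow_nonneg ha.le (-q))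
  nlinarith

theorem abs_rpow_neg_sub_le {q m a b : ℝ} (hq : 0 ≤ q) (hm : 0 < m) (ha : m ≤ a) (hb : m ≤ b) :
    |a ^ (-q) - b ^ (-q)| ≤ q * m ^ (-q) * (|a - b| / m) := by
  wlog hab : a ≤ b generalizing a b
  · rw [abs_sub_comm, abs_sub_comm a b]
    exact this hb ha (le_of_not_ge hab)
  have ha0 : 0 < a := hm.trans_le ha
  have h1 := rpow_neg_sub_le hq ha0 hab
  have h2 : b ^ (-q) ≤ a ^ (-q) := Real.rpow_le_rpow_of_nonpos ha0 hab (by linarith)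
  rw [abs_of_nonneg (sub_nonneg.2 h2), abs_sub_comm, abs_of_nonneg (sub_nonneg.2 hab)]
  refine h1.trans ?_
  have h3 : a ^ (-q) ≤ m ^ (-q) := Real.rpow_le_rpow_of_nonpos hm ha (by linarith)
  have h4 : (b - a) / a ≤ (b - a) / m := by gcongr
  have : 0 ≤ (b - a) / a := div_nonneg (by linarith) ha0.le
  gcongr

theorem rieszKernel_sub_le {d : ℕ} {s m : ℝ} (hs : 0 < s) (hm : 0 < m)
    {u v : EuclideanSpace ℝ (Fin d)} (hu : m ≤ ‖u‖) (hv : m ≤ ‖v‖) (hv' : ‖v‖ ≤ 4 * m) :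
    ‖rieszKernel d s u - rieszKernel d s v‖ ≤
      (5 + 4 * s) * m ^ (-s) * (‖u - v‖ / m) := by
  have e : rieszKernel d s u - rieszKernel d s v =
      ‖u‖ ^ (-(s + 1)) • (u - v) + (‖u‖ ^ (-(s + 1)) - ‖v‖ ^ (-(s + 1))) • v := by
    simp only [rieszKernel]; module
  rw [e]
  refine (norm_add_le _ _).trans ?_
  rw [norm_smul, norm_smul, Real.norm_of_nonneg (by positivity), Real.norm_eq_abs]
  have h1 : ‖u‖ ^ (-(s + 1)) ≤ m ^ (-(s + 1)) :=
    Real.rpow_le_rpow_of_nonpos hm hu (by linarith)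
  have h2 := abs_rpow_neg_sub_le (q := s + 1) (by linarith) hm hu hv
  have h3 : |‖u‖ - ‖v‖| ≤ ‖u - v‖ := abs_norm_sub_norm_le u v
  have h4 : m ^ (-(s + 1)) * m = m ^ (-s) := by
    rw [show -s = -(s + 1) + 1 by ring, Real.rpow_add hm, Real.rpow_one]
  have h5 : |‖u‖ ^ (-(s + 1)) - ‖v‖ ^ (-(s + 1))| ≤
      (s + 1) * m ^ (-(s + 1)) * (‖u - v‖ / m) := h2.trans (by gcongr)
  calc ‖u‖ ^ (-(s + 1)) * ‖u - v‖ + |‖u‖ ^ (-(s + 1)) - ‖v‖ ^ (-(s + 1))| * ‖v‖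
      ≤ m ^ (-(s + 1)) * ‖u - v‖ + (s + 1) * m ^ (-(s + 1)) * (‖u - v‖ / m) * (4 * m) := by
        gcongr
    _ = (5 + 4 * s) * m ^ (-s) * (‖u - v‖ / m) := by
        rw [← h4]; field_simp; ring

theorem sum_range_rpow_neg_le {σ : ℝ} (h0 : 0 ≤ σ) (h1 : σ < 1) (n : ℕ) :
    ∑ a ∈ Finset.range n, (1 + (a : ℝ)) ^ (-σ) ≤ (n : ℝ) ^ (1 - σ) / (1 - σ) := by
  induction n with
  | zero => simp [Real.zero_rpow (show 1 - σ ≠ 0 by linarith)]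
  | succ n ih =>
    rw [Finset.sum_range_succ]
    have hn : (0 : ℝ) < n + 1 := by positivity
    have key : (n : ℝ) ^ (1 - σ) ≤ (n + 1 : ℝ) ^ (1 - σ) - (1 - σ) * (n + 1 : ℝ) ^ (-σ) := by
      have hb : ((n : ℝ) / (n + 1)) ^ (1 - σ) ≤ 1 + (1 - σ) * (-(1 / (n + 1))) := by
        have := rpow_one_add_le_one_add_mul_self (s := -(1 / ((n : ℝ) + 1)))
          (p := 1 - σ) (by
            have : 1 / ((n : ℝ) + 1) ≤ 1 := by rw [div_le_one hn]; linarith [n.cast_nonneg (α := ℝ)]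
            linarith) (by linarith) (by linarith)
        convert this using 2
        field_simp; ring
      have e : (n : ℝ) ^ (1 - σ) = (n + 1 : ℝ) ^ (1 - σ) * ((n : ℝ) / (n + 1)) ^ (1 - σ) := by
        rw [← Real.mul_rpow hn.le (by positivity)]; congr 1; field_simp
      have e2 : (n + 1 : ℝ) ^ (1 - σ) = (n + 1 : ℝ) ^ (-σ) * (n + 1) := by
        rw [show 1 - σ = -σ + 1 by ring, Real.rpow_add hn, Real.rpow_one]
      have := mul_le_mul_of_nonneg_left hb (Real.rpow_nonneg hn.le (1 - σ))
      rw [e]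
      refine this.trans (le_of_eq ?_)
      rw [e2]; field_simp; ring
    push_cast
    rw [le_div_iff₀ (by linarith)] at ih ⊢
    rw [add_comm 1 (n : ℝ)]
    nlinarith

theorem sum_fin_rpow_neg_abs_sub_le {σ : ℝ} (h0 : 0 ≤ σ) (h1 : σ < 1) {n : ℕ} (a : Fin n) :
    ∑ b : Fin n, (1 + |((b : ℕ) : ℝ) - (a : ℕ)|) ^ (-σ) ≤ 2 / (1 - σ) * (n : ℝ) ^ (1 - σ) := by
  have hle : ∑ b : Fin n, (1 + |((b : ℕ) : ℝ) - (a : ℕ)|) ^ (-σ) ≤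
      2 * ∑ c ∈ Finset.range n, (1 + (c : ℝ)) ^ (-σ) := by
    rw [Fin.sum_univ_eq_sum_range (fun b => (1 + |(b : ℝ) - (a : ℕ)|) ^ (-σ)) n, two_mul,
      ← Finset.sum_range_add_sum_Ico _ a.2.le]
    refine add_le_add ?_ ?_
    · rw [← Finset.sum_range_reflect]
      refine (Finset.sum_le_sum (g := fun c : ℕ => (1 + (c : ℝ)) ^ (-σ)) ?_).trans
        (Finset.sum_le_sum_of_subset_of_nonneg
          (Finset.range_subset_range.2 a.2.le) (fun _ _ _ => by positivity))
      intro j hj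
      have hj := Finset.mem_range.1 hj
      refine Real.rpow_le_rpow_of_nonpos (by positivity) ?_ (by linarith)
      have : ((a - 1 - j : ℕ) : ℝ) = a - 1 - j := by
        rw [Nat.sub_sub, Nat.cast_sub (by omega)]; push_cast; ring
      rw [this, abs_of_nonpos (by linarith [j.cast_nonneg (α := ℝ)])]
      linarith
    · rw [Finset.sum_Ico_eq_sum_range]
      refine (Finset.sum_le_sum (g := fun c : ℕ => (1 + (c : ℝ)) ^ (-σ)) ?_).trans
        (Finset.sum_le_sum_of_subset_of_nonneg
          (Finset.range_subset_range.2 (Nat.sub_le _ _)) (fun _ _ _ => by positivity))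
      intro j _
      refine le_of_eq ?_
      congr 1
      push_cast
      rw [add_sub_cancel_left, abs_of_nonneg (Nat.cast_nonneg _)]
  refine hle.trans ?_
  have := sum_range_rpow_neg_le h0 h1 n
  calc _ ≤ 2 * ((n : ℝ) ^ (1 - σ) / (1 - σ)) := by gcongr
    _ = _ := by ring

theorem sum_grid_rpow_neg_le {d : ℕ} (hd : 1 ≤ d) {s : ℝ} (hs : 0 < s) (hsd : s < d) :
    ∃ C : ℝ, 0 < C ∧ ∀ (n : ℕ), 1 ≤ n → ∀ (a : Fin d → Fin n) (r : (Fin d → Fin n) → ℝ),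
      (∀ b, b ≠ a → 1 ≤ r b) → (∀ b c, |((b c : ℕ) : ℝ) - (a c : ℕ)| ≤ r b) →
      ((n : ℝ) ^ d)⁻¹ * ∑ b with b ≠ a, r b ^ (-s) ≤ C * (n : ℝ) ^ (-s) := by
  have hd0 : (0 : ℝ) < d := by exact_mod_cast hd
  set σ := s / d with hσ
  have h0 : 0 ≤ σ := by positivity
  have h1 : σ < 1 := by rw [hσ, div_lt_one hd0]; exact hsd
  have hσd : σ * d = s := by rw [hσ]; field_simp
  have h1' : 0 < 1 - σ := by linarith
  refine ⟨2 ^ s * (2 / (1 - σ)) ^ d, by positivity, fun n hn a r hr1 hr2 => ?_⟩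
  have hn0 : (0 : ℝ) < n := by exact_mod_cast hn
  have key : ∑ b with b ≠ a, r b ^ (-s) ≤
      2 ^ s * ∑ b : Fin d → Fin n, ∏ c, (1 + |((b c : ℕ) : ℝ) - (a c : ℕ)|) ^ (-σ) := by
    rw [Finset.mul_sum]
    refine (Finset.sum_le_sum ?_).trans (Finset.sum_le_sum_of_subset_of_nonneg
      (Finset.filter_subset _ _) fun _ _ _ => ?_)
    · intro b hb
      have hb := hr1 b (Finset.mem_filter.1 hb).2
      rw [Real.finsetProd_rpow _ _ (fun _ _ => by positivity)]
      have hp : ∏ c, (1 + |((b c : ℕ) : ℝ) - (a c : ℕ)|) ≤ (2 * r b) ^ d := by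
        refine (Finset.prod_le_prod (g := fun _ => 2 * r b) (fun _ _ => by positivity)
          fun c _ => ?_).trans (by simp)
        linarith [hr2 b c]
      have hp0 : 0 < ∏ c, (1 + |((b c : ℕ) : ℝ) - (a c : ℕ)|) :=
        Finset.prod_pos fun _ _ => by positivity
      have h3 := Real.rpow_le_rpow_of_nonpos hp0 hp (neg_nonpos.2 h0)
      rw [← Real.rpow_natCast, ← Real.rpow_mul (by positivity),
        show (d : ℝ) * -σ = -s by linarith, Real.mul_rpow (by norm_num) (by linarith)] at h3
      calc r b ^ (-s) = 2 ^ s * (2 ^ (-s) * r b ^ (-s)) := by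
            rw [← mul_assoc, ← Real.rpow_add (by norm_num)]; simp
        _ ≤ _ := by gcongr
    · exact mul_nonneg (by positivity) (Finset.prod_nonneg fun _ _ => by positivity)
  have hprod : ∑ b : Fin d → Fin n, ∏ c, (1 + |((b c : ℕ) : ℝ) - (a c : ℕ)|) ^ (-σ) ≤
      (2 / (1 - σ) * (n : ℝ) ^ (1 - σ)) ^ d := by
    have := Finset.prod_univ_sum (fun _ : Fin d => (Finset.univ : Finset (Fin n)))
      (fun c b => (1 + |((b : ℕ) : ℝ) - (a c : ℕ)|) ^ (-σ))
    rw [Fintype.piFinset_univ] at this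
    rw [← this]
    refine (Finset.prod_le_prod (fun _ _ => Finset.sum_nonneg fun _ _ => by positivity)
      (fun c _ => sum_fin_rpow_neg_abs_sub_le h0 h1 (a c))).trans (by simp)
  calc _ ≤ ((n : ℝ) ^ d)⁻¹ * (2 ^ s * (2 / (1 - σ) * (n : ℝ) ^ (1 - σ)) ^ d) := by
        gcongr; exact key.trans (by gcongr)
    _ = _ := by
        have : ((n : ℝ) ^ (1 - σ)) ^ d = (n : ℝ) ^ d * (n : ℝ) ^ (-s) := by
          rw [← Real.rpow_natCast, ← Real.rpow_mul hn0.le, ← Real.rpow_natCast,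
            ← Real.rpow_add hn0]
          congr 1; linarith
        rw [mul_pow, this]; field_simp

theorem le_sum_fin_sq_sub (n : ℕ) (t : ℝ) :
    (n : ℝ) * (n ^ 2 - 1) / 12 ≤ ∑ a : Fin n, (((a : ℕ) : ℝ) - t) ^ 2 := by
  have h : ∀ n : ℕ, ∑ a ∈ Finset.range n, ((a : ℝ) - t) ^ 2 =
      n * (t - (n - 1) / 2) ^ 2 + n * (n ^ 2 - 1) / 12 := by
    intro n
    induction n with
    | zero => simp
    | succ n ih => rw [Finset.sum_range_succ, ih]; push_cast; ring
  rw [Fin.sum_univ_eq_sum_range (fun a => ((a : ℝ) - t) ^ 2) n, h]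
  have : 0 ≤ (n : ℝ) * (t - (n - 1) / 2) ^ 2 := by positivity
  linarith

theorem le_sum_pi_fin_sq_sub {d n : ℕ} (hn : 2 ≤ n) (c : Fin d) (t : ℝ) :
    (n : ℝ) ^ 2 / 16 ≤ ((n : ℝ) ^ d)⁻¹ * ∑ a : Fin d → Fin n, (((a c : ℕ) : ℝ) - t) ^ 2 := by
  have hn' : (2 : ℝ) ≤ n := by exact_mod_cast hn
  have hprod := Finset.prod_univ_sum (fun _ : Fin d => (Finset.univ : Finset (Fin n)))
    (fun i a => (n : ℝ)⁻¹ * if i = c then (((a : ℕ) : ℝ) - t) ^ 2 else 1)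
  rw [Fintype.piFinset_univ] at hprod
  have hl : ∀ i : Fin d, ∑ a : Fin n, (n : ℝ)⁻¹ * (if i = c then (((a : ℕ) : ℝ) - t) ^ 2 else 1) =
      if i = c then (n : ℝ)⁻¹ * ∑ a : Fin n, (((a : ℕ) : ℝ) - t) ^ 2 else 1 := by
    intro i
    rw [← Finset.mul_sum]
    split_ifs
    · rfl
    · simp; field_simp
  have hr : ∀ a : Fin d → Fin n,
      ∏ i, ((n : ℝ)⁻¹ * if i = c then (((a i : ℕ) : ℝ) - t) ^ 2 else 1) =
      ((n : ℝ) ^ d)⁻¹ * (((a c : ℕ) : ℝ) - t) ^ 2 := by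
    intro a
    rw [Finset.prod_mul_distrib, Finset.prod_ite_eq' Finset.univ c]
    simp
  simp_rw [hl, hr] at hprod
  rw [Finset.prod_ite_eq' Finset.univ c, if_pos (Finset.mem_univ c)] at hprod
  rw [Finset.mul_sum, ← hprod]
  have h1 := le_sum_fin_sq_sub n t
  calc (n : ℝ) ^ 2 / 16 ≤ (n : ℝ)⁻¹ * ((n : ℝ) * (n ^ 2 - 1) / 12) := by
        field_simp; nlinarith
    _ ≤ _ := by gcongr

theorem EuclideanSpace.norm_le_sum_abs {d : ℕ} (v : EuclideanSpace ℝ (Fin d)) :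
    ‖v‖ ≤ ∑ c, |v c| := by
  rw [EuclideanSpace.norm_eq]
  refine Real.sqrt_le_iff.2 ⟨Finset.sum_nonneg fun _ _ => abs_nonneg _, ?_⟩
  exact Finset.sum_sq_le_sq_sum_of_nonneg fun _ _ => abs_nonneg _

theorem EuclideanSpace.abs_apply_le_norm {d : ℕ} (v : EuclideanSpace ℝ (Fin d)) (c : Fin d) :
    |v c| ≤ ‖v‖ := PiLp.norm_apply_le v c

/-- The combinatorial data of a Cantor-type set in `ℝᵈ`: a node of level `i` has diameter
comparable to `scale i` and contains a cubic grid of `(branch i) ^ d` well separated nodes of the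
next level. Nodes of level `depth` are not subdivided. -/
structure GridTree (d : ℕ) (A : ℝ) where
  depth : ℕ
  branch : ℕ → ℕ
  scale : ℕ → ℝ
  two_le_branch : ∀ i, 2 ≤ branch i
  scale_pos : ∀ i, 0 < scale i
  scale_succ_le : ∀ i, A * (d * branch i) * scale (i + 1) ≤ scale i

namespace GridTree

variable {d : ℕ} {A : ℝ} (T : GridTree d A)

/-- The positions of the children inside a node of level `i`. -/
abbrev Digit (i : ℕ) : Type := Fin d → Fin (T.branch i)

/-- The finest nodes, encoded by the positions of their ancestors. -/
abbrev Address : Type := (i : Fin T.depth) → T.Digit i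

/-- The proportion of the finest nodes contained in a given node of level `i`. -/
def prob (i : ℕ) : ℝ := ∏ j ∈ Finset.range i, ((T.branch j : ℝ) ^ d)⁻¹

/-- The distance between neighbouring children of a node of level `i`. -/
def step (i : ℕ) : ℝ := T.scale i / (d * T.branch i)

/-- The child positions as points of the integer lattice, centred at the origin. -/
def vec (i : ℕ) (a : T.Digit i) : EuclideanSpace ℝ (Fin d) :=
  WithLp.toLp 2 fun c => ((a c : ℕ) : ℝ) - ((T.branch i : ℝ) - 1) / 2

/-- The displacement of the node of level `i + 1` relative to its parent. -/
def offset (i : ℕ) (ω : T.Address) : EuclideanSpace ℝ (Fin d) :=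
  if h : i < T.depth then T.step i • T.vec i (ω ⟨i, h⟩) else 0

/-- The centre of the ancestor of level `j`. -/
def centre (j : ℕ) (ω : T.Address) : EuclideanSpace ℝ (Fin d) :=
  ∑ i ∈ Finset.range j, T.offset i ω

/-- The centre of a finest node. -/
def point (ω : T.Address) : EuclideanSpace ℝ (Fin d) := T.centre T.depth ω

/-- The paths to `ω` and `ω'` separate exactly at level `k`. -/
def Splits (k : Fin T.depth) (ω ω' : T.Address) : Prop :=
  (∀ i < k, ω i = ω' i) ∧ ω k ≠ ω' k

theorem prob_zero : T.prob 0 = 1 := by simp [prob]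

theorem prob_succ (i : ℕ) : T.prob (i + 1) = T.prob i * ((T.branch i : ℝ) ^ d)⁻¹ := by
  rw [prob, Finset.prod_range_succ, prob]

theorem branch_pos (i : ℕ) : (0 : ℝ) < T.branch i := by
  have := T.two_le_branch i
  exact_mod_cast (by omega : 0 < T.branch i)

theorem two_le_branch_real (i : ℕ) : (2 : ℝ) ≤ T.branch i := by
  exact_mod_cast T.two_le_branch i

theorem prob_pos (i : ℕ) : 0 < T.prob i :=
  Finset.prod_pos fun j _ => inv_pos.2 (pow_pos (T.branch_pos j) _)

theorem step_pos (hd : 1 ≤ d) (i : ℕ) : 0 < T.step i := by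
  have := T.branch_pos i
  have := T.scale_pos i
  have : (0 : ℝ) < d := by exact_mod_cast hd
  unfold step; positivity

theorem mul_scale_succ_le_step (hd : 1 ≤ d) (i : ℕ) : A * T.scale (i + 1) ≤ T.step i := by
  have := T.branch_pos i
  have : (0 : ℝ) < d := by exact_mod_cast hd
  rw [step, le_div_iff₀ (by positivity)]
  linarith [T.scale_succ_le i]

theorem step_le_half_scale (hd : 1 ≤ d) (i : ℕ) : T.step i ≤ T.scale i / 2 := by
  have h1 : (1 : ℝ) ≤ d := by exact_mod_cast hd
  have h2 := T.two_le_branch_real i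
  have := T.scale_pos i
  unfold step
  gcongr
  nlinarith

theorem scale_succ_le_half (hd : 1 ≤ d) (hA : 8 ≤ A) (i : ℕ) :
    T.scale (i + 1) ≤ T.scale i / 2 := by
  have h1 := T.mul_scale_succ_le_step hd i
  have h2 := T.step_le_half_scale hd i
  have h3 := T.scale_pos (i + 1)
  nlinarith

theorem scale_add_le (hd : 1 ≤ d) (hA : 8 ≤ A) (i m : ℕ) :
    T.scale (i + m) ≤ (1 / 2) ^ m * T.scale i := by
  induction m with
  | zero => simp
  | succ m ih =>
    have := T.scale_succ_le_half hd hA (i + m)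
    rw [pow_succ, ← add_assoc]
    linarith

theorem scale_anti (hd : 1 ≤ d) (hA : 8 ≤ A) : Antitone T.scale :=
  antitone_nat_of_succ_le fun i => by
    linarith [T.scale_succ_le_half hd hA i, T.scale_pos i]

theorem scale_le_mul_step (hd : 1 ≤ d) (hA : 8 ≤ A) {k j : ℕ} (hkj : k < j) :
    T.scale j ≤ 2 / A * (1 / 2) ^ (j - k) * T.step k := by
  obtain ⟨m, rfl⟩ : ∃ m, j = k + 1 + m := ⟨j - (k + 1), by omega⟩
  have h1 := T.scale_add_le hd hA (k + 1) m
  have h2 := T.mul_scale_succ_le_step hd k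
  have hA0 : 0 < A := by linarith
  have h3 : T.scale (k + 1) ≤ T.step k / A := by rw [le_div_iff₀ hA0]; linarith
  rw [show k + 1 + m - k = m + 1 by omega, pow_succ]
  calc _ ≤ (1 / 2) ^ m * (T.step k / A) := h1.trans (by gcongr)
    _ = _ := by field_simp

theorem norm_vec_le (i : ℕ) (a : T.Digit i) : ‖T.vec i a‖ ≤ d * T.branch i / 2 := by
  refine (EuclideanSpace.norm_le_sum_abs _).trans ?_
  have : ∀ c, |T.vec i a c| ≤ (T.branch i : ℝ) / 2 := by
    intro c
    have h1 : ((a c : ℕ) : ℝ) + 1 ≤ T.branch i := by exact_mod_cast (a c).2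
    have h2 : (0 : ℝ) ≤ (a c : ℕ) := Nat.cast_nonneg _
    simp only [vec]
    rw [abs_le]; constructor <;> linarith
  refine (Finset.sum_le_sum fun c _ => this c).trans ?_
  simp [mul_div_assoc]

theorem vec_sub_apply (i : ℕ) (a b : T.Digit i) (c : Fin d) :
    (T.vec i b - T.vec i a) c = ((b c : ℕ) : ℝ) - (a c : ℕ) := by
  simp [vec]

theorem abs_sub_le_norm_vec_sub (i : ℕ) (a b : T.Digit i) (c : Fin d) :
    |((b c : ℕ) : ℝ) - (a c : ℕ)| ≤ ‖T.vec i b - T.vec i a‖ := by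
  rw [← T.vec_sub_apply]
  exact EuclideanSpace.abs_apply_le_norm _ c

theorem one_le_norm_vec_sub (i : ℕ) {a b : T.Digit i} (hab : b ≠ a) :
    1 ≤ ‖T.vec i b - T.vec i a‖ := by
  obtain ⟨c, hc⟩ := Function.ne_iff.1 hab
  refine le_trans ?_ (T.abs_sub_le_norm_vec_sub i a b c)
  have h : ((b c : ℕ) : ℤ) - (a c : ℕ) ≠ 0 := by
    have : (b c : ℕ) ≠ (a c : ℕ) := fun h => hc (Fin.ext h)
    omega
  exact_mod_cast Int.one_le_abs h

theorem norm_offset_le (hd : 1 ≤ d) (i : ℕ) (ω : T.Address) :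
    ‖T.offset i ω‖ ≤ T.scale i / 2 := by
  have h0 := T.scale_pos i
  have hb := T.branch_pos i
  have hd0 : (0 : ℝ) < d := by exact_mod_cast hd
  unfold offset
  split_ifs with h
  · rw [norm_smul, Real.norm_of_nonneg (T.step_pos hd i).le]
    calc _ ≤ T.step i * (d * T.branch i / 2) :=
          mul_le_mul_of_nonneg_left (T.norm_vec_le i _) (T.step_pos hd i).le
      _ = _ := by unfold step; field_simp
  · simp; positivity

theorem centre_succ (j : ℕ) (ω : T.Address) :
    T.centre (j + 1) ω = T.centre j ω + T.offset j ω := by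
  rw [centre, Finset.sum_range_succ, centre]

theorem norm_centre_sub_le (hd : 1 ≤ d) (hA : 8 ≤ A) {j m : ℕ} (hjm : j ≤ m) (ω : T.Address) :
    ‖T.centre m ω - T.centre j ω‖ ≤ T.scale j - T.scale m := by
  induction m, hjm using Nat.le_induction with
  | base => simp
  | succ m _ ih =>
    have h1 := T.norm_offset_le hd m ω
    have h2 := T.scale_succ_le_half hd hA m
    rw [centre_succ, add_sub_right_comm]
    refine (norm_add_le _ _).trans ?_
    linarith

theorem norm_point_sub_centre_le (hd : 1 ≤ d) (hA : 8 ≤ A) {j : ℕ} (hj : j ≤ T.depth)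
    (ω : T.Address) : ‖T.point ω - T.centre j ω‖ ≤ T.scale j := by
  have := T.norm_centre_sub_le hd hA hj ω
  have := T.scale_pos T.depth
  unfold point; linarith

theorem offset_congr {k : ℕ} {ω ω' : T.Address} (h : ∀ i : Fin T.depth, i.1 = k → ω i = ω' i) :
    T.offset k ω = T.offset k ω' := by
  unfold offset
  split_ifs with hk
  · rw [h ⟨k, hk⟩ rfl]
  · rfl

theorem centre_congr {j : ℕ} {ω ω' : T.Address} (h : ∀ i : Fin T.depth, i.1 < j → ω i = ω' i) :
    T.centre j ω = T.centre j ω' :=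
  Finset.sum_congr rfl fun k hk => T.offset_congr fun i hi => h i (by
    have := Finset.mem_range.1 hk; omega)

variable {T} in
theorem Splits.symm {k : Fin T.depth} {ω ω' : T.Address} (h : T.Splits k ω ω') :
    T.Splits k ω' ω := ⟨fun i hi => (h.1 i hi).symm, h.2.symm⟩

theorem exists_splits {ω ω' : T.Address} (h : ω ≠ ω') : ∃ k, T.Splits k ω ω' := by
  classical
  obtain ⟨k, hk, hmin⟩ := WellFounded.has_min (wellFounded_lt (α := Fin T.depth))
    {k | ω k ≠ ω' k} (Function.ne_iff.1 h)
  exact ⟨k, fun i hi => not_not.1 fun hne => hmin i hne hi, hk⟩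

theorem splits_unique {k l : Fin T.depth} {ω ω' : T.Address} (h : T.Splits k ω ω')
    (h' : T.Splits l ω ω') : k = l := by
  rcases lt_trichotomy k l with hkl | hkl | hkl
  · exact absurd (h'.1 k hkl) h.2
  · exact hkl
  · exact absurd (h.1 l hkl) h'.2

theorem centre_sub_of_splits {k : Fin T.depth} {ω ω' : T.Address} (h : T.Splits k ω ω') :
    T.centre (k + 1) ω' - T.centre (k + 1) ω =
      T.step k • (T.vec k (ω' k) - T.vec k (ω k)) := by
  have e : T.centre k ω' = T.centre k ω := T.centre_congr fun i hi => (h.1 i hi).symm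
  have e2 : ∀ η : T.Address, T.offset k η = T.step k • T.vec k (η k) := fun η => by
    simp [offset]
  rw [centre_succ, centre_succ, e, e2, e2, smul_sub]; abel

theorem norm_sub_smul_le_of_splits (hd : 1 ≤ d) (hA : 8 ≤ A) {k : Fin T.depth}
    {ω ω' : T.Address} (h : T.Splits k ω ω') {x : EuclideanSpace ℝ (Fin d)}
    (hx : ‖x - T.centre (k + 1) ω‖ ≤ 2 * T.scale (k + 1)) :
    ‖(T.point ω' - x) - T.step k • (T.vec k (ω' k) - T.vec k (ω k))‖ ≤ T.step k / 2 := by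
  rw [← T.centre_sub_of_splits h]
  have h1 := T.norm_point_sub_centre_le hd hA (j := k + 1) k.2 ω'
  have h2 := T.mul_scale_succ_le_step hd k
  have h3 := T.scale_pos (k + 1)
  have e : (T.point ω' - x) - (T.centre (k + 1) ω' - T.centre (k + 1) ω) =
    (T.point ω' - T.centre (k + 1) ω') - (x - T.centre (k + 1) ω) := by abel
  rw [e]
  refine (norm_sub_le _ _).trans ?_
  nlinarith

theorem norm_bounds_of_splits (hd : 1 ≤ d) (hA : 8 ≤ A) {k : Fin T.depth}
    {ω ω' : T.Address} (h : T.Splits k ω ω') {x : EuclideanSpace ℝ (Fin d)}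
    (hx : ‖x - T.centre (k + 1) ω‖ ≤ 2 * T.scale (k + 1)) :
    T.step k / 2 * ‖T.vec k (ω' k) - T.vec k (ω k)‖ ≤ ‖T.point ω' - x‖ ∧
    ‖T.point ω' - x‖ ≤ 2 * T.step k * ‖T.vec k (ω' k) - T.vec k (ω k)‖ := by
  have h1 := T.norm_sub_smul_le_of_splits hd hA h hx
  have h2 := T.one_le_norm_vec_sub k h.2.symm
  have h3 := T.step_pos hd k
  have h4 : ‖T.step k • (T.vec k (ω' k) - T.vec k (ω k))‖ =
      T.step k * ‖T.vec k (ω' k) - T.vec k (ω k)‖ := by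
    rw [norm_smul, Real.norm_of_nonneg h3.le]
  have h5 := norm_sub_norm_le (T.step k • (T.vec k (ω' k) - T.vec k (ω k))) (T.point ω' - x)
  have h6 := norm_sub_norm_le (T.point ω' - x) (T.step k • (T.vec k (ω' k) - T.vec k (ω k)))
  rw [norm_sub_rev (T.step k • (T.vec k (ω' k) - T.vec k (ω k)))] at h5
  constructor <;> nlinarith

open Classical in
theorem prob_mul_sum_prefix (k : Fin T.depth) (ω : T.Address) (φ : T.Digit k → ℝ) :
    T.prob T.depth * ∑ ω' : T.Address, (if ∀ i < k, ω i = ω' i then φ (ω' k) else 0) =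
      T.prob k * (((T.branch k : ℝ) ^ d)⁻¹ * ∑ a, φ a) := by
  set Φ : (i : Fin T.depth) → T.Digit i → ℝ := Function.update (fun _ _ => 0) k φ with hΦ
  have hΦk : Φ k = φ := Function.update_self ..
  set w : Fin T.depth → ℝ := fun i => ((T.branch i : ℝ) ^ d)⁻¹ with hw
  set f : (i : Fin T.depth) → T.Digit i → ℝ := fun i a =>
    w i * (if i < k then (if ω i = a then 1 else 0) else if i = k then Φ i a else 1) with hf
  have hprod := Finset.prod_univ_sum (fun i : Fin T.depth => (Finset.univ : Finset (T.Digit i))) f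
  rw [Fintype.piFinset_univ] at hprod
  have hcard : ∀ i : Fin T.depth, w i * ∑ _a : T.Digit i, (1 : ℝ) = 1 := by
    intro i
    have := T.branch_pos i
    simp only [hw, Finset.sum_const, Finset.card_univ, Fintype.card_pi, Fintype.card_fin,
      Finset.prod_const, nsmul_eq_mul, mul_one, Nat.cast_pow]
    field_simp
  have hL : T.prob T.depth = ∏ i : Fin T.depth, w i := by
    rw [prob, Finset.prod_range]
  have hright : ∑ x : T.Address, ∏ i, f i (x i) =
      T.prob T.depth * ∑ ω' : T.Address, (if ∀ i < k, ω i = ω' i then φ (ω' k) else 0) := by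
    rw [Finset.mul_sum]
    refine Finset.sum_congr rfl fun x _ => ?_
    simp only [hf]
    rw [Finset.prod_mul_distrib, ← hL]
    congr 1
    split_ifs with h
    · rw [Finset.prod_eq_single k]
      · simp [hΦk]
      · intro b _ hbk
        by_cases hb : b < k
        · simp [hb, h b hb]
        · simp [hb, hbk]
      · simp
    · push Not at h
      obtain ⟨i, hi, hne⟩ := h
      exact Finset.prod_eq_zero (Finset.mem_univ i) (by simp [hi, hne])
  rw [← hright, ← hprod]
  have hfac : ∀ i : Fin T.depth, ∑ a, f i a =
      (if i < k then w i else 1) * (if i = k then w k * ∑ a, φ a else 1) := by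
    intro i
    rcases lt_trichotomy i k with h | h | h
    · simp only [hf, h, h.ne, if_true, if_false, ← Finset.mul_sum]
      simp
    · subst h
      simp [hf, ← Finset.mul_sum, hΦk]
    · simp only [hf, h.not_gt, h.ne', if_false, ← Finset.mul_sum]
      simpa using hcard i
  simp_rw [hfac]
  rw [Finset.prod_mul_distrib, Finset.prod_ite_eq' Finset.univ k]
  simp only [Finset.mem_univ, if_true]
  congr 1
  rw [prob, ← Fin.prod_univ_eq_prod_range (fun i => ((T.branch i : ℝ) ^ d)⁻¹),
    Finset.prod_ite, Finset.prod_const_one, mul_one]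
  symm
  refine Finset.prod_bij (fun (a : Fin (k : ℕ)) _ => (⟨a, a.2.trans k.2⟩ : Fin T.depth)) ?_ ?_ ?_ ?_
  · intro a _; simp only [Finset.mem_filter, Finset.mem_univ, true_and]; exact a.2
  · intro a _ b _ h; simpa [Fin.ext_iff] using h
  · intro b hb; exact ⟨⟨b, (Finset.mem_filter.1 hb).2⟩, Finset.mem_univ _, rfl⟩
  · intro a _; rfl

theorem card_address : T.prob T.depth * Fintype.card T.Address = 1 := by
  have hL : T.prob T.depth = ∏ i : Fin T.depth, ((T.branch i : ℝ) ^ d)⁻¹ := by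
    rw [prob, Finset.prod_range]
  rw [hL, Fintype.card_pi, Nat.cast_prod, ← Finset.prod_mul_distrib]
  refine Finset.prod_eq_one fun i _ => ?_
  have := T.branch_pos i
  simp only [Fintype.card_pi, Fintype.card_fin, Finset.prod_const, Finset.card_univ, Nat.cast_pow]
  field_simp

end GridTree

section Moments

variable {Ω V : Type*} [Fintype Ω] [NormedAddCommGroup V] [InnerProductSpace ℝ V]

theorem norm_add_pow_four_add_norm_sub_pow_four_le (y x : V) :
    ‖y + x‖ ^ 4 + ‖y - x‖ ^ 4 ≤ 2 * (‖y‖ ^ 4 + 6 * (‖y‖ ^ 2 * ‖x‖ ^ 2) + ‖x‖ ^ 4) := by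
  have h1 := norm_add_sq_real y x
  have h2 := norm_sub_sq_real y x
  have h3 := abs_real_inner_le_norm y x
  have h4 : (inner ℝ y x) ^ 2 ≤ ‖y‖ ^ 2 * ‖x‖ ^ 2 := by
    rw [← mul_pow, ← sq_abs]; gcongr
  calc _ = (‖y + x‖ ^ 2) ^ 2 + (‖y - x‖ ^ 2) ^ 2 := by ring
    _ ≤ _ := by rw [h1, h2]; nlinarith

/-- Second and fourth moment bounds for sums of vectors that can be flipped independently. -/
theorem sum_norm_pow_le_of_flip (X : ℕ → Ω → V) (σ : ℕ → Ω ≃ Ω) (b : ℕ → ℝ)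
    (hneg : ∀ j ω, X j (σ j ω) = -X j ω) (hfix : ∀ j, ∀ i < j, ∀ ω, X i (σ j ω) = X i ω)
    (hb : ∀ j ω, ‖X j ω‖ ≤ b j) (m : ℕ) :
    ∑ ω, ‖∑ i ∈ Finset.range m, X i ω‖ ^ 2 ≤
        Fintype.card Ω * ∑ i ∈ Finset.range m, b i ^ 2 ∧
      ∑ ω, ‖∑ i ∈ Finset.range m, X i ω‖ ^ 4 ≤
        Fintype.card Ω * (3 * (∑ i ∈ Finset.range m, b i ^ 2) ^ 2) := by
  induction m with
  | zero => simp
  | succ m ih =>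
    set Y : Ω → V := fun ω => ∑ i ∈ Finset.range m, X i ω with hY
    set S := ∑ i ∈ Finset.range m, b i ^ 2 with hS
    have hS0 : 0 ≤ S := Finset.sum_nonneg fun _ _ => sq_nonneg _
    have hYσ : ∀ ω, Y (σ m ω) = Y ω := fun ω =>
      Finset.sum_congr rfl fun i hi => hfix m i (Finset.mem_range.1 hi) ω
    have hflip : ∀ n : ℕ, ∑ ω, ‖Y ω + X m ω‖ ^ n = ∑ ω, ‖Y ω - X m ω‖ ^ n := by
      intro n
      rw [← Equiv.sum_comp (σ m)]
      simp [hYσ, hneg, sub_eq_add_neg]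
    have hx2 : ∀ ω, ‖X m ω‖ ^ 2 ≤ b m ^ 2 := fun ω =>
      pow_le_pow_left₀ (norm_nonneg _) (hb m ω) 2
    have hx4 : ∀ ω, ‖X m ω‖ ^ 4 ≤ (b m ^ 2) ^ 2 := fun ω => by
      have := pow_le_pow_left₀ (sq_nonneg _) (hx2 ω) 2
      calc _ = (‖X m ω‖ ^ 2) ^ 2 := by ring
        _ ≤ _ := this
    simp_rw [Finset.sum_range_succ]
    change ∑ ω, ‖Y ω + X m ω‖ ^ 2 ≤ _ ∧ ∑ ω, ‖Y ω + X m ω‖ ^ 4 ≤ _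
    have h2 : ∑ ω, ‖Y ω + X m ω‖ ^ 2 ≤ Fintype.card Ω * (S + b m ^ 2) := by
      have : ∑ ω, ‖Y ω + X m ω‖ ^ 2 + ∑ ω, ‖Y ω - X m ω‖ ^ 2 ≤
          2 * (∑ ω, ‖Y ω‖ ^ 2 + ∑ _ω : Ω, b m ^ 2) := by
        rw [← Finset.sum_add_distrib, ← Finset.sum_add_distrib, Finset.mul_sum]
        refine Finset.sum_le_sum fun ω _ => ?_
        have := parallelogram_law_with_norm ℝ (Y ω) (X m ω)
        nlinarith [hx2 ω]
      rw [← hflip] at this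
      simp only [Finset.sum_const, Finset.card_univ, nsmul_eq_mul] at this
      nlinarith [ih.1]
    refine ⟨h2, ?_⟩
    have : ∑ ω, ‖Y ω + X m ω‖ ^ 4 + ∑ ω, ‖Y ω - X m ω‖ ^ 4 ≤
        2 * (∑ ω, ‖Y ω‖ ^ 4 + 6 * (b m ^ 2 * ∑ ω, ‖Y ω‖ ^ 2) + ∑ _ω : Ω, (b m ^ 2) ^ 2) := by
      rw [← Finset.sum_add_distrib, Finset.mul_sum, Finset.mul_sum, ← Finset.sum_add_distrib,
        ← Finset.sum_add_distrib, Finset.mul_sum]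
      refine Finset.sum_le_sum fun ω _ => ?_
      have h5 := norm_add_pow_four_add_norm_sub_pow_four_le (Y ω) (X m ω)
      have h6 := mul_le_mul_of_nonneg_left (hx2 ω) (sq_nonneg ‖Y ω‖)
      nlinarith [hx4 ω]
    rw [← hflip] at this
    simp only [Finset.sum_const, Finset.card_univ, nsmul_eq_mul] at this
    have h7 := mul_le_mul_of_nonneg_left ih.1 (sq_nonneg (b m))
    have h8 : (0 : ℝ) ≤ Fintype.card Ω * (b m ^ 2) ^ 2 := by positivity
    nlinarith [ih.2]

/-- A Paley–Zygmund type inequality: correlation with a vector having bounded fourth moment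
forces `F` to be large on a set of positive proportion. -/
theorem le_card_of_correlation {c C p S : ℝ} (hc : 0 < c) (hC : 0 < C) (hp : 0 < p)
    (hS : 0 < S) (hcard : p * Fintype.card Ω = 1) (F Y : Ω → V)
    (h1 : c * S ≤ p * ∑ ω, inner ℝ (F ω) (Y ω)) (h2 : p * ∑ ω, ‖F ω‖ ^ 2 ≤ C * S)
    (h3 : p * ∑ ω, ‖Y ω‖ ^ 2 ≤ S) (h4 : p * ∑ ω, ‖Y ω‖ ^ 4 ≤ 3 * S ^ 2) :
    c ^ 4 / (12 * C ^ 2) ≤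
      p * (Finset.univ.filter fun ω => (c / 4) ^ 2 * S ≤ ‖F ω‖ ^ 2).card := by
  classical
  set l := c / (2 * C) with hl
  set μ := l * c / 3 with hμ
  have hl0 : 0 < l := by positivity
  have hμ0 : 0 < μ := by positivity
  have hpt : ∀ ω, inner ℝ (F ω) (Y ω) ≤ c / 8 * (S + ‖Y ω‖ ^ 2) + l / 2 * ‖F ω‖ ^ 2 +
      (μ / (4 * l * S) * ‖Y ω‖ ^ 4 +
        S / (4 * l * μ) * if (c / 4) ^ 2 * S ≤ ‖F ω‖ ^ 2 then 1 else 0) := by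
    intro ω
    refine (real_inner_le_norm _ _).trans ?_
    set f := ‖F ω‖
    set y := ‖Y ω‖
    have hf : 0 ≤ f := norm_nonneg _
    have hy : 0 ≤ y := norm_nonneg _
    split_ifs with h
    · have e1 : f * y ≤ l / 2 * f ^ 2 + y ^ 2 / (2 * l) := by
        have := sq_nonneg (l * f - y)
        rw [← sub_nonneg]
        have e : l / 2 * f ^ 2 + y ^ 2 / (2 * l) - f * y = (l * f - y) ^ 2 / (2 * l) := by
          field_simp; ring
        rw [e]; positivity
      have e2 : y ^ 2 / (2 * l) ≤ μ / (4 * l * S) * y ^ 4 + S / (4 * l * μ) * 1 := by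
        rw [← sub_nonneg]
        have e : μ / (4 * l * S) * y ^ 4 + S / (4 * l * μ) * 1 - y ^ 2 / (2 * l) =
            (μ * y ^ 2 - S) ^ 2 / (4 * l * S * μ) := by
          field_simp; ring
        rw [e]; positivity
      have e3 : 0 ≤ c / 8 * (S + y ^ 2) := by positivity
      linarith
    · have h := not_le.1 h
      have e1 : f * y ≤ c / 8 * (S + y ^ 2) := by
        have := sq_nonneg (4 / c * f - y)
        have e : (4 / c * f - y) ^ 2 = 16 / c ^ 2 * f ^ 2 - 8 / c * (f * y) + y ^ 2 := by
          field_simp; ring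
        have h' : 16 / c ^ 2 * f ^ 2 ≤ S := by
          calc 16 / c ^ 2 * f ^ 2 ≤ 16 / c ^ 2 * ((c / 4) ^ 2 * S) := by gcongr
            _ = S := by field_simp; ring
        have h'' : 8 / c * (f * y) ≤ S + y ^ 2 := by linarith
        calc f * y = c / 8 * (8 / c * (f * y)) := by field_simp
          _ ≤ _ := by gcongr
      have e2 : 0 ≤ l / 2 * f ^ 2 + (μ / (4 * l * S) * y ^ 4 + S / (4 * l * μ) * 0) := by
        positivity
      linarith
  have hsum := mul_le_mul_of_nonneg_left (Finset.sum_le_sum fun ω (_ : ω ∈ Finset.univ) => hpt ω)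
    hp.le
  simp only [Finset.sum_add_distrib, ← Finset.mul_sum, Finset.sum_const, Finset.card_univ,
    nsmul_eq_mul, Finset.sum_boole] at hsum
  set G : ℝ := ((Finset.univ.filter fun ω => (c / 4) ^ 2 * S ≤ ‖F ω‖ ^ 2).card : ℝ)
  have key : c * S ≤ c / 8 * (S + S) + l / 2 * (C * S) +
      (μ / (4 * l * S) * (3 * S ^ 2) + S / (4 * l * μ) * (p * G)) := by
    refine h1.trans (hsum.trans ?_)
    have a1 : 0 ≤ μ / (4 * l * S) := by positivity
    have a2 := mul_le_mul_of_nonneg_left h4 a1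
    have a3 := mul_le_mul_of_nonneg_left h2 (show 0 ≤ l / 2 by positivity)
    have a4 := mul_le_mul_of_nonneg_left h3 (show 0 ≤ c / 8 by positivity)
    have a5 : p * (Fintype.card Ω * S) = S := by rw [← mul_assoc, hcard, one_mul]
    have a6 : p * (c / 8 * (Fintype.card Ω * S + ∑ ω, ‖Y ω‖ ^ 2)) ≤ c / 8 * (S + S) := by
      nlinarith
    nlinarith
  have e1 : l / 2 * (C * S) = c / 4 * S := by rw [hl]; field_simp; ring
  have e2 : μ / (4 * l * S) * (3 * S ^ 2) = c / 4 * S := by rw [hμ]; field_simp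
  have e3 : c ^ 4 / (12 * C ^ 2) = c * (l * μ) := by rw [hμ, hl]; field_simp; ring
  rw [e1, e2] at key
  have key2 : c / 4 * S ≤ S / (4 * l * μ) * (p * G) := by linarith
  rw [e3]
  have := mul_le_mul_of_nonneg_left key2 (show 0 ≤ 4 * l * μ / S by positivity)
  calc c * (l * μ) = 4 * l * μ / S * (c / 4 * S) := by field_simp
    _ ≤ _ := this
    _ = p * G := by field_simp

end Moments

theorem sum_fin_half_pow_dist_le {n : ℕ} (k : Fin n) :
    ∑ j : Fin n, (1 / 2 : ℝ) ^ ((j - k : ℕ) + (k - j : ℕ)) ≤ 4 := by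
  have hg : ∀ m : ℕ, ∑ i ∈ Finset.range m, (1 / 2 : ℝ) ^ i ≤ 2 := fun m => by
    rw [geom_sum_eq (by norm_num)]
    have : (0 : ℝ) ≤ (1 / 2) ^ m := by positivity
    rw [div_le_iff_of_neg (by norm_num)]
    linarith
  rw [Fin.sum_univ_eq_sum_range (fun j => (1 / 2 : ℝ) ^ ((j - k : ℕ) + (k - j : ℕ))) n,
    ← Finset.sum_range_add_sum_Ico _ k.2.le]
  have h1 : ∑ j ∈ Finset.range k, (1 / 2 : ℝ) ^ ((j - k : ℕ) + (k - j : ℕ)) ≤ 2 := by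
    rw [← Finset.sum_range_reflect]
    refine (Finset.sum_le_sum fun j hj => ?_).trans (hg k)
    have := Finset.mem_range.1 hj
    exact pow_le_pow_of_le_one (by norm_num) (by norm_num) (by omega)
  have h2 : ∑ j ∈ Finset.Ico (k : ℕ) n, (1 / 2 : ℝ) ^ ((j - k : ℕ) + (k - j : ℕ)) ≤ 2 := by
    rw [Finset.sum_Ico_eq_sum_range]
    refine (Finset.sum_le_sum fun j _ => ?_).trans (hg (n - k))
    exact pow_le_pow_of_le_one (by norm_num) (by norm_num) (by omega)
  linarith

theorem sum_sum_half_pow_dist_le {n : ℕ} (θ : Fin n → ℝ) :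
    ∑ k : Fin n, ∑ j : Fin n, θ k * θ j * (1 / 2 : ℝ) ^ ((j - k : ℕ) + (k - j : ℕ)) ≤ 4 * ∑ k : Fin n, θ k ^ 2 := by
  have h : ∀ k j : Fin n, θ k * θ j * (1 / 2 : ℝ) ^ ((j - k : ℕ) + (k - j : ℕ)) ≤
      θ k ^ 2 / 2 * (1 / 2 : ℝ) ^ ((j - k : ℕ) + (k - j : ℕ)) +
      θ j ^ 2 / 2 * (1 / 2 : ℝ) ^ ((k - j : ℕ) + (j - k : ℕ)) := by
    intro k j
    rw [add_comm (k - j : ℕ), ← add_mul]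
    gcongr
    nlinarith [sq_nonneg (θ k - θ j)]
  have hd : ∑ k : Fin n, ∑ j : Fin n, θ k ^ 2 / 2 * (1 / 2 : ℝ) ^ ((j - k : ℕ) + (k - j : ℕ)) ≤
      2 * ∑ k : Fin n, θ k ^ 2 := by
    rw [Finset.mul_sum]
    refine Finset.sum_le_sum fun k _ => ?_
    rw [← Finset.mul_sum]
    have := mul_le_mul_of_nonneg_left (sum_fin_half_pow_dist_le k)
      (show 0 ≤ θ k ^ 2 / 2 by positivity)
    linarith
  calc _ ≤ ∑ k : Fin n, ∑ j : Fin n, (θ k ^ 2 / 2 * (1 / 2 : ℝ) ^ ((j - k : ℕ) + (k - j : ℕ)) +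
      θ j ^ 2 / 2 * (1 / 2 : ℝ) ^ ((k - j : ℕ) + (j - k : ℕ))) :=
        Finset.sum_le_sum fun k _ => Finset.sum_le_sum fun j _ => h k j
    _ ≤ _ := by
        simp_rw [Finset.sum_add_distrib]
        rw [Finset.sum_comm (f := fun k j : Fin n => θ j ^ 2 / 2 * _)]
        linarith

namespace GridTree

variable {d : ℕ} {A : ℝ} (T : GridTree d A)

/-- The size of the `s`-Riesz transform produced at level `i`. -/
def density (s : ℝ) (i : ℕ) : ℝ := T.prob i * T.scale i ^ (-s)

theorem density_pos (s : ℝ) (i : ℕ) : 0 < T.density s i :=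
  mul_pos (T.prob_pos i) (Real.rpow_pos_of_pos (T.scale_pos i) _)

open Classical in
/-- The Riesz transform at `x` of the part of the uniform probability measure on the finest
centres carried by the nodes which separate from `ω` at level `k`. -/
def field (s : ℝ) (k : Fin T.depth) (ω : T.Address) (x : EuclideanSpace ℝ (Fin d)) :
    EuclideanSpace ℝ (Fin d) :=
  T.prob T.depth • ∑ ω' with T.Splits k ω ω', rieszKernel d s (T.point ω' - x)

theorem field_congr {s : ℝ} {k : Fin T.depth} {ω η : T.Address} (h : ∀ i ≤ k, ω i = η i)
    (x : EuclideanSpace ℝ (Fin d)) : T.field s k ω x = T.field s k η x := by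
  classical
  unfold field
  congr 1
  refine Finset.sum_congr (Finset.filter_congr fun ω' _ => ?_) fun _ _ => rfl
  unfold Splits
  rw [h k le_rfl]
  refine and_congr_left fun _ => forall₂_congr fun i hi => ?_
  rw [h i hi.le]

open Classical in
theorem prob_mul_sum_splits (k : Fin T.depth) (ω : T.Address) (φ : T.Digit k → ℝ) :
    T.prob T.depth * ∑ ω' with T.Splits k ω ω', φ (ω' k) =
      T.prob k * (((T.branch k : ℝ) ^ d)⁻¹ * ∑ a with a ≠ ω k, φ a) := by
  have h := T.prob_mul_sum_prefix k ω (fun a => if a ≠ ω k then φ a else 0)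
  rw [← Finset.sum_filter (fun a => a ≠ ω k)] at h
  rw [← h, Finset.sum_filter]
  congr 1
  refine Finset.sum_congr rfl fun ω' _ => ?_
  unfold Splits
  by_cases h1 : ∀ i < k, ω i = ω' i
  · by_cases h2 : ω k = ω' k
    · simp [h2]
    · simp only [h2, if_true, not_false_eq_true, ne_eq, Ne.symm h2]
      simp
  · simp [h1]

theorem step_mul_branch (hd : 1 ≤ d) (i : ℕ) : T.step i * (d * T.branch i) = T.scale i := by
  have := T.branch_pos i
  have : (0 : ℝ) < d := by exact_mod_cast hd
  unfold step; field_simp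

theorem exists_field_bounds (hd : 1 ≤ d) {s : ℝ} (hs : 0 < s) (hsd : s < d) :
    ∃ C : ℝ, 0 < C ∧ ∀ {A : ℝ} (_ : 8 ≤ A) (T : GridTree d A) (k : Fin T.depth) (ω : T.Address)
      (x y : EuclideanSpace ℝ (Fin d)), ‖x - T.centre (k + 1) ω‖ ≤ 2 * T.scale (k + 1) →
      ‖y - T.centre (k + 1) ω‖ ≤ 2 * T.scale (k + 1) →
      ‖T.field s k ω x‖ ≤ C * T.density s k ∧
      ‖T.field s k ω x - T.field s k ω y‖ ≤ C * T.density s k * (‖x - y‖ / T.step k) := by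
  classical
  obtain ⟨C₁, hC₁, hgrid⟩ := sum_grid_rpow_neg_le hd hs hsd
  have hd0 : (0 : ℝ) < d := by exact_mod_cast hd
  refine ⟨C₁ * (2 * d) ^ s * (2 * (5 + 4 * s)), by positivity,
    fun {A} hA T k ω x y hx hy => ?_⟩
  have hst := T.step_pos hd k
  have hB := T.branch_pos k
  have hl := T.scale_pos k
  have hp := T.prob_pos T.depth
  set r : T.Digit k → ℝ := fun a => ‖T.vec k a - T.vec k (ω k)‖ with hr
  have hsum : T.prob T.depth * ∑ ω' with T.Splits k ω ω', (T.step k / 2 * r (ω' k)) ^ (-s) ≤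
      C₁ * (2 * d) ^ s * T.density s k := by
    have h1 := hgrid (T.branch k) (by have := T.two_le_branch k; omega) (ω k) r
      (fun b hb => T.one_le_norm_vec_sub k hb)
      (fun b c => T.abs_sub_le_norm_vec_sub k (ω k) b c)
    have h2 := T.prob_mul_sum_splits k ω (fun a => (T.step k / 2 * r a) ^ (-s))
    rw [h2]
    have h3 : ∀ a, (T.step k / 2 * r a) ^ (-s) = (T.step k / 2) ^ (-s) * r a ^ (-s) := fun a =>
      Real.mul_rpow (by positivity) (norm_nonneg _)
    simp_rw [h3, ← Finset.mul_sum]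
    have h4 : (T.step k / 2) ^ (-s) * (T.branch k : ℝ) ^ (-s) = (2 * d) ^ s * T.scale k ^ (-s) := by
      rw [← Real.mul_rpow (by positivity) (by positivity), ← T.step_mul_branch hd k,
        Real.rpow_neg (by positivity), Real.rpow_neg (by positivity),
        ← Real.inv_rpow (by positivity), ← Real.inv_rpow (by positivity),
        ← Real.mul_rpow (by positivity) (by positivity)]
      congr 1; field_simp
    calc _ = T.prob k * (T.step k / 2) ^ (-s) *
          (((T.branch k : ℝ) ^ d)⁻¹ * ∑ a with a ≠ ω k, r a ^ (-s)) := by ring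
      _ ≤ T.prob k * (T.step k / 2) ^ (-s) * (C₁ * (T.branch k : ℝ) ^ (-s)) := by
          have := T.prob_pos k
          gcongr
      _ = C₁ * T.prob k * ((T.step k / 2) ^ (-s) * (T.branch k : ℝ) ^ (-s)) := by ring
      _ = _ := by rw [h4, density]; ring
  have hD : 0 < T.density s k := T.density_pos s k
  have hc : (1 : ℝ) ≤ 2 * (5 + 4 * s) := by linarith
  constructor
  · rw [field, norm_smul, Real.norm_of_nonneg hp.le]
    refine le_trans ?_ (hsum.trans ?_)
    · gcongr
      refine (norm_sum_le _ _).trans (Finset.sum_le_sum fun ω' hω' => ?_)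
      have hsp := (Finset.mem_filter.1 hω').2
      have h1 := T.norm_bounds_of_splits hd hA hsp hx
      have h2 := T.one_le_norm_vec_sub k hsp.2.symm
      have h3 : 0 < T.step k / 2 * r (ω' k) := by
        have : 0 < r (ω' k) := by simp only [hr]; linarith
        positivity
      rw [norm_rieszKernel (h3.trans_le h1.1)]
      exact Real.rpow_le_rpow_of_nonpos h3 h1.1 (by linarith)
    · calc C₁ * (2 * d) ^ s * T.density s k = C₁ * (2 * d) ^ s * 1 * T.density s k := by ring
        _ ≤ _ := by gcongr
  · rw [field, field, ← smul_sub, ← Finset.sum_sub_distrib, norm_smul,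
      Real.norm_of_nonneg hp.le]
    have hterm : ‖∑ ω' with T.Splits k ω ω', (rieszKernel d s (T.point ω' - x) -
        rieszKernel d s (T.point ω' - y))‖ ≤ ∑ ω' with T.Splits k ω ω',
          (2 * (5 + 4 * s)) * (‖x - y‖ / T.step k) * (T.step k / 2 * r (ω' k)) ^ (-s) := by
      refine (norm_sum_le _ _).trans (Finset.sum_le_sum fun ω' hω' => ?_)
      have hsp := (Finset.mem_filter.1 hω').2
      have h1 := T.norm_bounds_of_splits hd hA hsp hx
      have h1' := T.norm_bounds_of_splits hd hA hsp hy
      have h2 := T.one_le_norm_vec_sub k hsp.2.symm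
      have h4 : T.step k / 2 ≤ T.step k / 2 * r (ω' k) := by
        simp only [hr]; nlinarith
      have h3 : 0 < T.step k / 2 * r (ω' k) := by linarith
      refine (rieszKernel_sub_le hs h3 h1.1 h1'.1 (h1'.2.trans (le_of_eq ?_))).trans ?_
      · simp only [hr]; ring
      · have e : T.point ω' - x - (T.point ω' - y) = -(x - y) := by abel
        rw [e, norm_neg]
        calc _ ≤ (5 + 4 * s) * (T.step k / 2 * r (ω' k)) ^ (-s) * (‖x - y‖ / (T.step k / 2)) := by
              gcongr
          _ = _ := by field_simp
    calc _ ≤ T.prob T.depth * ∑ ω' with T.Splits k ω ω',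
          (2 * (5 + 4 * s)) * (‖x - y‖ / T.step k) * (T.step k / 2 * r (ω' k)) ^ (-s) := by
          gcongr
      _ = (2 * (5 + 4 * s)) * (‖x - y‖ / T.step k) *
          (T.prob T.depth * ∑ ω' with T.Splits k ω ω', (T.step k / 2 * r (ω' k)) ^ (-s)) := by
          rw [← Finset.mul_sum]; ring
      _ ≤ (2 * (5 + 4 * s)) * (‖x - y‖ / T.step k) * (C₁ * (2 * d) ^ s * T.density s k) := by
          gcongr
      _ = _ := by ring

theorem sum_inner_field_eq_zero (s : ℝ) (k : Fin T.depth)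
    (f : T.Address → EuclideanSpace ℝ (Fin d))
    (hf : ∀ ω ω', (∀ i < k, ω i = ω' i) → f ω = f ω') :
    ∑ ω, inner ℝ (f ω) (T.field s k ω (T.point ω)) = 0 := by
  classical
  have e : ∀ ω, inner ℝ (f ω) (T.field s k ω (T.point ω)) = T.prob T.depth * ∑ ω',
      if T.Splits k ω ω' then inner ℝ (f ω) (rieszKernel d s (T.point ω' - T.point ω)) else 0 := by
    intro ω
    rw [field, inner_smul_right, inner_sum, Finset.sum_filter]
  simp_rw [e, ← Finset.mul_sum]
  refine mul_eq_zero_of_right _ ?_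
  have hswap := Finset.sum_comm (s := (Finset.univ : Finset T.Address))
    (t := (Finset.univ : Finset T.Address)) (f := fun ω ω' =>
      if T.Splits k ω ω' then inner ℝ (f ω) (rieszKernel d s (T.point ω' - T.point ω)) else 0)
  have hneg : ∑ ω' : T.Address, ∑ ω : T.Address,
      (if T.Splits k ω ω' then inner ℝ (f ω) (rieszKernel d s (T.point ω' - T.point ω)) else 0) =
      -∑ ω' : T.Address, ∑ ω : T.Address,
      (if T.Splits k ω' ω then inner ℝ (f ω') (rieszKernel d s (T.point ω - T.point ω')) else 0) := by
    simp_rw [← Finset.sum_neg_distrib]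
    refine Finset.sum_congr rfl fun ω' _ => Finset.sum_congr rfl fun ω _ => ?_
    by_cases h : T.Splits k ω ω'
    · rw [if_pos h, if_pos h.symm, hf ω ω' h.1, ← neg_sub (T.point ω), rieszKernel_neg,
        inner_neg_right]
    · rw [if_neg h, if_neg (fun h' => h h'.symm), neg_zero]
  linarith [hswap.trans hneg]

/-- The address obtained by reflecting the position at level `j`. -/
def flip (j : Fin T.depth) : T.Address ≃ T.Address :=
  Function.Involutive.toPerm (fun ω => Function.update ω j fun c => (ω j c).rev) fun ω => by
    simp [Fin.rev_rev]

theorem flip_apply_self (j : Fin T.depth) (ω : T.Address) :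
    T.flip j ω j = fun c => (ω j c).rev := Function.update_self ..

theorem flip_apply_of_ne {i j : Fin T.depth} (h : i ≠ j) (ω : T.Address) :
    T.flip j ω i = ω i := Function.update_of_ne h ..

/-- The normalised position at level `j`, pointing towards the centre of the ancestor. -/
def dir (j : Fin T.depth) (ω : T.Address) : EuclideanSpace ℝ (Fin d) :=
  (-((d : ℝ) * T.branch j)⁻¹) • T.vec j (ω j)

theorem vec_rev (j : ℕ) (a : T.Digit j) : T.vec j (fun c => (a c).rev) = -T.vec j a := by
  ext c
  have h : ((a c : ℕ) + 1 : ℕ) ≤ T.branch j := (a c).2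
  simp only [vec, Fin.val_rev, PiLp.neg_apply]
  rw [Nat.cast_sub h]
  push_cast
  ring

theorem dir_flip (j : Fin T.depth) (ω : T.Address) : T.dir j (T.flip j ω) = -T.dir j ω := by
  rw [dir, dir, flip_apply_self, vec_rev, smul_neg]

theorem dir_flip_of_ne {i j : Fin T.depth} (h : i ≠ j) (ω : T.Address) :
    T.dir i (T.flip j ω) = T.dir i ω := by
  rw [dir, dir, flip_apply_of_ne T h]

theorem norm_dir_le (hd : 1 ≤ d) (j : Fin T.depth) (ω : T.Address) : ‖T.dir j ω‖ ≤ 1 / 2 := by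
  have hB := T.branch_pos j
  have hd0 : (0 : ℝ) < d := by exact_mod_cast hd
  rw [dir, norm_smul, norm_neg, Real.norm_of_nonneg (by positivity)]
  calc _ ≤ ((d : ℝ) * T.branch j)⁻¹ * (d * T.branch j / 2) := by
        gcongr; exact T.norm_vec_le _ _
    _ = 1 / 2 := by field_simp

theorem sum_inner_dir_eq_zero (j : Fin T.depth)
    (f : T.Address → EuclideanSpace ℝ (Fin d))
    (hf : ∀ ω ω', (∀ i < j, ω i = ω' i) → f ω = f ω') :
    ∑ ω, inner ℝ (f ω) (T.dir j ω) = 0 := by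
  have h := Equiv.sum_comp (T.flip j) fun ω => inner ℝ (f ω) (T.dir j ω)
  have e : ∀ ω, inner ℝ (f (T.flip j ω)) (T.dir j (T.flip j ω)) = -inner ℝ (f ω) (T.dir j ω) := by
    intro ω
    rw [dir_flip, inner_neg_right, hf (T.flip j ω) ω fun i hi => T.flip_apply_of_ne hi.ne ω]
  simp only [e, Finset.sum_neg_distrib] at h
  linarith

theorem le_inner_rieszKernel_of_splits (hd : 1 ≤ d) (hA : 8 ≤ A) {s : ℝ} (hs : 0 < s)
    {k : Fin T.depth} {ω ω' : T.Address} (h : T.Splits k ω ω') :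
    (2 * T.scale k) ^ (-(s + 1)) * (T.step k / 2) * ‖T.vec k (ω' k) - T.vec k (ω k)‖ ^ 2 ≤
      inner ℝ (rieszKernel d s (T.point ω' - T.point ω)) (T.vec k (ω' k) - T.vec k (ω k)) := by
  set w := T.vec k (ω' k) - T.vec k (ω k) with hw
  set u := T.point ω' - T.point ω with hu
  have hst := T.step_pos hd k
  have h0 : ‖T.point ω - T.centre (k + 1) ω‖ ≤ 2 * T.scale (k + 1) := by
    have := T.norm_point_sub_centre_le hd hA (j := k + 1) k.2 ω
    linarith [T.scale_pos (k + 1)]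
  have h1 := T.norm_sub_smul_le_of_splits hd hA h h0
  have h2 := T.norm_bounds_of_splits hd hA h h0
  have h3 : 1 ≤ ‖w‖ := T.one_le_norm_vec_sub k h.2.symm
  rw [← hw, ← hu] at h1 h2
  have h4 : T.step k / 2 * ‖w‖ ^ 2 ≤ inner ℝ u w := by
    have e : inner ℝ u w = T.step k * ‖w‖ ^ 2 + inner ℝ (u - T.step k • w) w := by
      rw [inner_sub_left u, real_inner_smul_left, real_inner_self_eq_norm_sq]; ring
    have h5 := abs_le.1 (abs_real_inner_le_norm (u - T.step k • w) w)
    have h6 := mul_le_mul_of_nonneg_right h1 (norm_nonneg w)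
    rw [e]
    nlinarith
  have hw' : ‖w‖ ≤ d * T.branch k := by
    have := T.norm_vec_le k (ω' k)
    have := T.norm_vec_le k (ω k)
    refine (norm_sub_le _ _).trans ?_
    linarith
  have h7 : ‖u‖ ≤ 2 * T.scale k := by
    refine h2.2.trans ?_
    rw [← T.step_mul_branch hd k]
    nlinarith
  have h8 : 0 < ‖u‖ := lt_of_lt_of_le (by positivity) h2.1
  rw [rieszKernel, real_inner_smul_left, mul_assoc]
  have h9 := Real.rpow_le_rpow_of_nonpos h8 h7 (show -(s + 1) ≤ 0 by linarith)
  gcongr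

theorem le_sum_inner_field_dir (hd : 1 ≤ d) (hA : 8 ≤ A) {s : ℝ} (hs : 0 < s)
    (j : Fin T.depth) :
    2 ^ (-(s + 1)) / (64 * d ^ 2) * T.density s j ≤
      T.prob T.depth * ∑ ω, inner ℝ (T.field s j ω (T.point ω)) (T.dir j ω) := by
  classical
  have hB := T.branch_pos j
  have hst := T.step_pos hd j
  have hl := T.scale_pos j
  have hd0 : (0 : ℝ) < d := by exact_mod_cast hd
  have hp := T.prob_pos T.depth
  set K := fun ω ω' : T.Address => rieszKernel d s (T.point ω' - T.point ω) with hK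
  have e : ∀ ω, inner ℝ (T.field s j ω (T.point ω)) (T.dir j ω) =
      T.prob T.depth * ((d : ℝ) * T.branch j)⁻¹ * ∑ ω', if T.Splits j ω ω' then
        -inner ℝ (K ω ω') (T.vec j (ω j)) else 0 := by
    intro ω
    rw [field, dir, inner_smul_right, inner_smul_left, sum_inner, Finset.sum_filter,
      Finset.mul_sum, Finset.mul_sum, Finset.mul_sum]
    refine Finset.sum_congr rfl fun ω' _ => ?_
    simp only [conj_trivial]
    split_ifs <;> ring
  have hsym : ∑ ω, ∑ ω', (if T.Splits j ω ω' then -inner ℝ (K ω ω') (T.vec j (ω j)) else 0) =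
      1 / 2 * ∑ ω, ∑ ω', if T.Splits j ω ω' then
        inner ℝ (K ω ω') (T.vec j (ω' j) - T.vec j (ω j)) else 0 := by
    have hswap := Finset.sum_comm (s := (Finset.univ : Finset T.Address))
      (t := (Finset.univ : Finset T.Address)) (f := fun ω ω' =>
        if T.Splits j ω ω' then -inner ℝ (K ω ω') (T.vec j (ω j)) else 0)
    have h2 : ∑ ω' : T.Address, ∑ ω : T.Address,
        (if T.Splits j ω ω' then -inner ℝ (K ω ω') (T.vec j (ω j)) else 0) =
        ∑ ω : T.Address, ∑ ω' : T.Address,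
          (if T.Splits j ω ω' then inner ℝ (K ω ω') (T.vec j (ω' j)) else 0) := by
      refine Finset.sum_congr rfl fun ω _ => Finset.sum_congr rfl fun ω' _ => ?_
      by_cases h : T.Splits j ω ω'
      · have : K ω' ω = -K ω ω' := by
          simp only [hK]; rw [← rieszKernel_neg, neg_sub]
        rw [if_pos h, if_pos h.symm, this, inner_neg_left, neg_neg]
      · rw [if_neg h, if_neg (fun h' => h h'.symm)]
    have h3 : ∑ ω, ∑ ω', (if T.Splits j ω ω' then
        inner ℝ (K ω ω') (T.vec j (ω' j) - T.vec j (ω j)) else 0) =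
        ∑ ω : T.Address, ∑ ω' : T.Address,
          (if T.Splits j ω ω' then inner ℝ (K ω ω') (T.vec j (ω' j)) else 0) +
        ∑ ω, ∑ ω', (if T.Splits j ω ω' then -inner ℝ (K ω ω') (T.vec j (ω j)) else 0) := by
      simp_rw [← Finset.sum_add_distrib]
      refine Finset.sum_congr rfl fun ω _ => Finset.sum_congr rfl fun ω' _ => ?_
      split_ifs
      · rw [inner_sub_right]; ring
      · ring
    rw [h3, ← h2, ← hswap]; ring
  set κ := (2 * T.scale j) ^ (-(s + 1)) * (T.step j / 2) with hκ
  have hκ0 : 0 < κ := by positivity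
  have hlow : ∀ ω, κ * (T.prob j * ((T.branch j : ℝ) ^ 2 / 16)) ≤
      T.prob T.depth * ∑ ω', if T.Splits j ω ω' then
        inner ℝ (K ω ω') (T.vec j (ω' j) - T.vec j (ω j)) else 0 := by
    intro ω
    have h1 := T.prob_mul_sum_splits j ω fun a => ‖T.vec j a - T.vec j (ω j)‖ ^ 2
    have h2 := le_sum_pi_fin_sq_sub (T.two_le_branch j) (⟨0, hd⟩ : Fin d)
      ((ω j ⟨0, hd⟩ : ℕ) : ℝ)
    have h3 : ∑ a : T.Digit j, (((a ⟨0, hd⟩ : ℕ) : ℝ) - (ω j ⟨0, hd⟩ : ℕ)) ^ 2 ≤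
        ∑ a with a ≠ ω j, ‖T.vec j a - T.vec j (ω j)‖ ^ 2 := by
      rw [Finset.sum_filter]
      refine Finset.sum_le_sum fun a _ => ?_
      split_ifs with ha
      · rw [← sq_abs]
        gcongr
        exact T.abs_sub_le_norm_vec_sub j (ω j) a _
      · rw [not_not.1 ha]; simp
    have hpj := T.prob_pos j
    calc κ * (T.prob j * ((T.branch j : ℝ) ^ 2 / 16))
        ≤ κ * (T.prob T.depth * ∑ ω' with T.Splits j ω ω',
            ‖T.vec j (ω' j) - T.vec j (ω j)‖ ^ 2) := by
          rw [h1]; gcongr; exact h2.trans (by gcongr)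
      _ = T.prob T.depth * ∑ ω' with T.Splits j ω ω',
            κ * ‖T.vec j (ω' j) - T.vec j (ω j)‖ ^ 2 := by rw [← Finset.mul_sum]; ring
      _ ≤ _ := by
          rw [← Finset.sum_filter]
          gcongr with ω' hω'
          exact T.le_inner_rieszKernel_of_splits hd hA hs (Finset.mem_filter.1 hω').2
  simp_rw [e, ← Finset.mul_sum]
  rw [hsym]
  have hsumlow := Finset.sum_le_sum fun ω (_ : ω ∈ Finset.univ) => hlow ω
  rw [Finset.sum_const, Finset.card_univ, nsmul_eq_mul, ← Finset.mul_sum] at hsumlow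
  have hcard := T.card_address
  have e2 : 2 ^ (-(s + 1)) / (64 * d ^ 2) * T.density s j =
      ((d : ℝ) * T.branch j)⁻¹ * (1 / 2) * (κ * (T.prob j * ((T.branch j : ℝ) ^ 2 / 16))) := by
    rw [hκ, density, Real.mul_rpow (by norm_num) hl.le, step,
      show -(s + 1) = -s - 1 by ring, Real.rpow_sub_one hl.ne']
    field_simp; ring
  rw [e2]
  calc _ = ((d : ℝ) * T.branch j)⁻¹ * (1 / 2) * (T.prob T.depth * (Fintype.card T.Address *
        (κ * (T.prob j * ((T.branch j : ℝ) ^ 2 / 16))))) := by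
        rw [← mul_assoc (T.prob T.depth), hcard, one_mul]
    _ ≤ _ := mul_le_mul_of_nonneg_left (mul_le_mul_of_nonneg_left hsumlow hp.le) (by positivity)
    _ = _ := by ring

end GridTree

namespace GridTree

variable {d : ℕ} {A : ℝ} (T : GridTree d A)

/-- A bound, with constant `C`, for the field of each level and for its oscillation. -/
def FieldBound (s C : ℝ) : Prop :=
  ∀ (k : Fin T.depth) (ω : T.Address) (x y : EuclideanSpace ℝ (Fin d)),
    ‖x - T.centre (k + 1) ω‖ ≤ 2 * T.scale (k + 1) →
    ‖y - T.centre (k + 1) ω‖ ≤ 2 * T.scale (k + 1) →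
    ‖T.field s k ω x‖ ≤ C * T.density s k ∧
    ‖T.field s k ω x - T.field s k ω y‖ ≤ C * T.density s k * (‖x - y‖ / T.step k)

/-- The sum of the squares of the densities above the finest level. -/
def energy (s : ℝ) : ℝ := ∑ k : Fin T.depth, T.density s k ^ 2

/-- The Riesz transform at a finest centre of the uniform measure on the other ones. -/
def totalField (s : ℝ) (ω : T.Address) : EuclideanSpace ℝ (Fin d) :=
  ∑ k, T.field s k ω (T.point ω)

variable {T}

theorem FieldBound.norm_field_point_le {s C : ℝ} (h : T.FieldBound s C) (hd : 1 ≤ d) (hA : 8 ≤ A)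
    (k : Fin T.depth) (ω : T.Address) : ‖T.field s k ω (T.point ω)‖ ≤ C * T.density s k := by
  have := T.norm_point_sub_centre_le hd hA (j := k + 1) k.2 ω
  have := T.scale_pos (k + 1)
  exact (h k ω (T.point ω) (T.point ω) (by linarith) (by linarith)).1

theorem FieldBound.abs_sum_inner_le {s C b : ℝ} (h : T.FieldBound s C) (hC : 0 ≤ C) (hd : 1 ≤ d)
    (hA : 8 ≤ A) {k j : Fin T.depth} (hkj : k < j) (V : T.Address → EuclideanSpace ℝ (Fin d))
    (hV : ∀ f : T.Address → EuclideanSpace ℝ (Fin d),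
      (∀ ω ω', (∀ i < j, ω i = ω' i) → f ω = f ω') → ∑ ω, inner ℝ (f ω) (V ω) = 0)
    (hb : ∀ ω, ‖V ω‖ ≤ b) :
    |T.prob T.depth * ∑ ω, inner ℝ (T.field s k ω (T.point ω)) (V ω)| ≤
      C * T.density s k * (2 / A * (1 / 2) ^ (j - k : ℕ)) * b := by
  have hp := T.prob_pos T.depth
  have hst := T.step_pos hd k
  have hD := T.density_pos s k
  have hA0 : 0 < A := by linarith
  have h0 := hV (fun ω => T.field s k ω (T.centre j ω)) fun ω ω' hω => by
    rw [T.field_congr (fun i hi => hω i (hi.trans_lt hkj)),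
      T.centre_congr (fun i hi => hω i (Fin.lt_def.2 hi))]
  have e : ∑ ω, inner ℝ (T.field s k ω (T.point ω)) (V ω) =
      ∑ ω, inner ℝ (T.field s k ω (T.point ω) - T.field s k ω (T.centre j ω)) (V ω) := by
    simp_rw [inner_sub_left, Finset.sum_sub_distrib, h0, sub_zero]
  have hterm : ∀ ω, |inner ℝ (T.field s k ω (T.point ω) - T.field s k ω (T.centre j ω)) (V ω)| ≤
      C * T.density s k * (2 / A * (1 / 2) ^ (j - k : ℕ)) * b := by
    intro ω
    refine (abs_real_inner_le_norm _ _).trans ?_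
    have h1 := T.norm_point_sub_centre_le hd hA (j := k + 1) k.2 ω
    have h2 := T.norm_centre_sub_le hd hA (j := k + 1) (m := j) hkj ω
    have h3 := T.norm_point_sub_centre_le hd hA (j := j) j.2.le ω
    have := T.scale_pos (k + 1)
    have := T.scale_pos j
    refine mul_le_mul ((h k ω _ _ (by linarith) (by linarith)).2.trans ?_) (hb ω)
      (norm_nonneg _) (by positivity)
    gcongr
    rw [div_le_iff₀ hst]
    exact h3.trans (T.scale_le_mul_step hd hA hkj)
  rw [e, abs_mul, abs_of_pos hp]
  calc _ ≤ T.prob T.depth * ∑ ω : T.Address,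
        C * T.density s k * (2 / A * (1 / 2) ^ (j - k : ℕ)) * b := by
        gcongr
        exact (Finset.abs_sum_le_sum_abs _ _).trans (Finset.sum_le_sum fun ω _ => hterm ω)
    _ = _ := by
        rw [Finset.sum_const, Finset.card_univ, nsmul_eq_mul, ← mul_assoc, T.card_address, one_mul]

theorem FieldBound.sum_norm_totalField_sq_le {s C : ℝ} (h : T.FieldBound s C) (hC : 0 ≤ C)
    (hd : 1 ≤ d) (hA : 8 ≤ A) :
    T.prob T.depth * ∑ ω, ‖T.totalField s ω‖ ^ 2 ≤ 4 * C ^ 2 * T.energy s := by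
  set I : Fin T.depth → Fin T.depth → ℝ := fun k j => T.prob T.depth *
    ∑ ω, inner ℝ (T.field s k ω (T.point ω)) (T.field s j ω (T.point ω)) with hI
  have hsymm : ∀ k j, I k j = I j k := fun k j => by
    simp only [hI, real_inner_comm]
  have e : T.prob T.depth * ∑ ω, ‖T.totalField s ω‖ ^ 2 = ∑ k, ∑ j, I k j := by
    simp_rw [← real_inner_self_eq_norm_sq, totalField, sum_inner, inner_sum, hI, ← Finset.mul_sum]
    rw [Finset.sum_comm]
    congr 1
    refine Finset.sum_congr rfl fun k _ => ?_
    rw [Finset.sum_comm]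
  have hlt : ∀ k j, k < j → I k j ≤
      C ^ 2 * (T.density s k * T.density s j * (1 / 2) ^ ((j - k : ℕ) + (k - j : ℕ))) := by
    intro k j hkj
    have h1 := h.abs_sum_inner_le hC hd hA hkj (fun ω => T.field s j ω (T.point ω))
      (fun f hf => T.sum_inner_field_eq_zero s j f hf) (h.norm_field_point_le hd hA j)
    refine ((le_abs_self _).trans h1).trans ?_
    have hz : (k - j : ℕ) = 0 := Nat.sub_eq_zero_of_le (Fin.le_def.1 hkj.le)
    have h2 : 2 / A ≤ 1 := by rw [div_le_one (by linarith)]; linarith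
    have := T.density_pos s k
    have := T.density_pos s j
    rw [hz, add_zero]
    calc _ ≤ C * T.density s k * (1 * (1 / 2) ^ (j - k : ℕ)) * (C * T.density s j) := by gcongr
      _ = _ := by ring
  have hall : ∀ k j, I k j ≤
      C ^ 2 * (T.density s k * T.density s j * (1 / 2) ^ ((j - k : ℕ) + (k - j : ℕ))) := by
    intro k j
    rcases lt_trichotomy k j with hkj | rfl | hkj
    · exact hlt k j hkj
    · have hp := T.prob_pos T.depth
      simp only [hI, real_inner_self_eq_norm_sq]
      calc _ ≤ T.prob T.depth * ∑ ω : T.Address, (C * T.density s k) ^ 2 := by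
            gcongr with ω
            exact h.norm_field_point_le hd hA k ω
        _ = (C * T.density s k) ^ 2 := by
            rw [Finset.sum_const, Finset.card_univ, nsmul_eq_mul, ← mul_assoc, T.card_address,
              one_mul]
        _ = _ := by simp; ring
    · rw [hsymm, add_comm, mul_comm (T.density s k)]
      exact hlt j k hkj
  rw [e]
  calc _ ≤ ∑ k : Fin T.depth, ∑ j : Fin T.depth, C ^ 2 *
        (T.density s k * T.density s j * (1 / 2) ^ ((j - k : ℕ) + (k - j : ℕ))) :=
        Finset.sum_le_sum fun k _ => Finset.sum_le_sum fun j _ => hall k j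
    _ ≤ C ^ 2 * (4 * T.energy s) := by
        simp_rw [← Finset.mul_sum]
        gcongr
        exact sum_sum_half_pow_dist_le fun k : Fin T.depth => T.density s k
    _ = _ := by ring

theorem FieldBound.le_sum_inner_totalField {s C : ℝ} (h : T.FieldBound s C) (hC : 0 ≤ C)
    (hd : 1 ≤ d) (hA : 8 ≤ A) (hs : 0 < s) :
    (2 ^ (-(s + 1)) / (64 * d ^ 2) - 4 * C / A) * T.energy s ≤
      T.prob T.depth * ∑ ω, inner ℝ (T.totalField s ω)
        (∑ j : Fin T.depth, T.density s j • T.dir j ω) := by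
  set c : ℝ := 2 ^ (-(s + 1)) / (64 * d ^ 2) with hc
  have hA0 : 0 < A := by linarith
  set I : Fin T.depth → Fin T.depth → ℝ := fun k j => T.prob T.depth *
    ∑ ω, inner ℝ (T.field s k ω (T.point ω)) (T.dir j ω) with hI
  have e : T.prob T.depth * ∑ ω, inner ℝ (T.totalField s ω)
        (∑ j : Fin T.depth, T.density s j • T.dir j ω) =
      ∑ k, ∑ j : Fin T.depth, T.density s j * I k j := by
    simp_rw [totalField, sum_inner, inner_sum, real_inner_smul_right, hI]
    rw [Finset.sum_comm, Finset.mul_sum]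
    refine Finset.sum_congr rfl fun k _ => ?_
    rw [Finset.sum_comm, Finset.mul_sum]
    refine Finset.sum_congr rfl fun j _ => ?_
    rw [← Finset.mul_sum]; ring
  have hall : ∀ k j : Fin T.depth, (if k = j then c * T.density s k ^ 2 else 0) -
      C / A * (T.density s k * T.density s j * (1 / 2) ^ ((j - k : ℕ) + (k - j : ℕ))) ≤
      T.density s j * I k j := by
    intro k j
    have := T.density_pos s k
    have := T.density_pos s j
    rcases lt_trichotomy k j with hkj | rfl | hkj
    · have h1 := h.abs_sum_inner_le hC hd hA hkj (T.dir j)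
        (fun f hf => T.sum_inner_dir_eq_zero j f hf) (T.norm_dir_le hd j)
      have hz : (k - j : ℕ) = 0 := Nat.sub_eq_zero_of_le (Fin.le_def.1 hkj.le)
      have h2 := mul_le_mul_of_nonneg_left (abs_le.1 h1).1 (T.density_pos s j).le
      rw [if_neg hkj.ne, hz, add_zero]
      refine le_trans (le_of_eq ?_) h2
      ring
    · have h1 := T.le_sum_inner_field_dir hd hA hs k
      have h2 := mul_le_mul_of_nonneg_left h1 (T.density_pos s k).le
      rw [if_pos rfl]
      refine le_trans ?_ h2
      have : 0 ≤ C / A * (T.density s k * T.density s k * (1 / 2) ^ ((k - k : ℕ) + (k - k : ℕ))) := by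
        positivity
      rw [← hc]; linarith
    · have h1 : I k j = 0 := by
        have := T.sum_inner_field_eq_zero s k (T.dir j) fun ω ω' hω => by
          rw [dir, dir, hω j hkj]
        rw [Finset.sum_congr rfl fun ω _ => real_inner_comm _ _] at this
        simp only [hI, this, mul_zero]
      rw [if_neg hkj.ne', h1, mul_zero, zero_sub, neg_nonpos]
      positivity
  rw [e]
  refine le_trans ?_ (Finset.sum_le_sum fun k _ => Finset.sum_le_sum fun j _ => hall k j)
  simp_rw [Finset.sum_sub_distrib, ← Finset.mul_sum, Finset.sum_ite_eq, Finset.mem_univ, if_true,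
    ← Finset.mul_sum]
  have h1 := sum_sum_half_pow_dist_le fun k : Fin T.depth => T.density s k
  have h2 : C / A * _ ≤ C / A * _ := mul_le_mul_of_nonneg_left h1 (by positivity)
  simp only [energy]
  calc _ = c * ∑ k : Fin T.depth, T.density s k ^ 2 -
        C / A * (4 * ∑ k : Fin T.depth, T.density s k ^ 2) := by ring
    _ ≤ _ := by linarith

theorem sum_norm_sum_dir_pow_le (hd : 1 ≤ d) (s : ℝ) :
    T.prob T.depth * ∑ ω, ‖∑ j : Fin T.depth, T.density s j • T.dir j ω‖ ^ 2 ≤ T.energy s ∧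
    T.prob T.depth * ∑ ω, ‖∑ j : Fin T.depth, T.density s j • T.dir j ω‖ ^ 4 ≤
      3 * T.energy s ^ 2 := by
  classical
  set X : ℕ → T.Address → EuclideanSpace ℝ (Fin d) := fun j ω =>
    if h : j < T.depth then T.density s j • T.dir ⟨j, h⟩ ω else 0 with hX
  set σ : ℕ → T.Address ≃ T.Address := fun j =>
    if h : j < T.depth then T.flip ⟨j, h⟩ else Equiv.refl _ with hσ
  have hmain := sum_norm_pow_le_of_flip X σ (fun j => T.density s j) ?_ ?_ ?_ T.depth
  · have hsum : ∀ ω, ∑ j ∈ Finset.range T.depth, X j ω =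
        ∑ j : Fin T.depth, T.density s j • T.dir j ω := by
      intro ω
      rw [Finset.sum_range]
      exact Finset.sum_congr rfl fun j _ => by simp [hX]
    simp_rw [hsum] at hmain
    rw [Finset.sum_range (fun j => T.density s j ^ 2)] at hmain
    have hp := T.prob_pos T.depth
    refine ⟨(mul_le_mul_of_nonneg_left hmain.1 hp.le).trans_eq ?_,
      (mul_le_mul_of_nonneg_left hmain.2 hp.le).trans_eq ?_⟩ <;>
    rw [← mul_assoc, T.card_address, one_mul, energy]
  · intro j ω
    by_cases h : j < T.depth
    · simp only [hX, hσ, dif_pos h, dir_flip, smul_neg]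
    · simp [hX, h]
  · intro j i hij ω
    by_cases h : j < T.depth
    · simp only [hX, hσ, dif_pos h, dif_pos (hij.trans h)]
      rw [dir_flip_of_ne]
      simpa using hij.ne
    · simp [hσ, h]
  · intro j ω
    have := T.density_pos s j
    by_cases h : j < T.depth
    · simp only [hX, dif_pos h, norm_smul, Real.norm_of_nonneg this.le]
      have := T.norm_dir_le hd ⟨j, h⟩ ω
      nlinarith
    · simp [hX, h, this.le]

theorem exists_large_totalField (hd : 1 ≤ d) {s : ℝ} (hs : 0 < s) (hsd : s < d) :
    ∃ A C ε κ : ℝ, 8 ≤ A ∧ 0 < C ∧ 0 < ε ∧ 0 < κ ∧ ∀ T : GridTree d A, T.FieldBound s C ∧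
      κ ≤ T.prob T.depth *
        (Finset.univ.filter fun ω => ε ^ 2 * T.energy s ≤ ‖T.totalField s ω‖ ^ 2).card := by
  obtain ⟨C, hC, hbound⟩ := exists_field_bounds hd hs hsd
  have hd0 : (0 : ℝ) < d := by exact_mod_cast hd
  set c : ℝ := 2 ^ (-(s + 1)) / (64 * d ^ 2) with hc
  have hc0 : 0 < c := by positivity
  obtain ⟨A, hA, hA'⟩ : ∃ A, 8 ≤ A ∧ 8 * C / c ≤ A :=
    ⟨max 8 (8 * C / c), le_max_left _ _, le_max_right _ _⟩
  refine ⟨A, C, c / 2 / 4, min 1 ((c / 2) ^ 4 / (12 * (4 * C ^ 2) ^ 2)), hA, hC, by positivity,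
    by positivity, fun T => ?_⟩
  have hF : T.FieldBound s C := fun k ω x y => hbound hA T k ω x y
  refine ⟨hF, ?_⟩
  have hS0 : 0 ≤ T.energy s := Finset.sum_nonneg fun _ _ => sq_nonneg _
  rcases hS0.eq_or_lt with hS | hS
  · refine (min_le_left _ _).trans ?_
    rw [← hS, Finset.filter_true_of_mem fun ω _ => by rw [mul_zero]; positivity, Finset.card_univ,
      T.card_address]
  · refine (min_le_right _ _).trans ?_
    refine le_card_of_correlation (c := c / 2) (by positivity) (by positivity) (T.prob_pos _) hS T.card_address
      (T.totalField s) _ (le_trans ?_ (hF.le_sum_inner_totalField hC.le hd hA hs))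
      (hF.sum_norm_totalField_sq_le hC.le hd hA) (sum_norm_sum_dir_pow_le hd s).1
      (sum_norm_sum_dir_pow_le hd s).2
    gcongr
    have : 4 * C / A ≤ c / 2 := by
      rw [div_le_iff₀ (by linarith)]
      rw [div_le_iff₀ hc0] at hA'
      linarith
    linarith

end GridTree

section FiniteSum

variable {d : ℕ} {s : ℝ} {ι : Type*} [Fintype ι]

theorem truncRiesz_sum_dirac (a : ι → ℝ) (ha : ∀ i, 0 ≤ a i) (y : ι → EuclideanSpace ℝ (Fin d))
    (ε : ℝ) (x : EuclideanSpace ℝ (Fin d)) :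
    truncRiesz d s (∑ i, ENNReal.ofReal (a i) • Measure.dirac (y i)) ε x =
      ∑ i, a i • {y | ε < dist y x}.indicator (fun y => rieszKernel d s (y - x)) (y i) := by
  have hm : MeasurableSet {y : EuclideanSpace ℝ (Fin d) | ε < dist y x} :=
    (isOpen_lt continuous_const (continuous_id.dist continuous_const)).measurableSet
  rw [truncRiesz, ← integral_indicator hm, integral_finsetSum_measure]
  · refine Finset.sum_congr rfl fun i _ => ?_
    rw [integral_smul_measure, integral_dirac, ENNReal.toReal_ofReal (ha i)]
  · intro i _
    exact (integrable_dirac (by simp)).smul_measure ENNReal.ofReal_ne_top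

theorem tendsto_truncRiesz_sum_dirac (a : ι → ℝ) (ha : ∀ i, 0 ≤ a i)
    (y : ι → EuclideanSpace ℝ (Fin d)) (x : EuclideanSpace ℝ (Fin d)) :
    Tendsto (fun ε => truncRiesz d s (∑ i, ENNReal.ofReal (a i) • Measure.dirac (y i)) ε x)
      (𝓝[>] (0 : ℝ)) (𝓝 (∑ i, a i • rieszKernel d s (y i - x))) := by
  simp_rw [truncRiesz_sum_dirac a ha]
  refine tendsto_finsetSum _ fun i _ => Tendsto.const_smul ?_ _
  by_cases hi : y i = x
  · refine tendsto_const_nhds.congr fun ε => ?_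
    rw [hi, indicator_apply, sub_self]
    simp [rieszKernel]
  · have h0 : 0 < dist (y i) x := dist_pos.2 hi
    refine tendsto_const_nhds.congr' ?_
    filter_upwards [nhdsWithin_le_nhds (Iio_mem_nhds h0)] with ε hε
    rw [indicator_of_mem (show y i ∈ {y | ε < dist y x} from hε)]

theorem rieszExists_sum_dirac (a : ι → ℝ) (ha : ∀ i, 0 ≤ a i)
    (y : ι → EuclideanSpace ℝ (Fin d)) (x : EuclideanSpace ℝ (Fin d)) :
    rieszExists d s (∑ i, ENNReal.ofReal (a i) • Measure.dirac (y i)) x :=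
  ⟨_, tendsto_truncRiesz_sum_dirac a ha y x⟩

theorem rieszTransform_sum_dirac (a : ι → ℝ) (ha : ∀ i, 0 ≤ a i)
    (y : ι → EuclideanSpace ℝ (Fin d)) (x : EuclideanSpace ℝ (Fin d)) :
    rieszTransform d s (∑ i, ENNReal.ofReal (a i) • Measure.dirac (y i)) x =
      ∑ i, a i • rieszKernel d s (y i - x) :=
  (tendsto_truncRiesz_sum_dirac a ha y x).limUnder_eq

end FiniteSum

namespace GridTree

variable {d : ℕ} {A : ℝ} {T : GridTree d A}

open Classical in
theorem sum_eq_add_sum_splits {E : Type*} [AddCommMonoid E] (f : T.Address → E) (ω : T.Address) :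
    ∑ ω', f ω' = f ω + ∑ k, ∑ ω' with T.Splits k ω ω', f ω' := by
  have h : ∀ ω', (if ω' = ω then f ω' else 0) + ∑ k, (if T.Splits k ω ω' then f ω' else 0) =
      f ω' := by
    intro ω'
    by_cases hω : ω' = ω
    · subst hω
      rw [if_pos rfl, Finset.sum_eq_zero fun k _ => if_neg fun h => h.2 rfl, add_zero]
    · obtain ⟨k, hk⟩ := T.exists_splits (Ne.symm hω)
      rw [if_neg hω, zero_add, Finset.sum_eq_single k, if_pos hk]
      · exact fun l _ hl => if_neg fun h => hl (T.splits_unique h hk)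
      · simp
  simp_rw [Finset.sum_filter]
  rw [Finset.sum_comm, ← Finset.sum_congr rfl fun ω' _ => h ω', Finset.sum_add_distrib]
  simp

theorem FieldBound.norm_sum_field_sub_le {s C ρ : ℝ} (h : T.FieldBound s C) (hC : 0 ≤ C)
    (hd : 1 ≤ d) (hA : 8 ≤ A) (hρ : ρ ≤ 1) (ω : T.Address) {x : EuclideanSpace ℝ (Fin d)}
    (hx : ‖x - T.point ω‖ ≤ ρ * T.scale T.depth) :
    ‖∑ k, T.field s k ω x - T.totalField s ω‖ ≤ C * ρ * √(T.energy s) := by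
  have hl := T.scale_pos T.depth
  have hρ0 : 0 ≤ ρ := by
    by_contra! hlt
    nlinarith [norm_nonneg (x - T.point ω)]
  rw [totalField, ← Finset.sum_sub_distrib]
  have hterm : ∀ k : Fin T.depth, ‖T.field s k ω x - T.field s k ω (T.point ω)‖ ≤
      C * ρ * √(T.energy s) * (1 / 2) ^ (T.depth - k) := by
    intro k
    have h1 := T.norm_point_sub_centre_le hd hA (j := k + 1) k.2 ω
    have h2 := T.scale_anti hd hA (show (k : ℕ) + 1 ≤ T.depth from k.2)
    have h3 := T.scale_pos (k + 1)
    have h4 : ‖x - T.centre (k + 1) ω‖ ≤ 2 * T.scale (k + 1) := by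
      have := norm_add_le (x - T.point ω) (T.point ω - T.centre (k + 1) ω)
      rw [sub_add_sub_cancel] at this
      nlinarith
    have h5 := (h k ω x (T.point ω) h4 (by linarith)).2
    have hst := T.step_pos hd k
    have h6 := T.scale_le_mul_step hd hA k.2
    have h7 : T.density s k ≤ √(T.energy s) := by
      refine Real.le_sqrt_of_sq_le ?_
      exact Finset.single_le_sum (f := fun k : Fin T.depth => T.density s k ^ 2)
        (fun _ _ => sq_nonneg _) (Finset.mem_univ k)
    have h8 : 2 / A ≤ 1 := by rw [div_le_one (by linarith)]; linarith
    have hD := T.density_pos s k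
    have h9 : ‖x - T.point ω‖ / T.step k ≤ ρ * (1 * (1 / 2) ^ (T.depth - k)) := by
      rw [div_le_iff₀ hst, mul_assoc]
      refine hx.trans ?_
      gcongr
      exact h6.trans (by gcongr)
    calc _ ≤ C * √(T.energy s) * (ρ * (1 * (1 / 2) ^ (T.depth - k))) := h5.trans (by gcongr)
      _ = _ := by ring
  refine (norm_sum_le _ _).trans ((Finset.sum_le_sum fun k _ => hterm k).trans ?_)
  rw [← Finset.mul_sum]
  refine mul_le_of_le_one_right (by positivity) ?_
  rw [Fin.sum_univ_eq_sum_range (fun k => (1 / 2 : ℝ) ^ (T.depth - k)) T.depth]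
  have hgeom : ∀ n : ℕ, ∑ k ∈ Finset.range n, (1 / 2 : ℝ) ^ (n - k) = 1 - (1 / 2) ^ n := by
    intro n
    induction n with
    | zero => simp
    | succ n ih =>
      have e : ∀ k ∈ Finset.range n, (1 / 2 : ℝ) ^ (n + 1 - k) = (1 / 2) ^ (n - k) * (1 / 2) := by
        intro k hk
        rw [← pow_succ, Nat.succ_sub (Finset.mem_range.1 hk).le]
      rw [Finset.sum_range_succ, Finset.sum_congr rfl e, ← Finset.sum_mul, ih]
      simp only [add_tsub_cancel_left, pow_succ]
      ring
  rw [hgeom]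
  linarith [show (0 : ℝ) ≤ (1 / 2) ^ T.depth by positivity]

theorem exists_unit_smul_eq (hd : 1 ≤ d) (F : EuclideanSpace ℝ (Fin d)) :
    ∃ e : EuclideanSpace ℝ (Fin d), ‖e‖ = 1 ∧ inner ℝ F e = ‖F‖ := by
  by_cases hF : F = 0
  · exact ⟨EuclideanSpace.single ⟨0, hd⟩ 1, by simp, by simp [hF]⟩
  · refine ⟨‖F‖⁻¹ • F, norm_smul_inv_norm hF, ?_⟩
    rw [inner_smul_right, real_inner_self_eq_norm_sq]
    field_simp

theorem exists_large_riesz (hd : 1 ≤ d) {s : ℝ} (hs : 0 < s) (hsd : s < d) :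
    ∃ A ρ c κ : ℝ, 8 ≤ A ∧ 0 < ρ ∧ ρ ≤ 1 ∧ 0 < c ∧ 0 < κ ∧ ∀ T : GridTree d A,
      ∃ (G : Finset T.Address) (z : T.Address → EuclideanSpace ℝ (Fin d)),
      κ ≤ T.prob T.depth * G.card ∧ (∀ ω, ‖z ω - T.point ω‖ ≤ ρ * T.scale T.depth) ∧
      ∀ ω ∈ G, ∀ x ∈ closedBall (z ω) (ρ * T.scale T.depth / 4),
        c * √(T.density s T.depth ^ 2 + T.energy s) ≤
          ‖T.prob T.depth • ∑ ω', rieszKernel d s (T.point ω' - x)‖ := by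
  obtain ⟨A, C, ε, κ, hA, hC, hε, hκ, hT⟩ := exists_large_totalField hd hs hsd
  refine ⟨A, min 1 (ε / (2 * C)), min (1 / 4) (ε / 2), κ, hA, by positivity, min_le_left _ _,
    by positivity, hκ, fun T => ?_⟩
  set ρ := min 1 (ε / (2 * C)) with hρ
  have hρ0 : 0 < ρ := by positivity
  have hρ1 : ρ ≤ 1 := min_le_left _ _
  have hρ2 : C * ρ ≤ ε / 2 := by
    have := min_le_right 1 (ε / (2 * C))
    rw [← hρ, le_div_iff₀ (by positivity)] at this
    linarith
  have hl := T.scale_pos T.depth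
  obtain ⟨hF, hG⟩ := hT T
  choose e he1 he2 using fun ω => exists_unit_smul_eq hd (T.totalField s ω)
  refine ⟨_, fun ω => T.point ω - (ρ * T.scale T.depth / 2) • e ω, hG, fun ω => ?_,
    fun ω hω x hx => ?_⟩
  · rw [sub_sub_cancel_left, norm_neg, norm_smul, he1, Real.norm_of_nonneg (by positivity)]
    nlinarith [mul_pos hρ0 hl]
  · have hS0 : 0 ≤ T.energy s := Finset.sum_nonneg fun _ _ => sq_nonneg _
    have hω1 : ε * √(T.energy s) ≤ ‖T.totalField s ω‖ := by
      have := (Finset.mem_filter.1 hω).2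
      refine le_of_sq_le_sq ?_ (norm_nonneg _)
      rwa [mul_pow, Real.sq_sqrt hS0]
    set m := ρ * T.scale T.depth with hm
    have hm0 : 0 < m := by positivity
    set u := T.point ω - x with hu
    have hv : ‖u - (m / 2) • e ω‖ ≤ m / 4 := by
      rw [mem_closedBall, dist_eq_norm, ← norm_neg] at hx
      have e1 : u - (m / 2) • e ω = -(x - (T.point ω - (m / 2) • e ω)) := by
        rw [hu]; abel
      rwa [e1]
    have hux : ‖u‖ ≤ m := by
      have := norm_add_le (u - (m / 2) • e ω) ((m / 2) • e ω)
      rw [sub_add_cancel, norm_smul, he1, Real.norm_of_nonneg (by positivity)] at this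
      linarith
    have hue : m / 4 ≤ inner ℝ u (e ω) := by
      have h1 : inner ℝ u (e ω) = m / 2 + inner ℝ (u - (m / 2) • e ω) (e ω) := by
        rw [inner_sub_left u, real_inner_smul_left, real_inner_self_eq_norm_sq, he1]; ring
      have h2 := (abs_le.1 (abs_real_inner_le_norm (u - (m / 2) • e ω) (e ω))).1
      rw [he1, mul_one] at h2
      linarith
    have hu0 : 0 < ‖u‖ := norm_pos_iff.2 fun h0 => by
      rw [h0, inner_zero_left] at hue; linarith
    have hown : T.density s T.depth / 4 ≤
        T.prob T.depth * inner ℝ (rieszKernel d s u) (e ω) := by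
      have hp := T.prob_pos T.depth
      have h1 : T.scale T.depth ^ (-s) / 4 ≤ inner ℝ (rieszKernel d s u) (e ω) := by
        rw [rieszKernel, real_inner_smul_left]
        calc T.scale T.depth ^ (-s) / 4 ≤ m ^ (-s) / 4 := by
              gcongr ?_ / 4
              exact Real.rpow_le_rpow_of_nonpos hm0 (mul_le_of_le_one_left hl.le hρ1) (by linarith)
          _ = m ^ (-(s + 1)) * (m / 4) := by
              rw [neg_add', Real.rpow_sub_one hm0.ne']; field_simp
          _ ≤ _ := mul_le_mul (Real.rpow_le_rpow_of_nonpos hu0 hux (by linarith)) hue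
              (by positivity) (by positivity)
      rw [density, mul_div_assoc]
      gcongr
    have hdec : T.prob T.depth • ∑ ω', rieszKernel d s (T.point ω' - x) =
        T.prob T.depth • rieszKernel d s u + ∑ k, T.field s k ω x := by
      classical
      rw [sum_eq_add_sum_splits _ ω, smul_add, Finset.smul_sum]
      congr 1
    have hfield := hF.norm_sum_field_sub_le hC.le hd hA hρ1 ω (x := x) (by
      rw [← norm_neg, neg_sub]; exact hux)
    have hin : inner ℝ (∑ k, T.field s k ω x) (e ω) ≥ ε / 2 * √(T.energy s) := by
      have h1 : inner ℝ (∑ k, T.field s k ω x) (e ω) = ‖T.totalField s ω‖ +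
          inner ℝ (∑ k, T.field s k ω x - T.totalField s ω) (e ω) := by
        rw [inner_sub_left, he2]; ring
      have h2 := (abs_le.1 (abs_real_inner_le_norm
        (∑ k, T.field s k ω x - T.totalField s ω) (e ω))).1
      rw [he1, mul_one] at h2
      have h3 := mul_le_mul_of_nonneg_right hρ2 (Real.sqrt_nonneg (T.energy s))
      rw [h1]
      linarith
    have hD := T.density_pos s T.depth
    calc _ ≤ min (1 / 4) (ε / 2) * (T.density s T.depth + √(T.energy s)) := by
          gcongr
          refine Real.sqrt_le_iff.2 ⟨by positivity, ?_⟩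
          nlinarith [Real.sq_sqrt hS0, Real.sqrt_nonneg (T.energy s)]
      _ ≤ 1 / 4 * T.density s T.depth + ε / 2 * √(T.energy s) := by
          rw [mul_add]
          gcongr
          · exact min_le_left _ _
          · exact min_le_right _ _
      _ ≤ inner ℝ (T.prob T.depth • ∑ ω', rieszKernel d s (T.point ω' - x)) (e ω) := by
          rw [hdec, inner_add_left, real_inner_smul_left]
          linarith
      _ ≤ _ := by
          have := real_inner_le_norm (T.prob T.depth • ∑ ω', rieszKernel d s (T.point ω' - x)) (e ω)
          rwa [he1, mul_one] at this

end GridTree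

theorem volume_real_ball_euclidean {d : ℕ} (x : EuclideanSpace ℝ (Fin d)) {r : ℝ} (hr : 0 < r) :
    volume.real (ball x r) = r ^ d * volume.real (ball (0 : EuclideanSpace ℝ (Fin d)) 1) := by
  rw [Measure.real, Measure.addHaar_ball_of_pos _ _ hr, ENNReal.toReal_mul,
    ENNReal.toReal_ofReal (by positivity), finrank_euclideanSpace_fin, Measure.real]

theorem volume_real_unit_ball_pos (d : ℕ) :
    0 < volume.real (ball (0 : EuclideanSpace ℝ (Fin d)) 1) :=
  ENNReal.toReal_pos (measure_ball_pos _ _ one_pos).ne' measure_ball_lt_top.ne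

/-- A finite `2 * δ`-separated set in a ball of radius `R` has at most `((R + δ) / δ) ^ d`
elements. -/
theorem card_le_of_separated_euclidean {d : ℕ} {R δ : ℝ} (hδ : 0 < δ) (hR : 0 ≤ R)
    (z : EuclideanSpace ℝ (Fin d)) (I : Finset (EuclideanSpace ℝ (Fin d)))
    (hI : ∀ c ∈ I, ‖c - z‖ ≤ R) (hsep : ∀ c ∈ I, ∀ c' ∈ I, c ≠ c' → 2 * δ ≤ ‖c - c'‖) :
    (I.card : ℝ) ≤ ((R + δ) / δ) ^ d := by
  have hv := volume_real_unit_ball_pos d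
  have hdisj : Set.PairwiseDisjoint (I : Set (EuclideanSpace ℝ (Fin d))) fun c => ball c δ := by
    intro c hc c' hc' hne
    refine ball_disjoint_ball ?_
    rw [dist_eq_norm]
    linarith [hsep c hc c' hc' hne]
  have hsub : ⋃ c ∈ I, ball c δ ⊆ ball z (R + δ) :=
    iUnion₂_subset fun c hc => ball_subset_ball' (by
      rw [dist_eq_norm]; linarith [hI c hc])
  have h := measureReal_mono (μ := volume) hsub measure_ball_lt_top.ne
  rw [measureReal_biUnion_finset hdisj (fun c _ => measurableSet_ball)
      (fun c _ => measure_ball_lt_top.ne),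
    Finset.sum_congr rfl fun c _ => volume_real_ball_euclidean c hδ, Finset.sum_const, nsmul_eq_mul,
    volume_real_ball_euclidean z (by positivity), ← mul_assoc] at h
  rw [div_pow, le_div_iff₀ (by positivity)]
  exact le_of_mul_le_mul_right h hv

namespace GridTree

variable {d : ℕ} {A : ℝ} (T : GridTree d A)

theorem step_succ_le (hd : 1 ≤ d) (hA : 8 ≤ A) {k i : ℕ} (hki : k < i) :
    T.step i ≤ T.step k / 8 := by
  have h1 := T.step_le_half_scale hd i
  have h2 := T.scale_anti hd hA (show k + 1 ≤ i from hki)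
  have h3 := T.mul_scale_succ_le_step hd k
  have := T.scale_pos (k + 1)
  nlinarith

theorem step_div_two_le_norm_centre_sub (hd : 1 ≤ d) (hA : 8 ≤ A) {i : Fin T.depth}
    {ω ω' : T.Address} (h : ¬ ∀ j ≤ i, ω j = ω' j) :
    T.step i / 2 ≤ ‖T.centre (i + 1) ω - T.centre (i + 1) ω'‖ := by
  have hne : ω ≠ ω' := by rintro rfl; exact h fun _ _ => rfl
  obtain ⟨k, hk⟩ := T.exists_splits hne
  have hki : k ≤ i := by
    by_contra! hlt
    exact h fun j hj => hk.1 j (hj.trans_lt hlt)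
  have h1 : T.step k ≤ ‖T.centre (k + 1) ω - T.centre (k + 1) ω'‖ := by
    have := T.one_le_norm_vec_sub k hk.2.symm
    have hst := T.step_pos hd k
    rw [norm_sub_rev, T.centre_sub_of_splits hk, norm_smul, Real.norm_of_nonneg hst.le]
    nlinarith
  have h2 := T.norm_centre_sub_le hd hA (j := k + 1) (m := i + 1) (by simpa using hki) ω
  have h3 := T.norm_centre_sub_le hd hA (j := k + 1) (m := i + 1) (by simpa using hki) ω'
  have h4 := T.mul_scale_succ_le_step hd k
  have h5 := T.scale_pos (k + 1)
  have h6 := T.scale_pos (i + 1)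
  have h7 : ‖T.centre (k + 1) ω - T.centre (k + 1) ω'‖ ≤
      ‖T.centre (i + 1) ω - T.centre (i + 1) ω'‖ + ‖T.centre (i + 1) ω - T.centre (k + 1) ω‖ +
        ‖T.centre (i + 1) ω' - T.centre (k + 1) ω'‖ := by
    have e : T.centre (k + 1) ω - T.centre (k + 1) ω' =
        (T.centre (i + 1) ω - T.centre (i + 1) ω') - (T.centre (i + 1) ω - T.centre (k + 1) ω) +
          (T.centre (i + 1) ω' - T.centre (k + 1) ω') := by abel
    rw [e]
    exact (norm_add_le _ _).trans (by gcongr; exact norm_sub_le _ _)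
  have h8 : T.step i ≤ T.step k := by
    rcases hki.eq_or_lt with rfl | hlt
    · exact le_rfl
    · have := T.step_succ_le hd hA (Fin.lt_def.1 hlt)
      have := T.step_pos hd k
      linarith
  nlinarith

theorem prob_mul_card_filter_prefix (i : Fin T.depth) (ω : T.Address) :
    T.prob T.depth * (Finset.univ.filter fun ω' : T.Address => ∀ j ≤ i, ω j = ω' j).card =
      T.prob (i + 1) := by
  classical
  have h := T.prob_mul_sum_prefix i ω fun a => if ω i = a then 1 else 0
  rw [Finset.sum_ite_eq, if_pos (Finset.mem_univ _), mul_one, ← prob_succ] at h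
  rw [← h, Finset.card_filter]
  push_cast
  congr 1
  refine Finset.sum_congr rfl fun ω' _ => ?_
  have : (∀ j ≤ i, ω j = ω' j) ↔ (∀ j < i, ω j = ω' j) ∧ ω i = ω' i :=
    ⟨fun h => ⟨fun j hj => h j hj.le, h i le_rfl⟩, fun h j hj =>
      hj.eq_or_lt.elim (fun e => e ▸ h.2) (h.1 j)⟩
  by_cases h1 : ∀ j < i, ω j = ω' j <;> by_cases h2 : ω i = ω' i <;> simp [this, h1, h2]

theorem prob_mul_card_le (hd : 1 ≤ d) (hA : 8 ≤ A) (i : Fin T.depth)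
    (z : EuclideanSpace ℝ (Fin d)) {R : ℝ} (hR : 0 ≤ R) :
    T.prob T.depth * (Finset.univ.filter fun ω : T.Address => ‖T.point ω - z‖ ≤ R).card ≤
      T.prob (i + 1) * ((R + T.scale (i + 1) + T.step i / 4) / (T.step i / 4)) ^ d := by
  classical
  set F := Finset.univ.filter fun ω : T.Address => ‖T.point ω - z‖ ≤ R with hF
  have hst := T.step_pos hd i
  have hp := T.prob_pos (i + 1)
  have hl := T.scale_pos (i + 1)
  have hpL := T.prob_pos T.depth
  set c : T.Address → EuclideanSpace ℝ (Fin d) := T.centre (i + 1) with hc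
  have hI := card_le_of_separated_euclidean (R := R + T.scale (i + 1)) (δ := T.step i / 4)
    (by positivity) (by positivity) z (F.image c) (by
      intro b hb
      obtain ⟨ω, hω, rfl⟩ := Finset.mem_image.1 hb
      have h1 := (Finset.mem_filter.1 hω).2
      have h2 := T.norm_point_sub_centre_le hd hA (j := i + 1) i.2 ω
      rw [norm_sub_rev] at h2
      have := norm_add_le (c ω - T.point ω) (T.point ω - z)
      rw [sub_add_sub_cancel] at this
      linarith) (by
      intro b hb b' hb' hne
      obtain ⟨ω, -, rfl⟩ := Finset.mem_image.1 hb
      obtain ⟨ω', -, rfl⟩ := Finset.mem_image.1 hb'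
      have := T.step_div_two_le_norm_centre_sub hd hA (i := i) (ω := ω) (ω' := ω') fun h =>
        hne (T.centre_congr fun j hj => h j (Fin.le_def.2 (by omega)))
      linarith)
  refine le_trans ?_ (mul_le_mul_of_nonneg_left hI hp.le)
  rw [Finset.card_eq_sum_card_image c F]
  push_cast
  rw [Finset.mul_sum, mul_comm (T.prob _), ← nsmul_eq_mul, ← Finset.sum_const]
  refine Finset.sum_le_sum fun b hb => ?_
  obtain ⟨ω, -, rfl⟩ := Finset.mem_image.1 hb
  rw [← T.prob_mul_card_filter_prefix i ω]
  gcongr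
  intro ω' hω'
  refine Finset.mem_filter.2 ⟨Finset.mem_univ _, ?_⟩
  by_contra hne
  have h1 := T.step_div_two_le_norm_centre_sub hd hA hne
  change _ ≤ ‖c ω - c ω'‖ at h1
  rw [(Finset.mem_filter.1 hω').2, sub_self, norm_zero] at h1
  linarith

/-- The Frostman estimate: `T.prob T.depth` times the number of finest nodes meeting a ball,
weighted by the proportion of a finest node covered by the ball. -/
theorem prob_mul_card_mul_le (hd : 1 ≤ d) (hA : 8 ≤ A) {h : ℝ → ℝ} {M₀ ρ : ℝ} (hM₀ : 0 < M₀)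
    (hρ : 0 < ρ) (hρ1 : ρ ≤ 1) (hmono : MonotoneOn h (Ici 0))
    (hdoub : ∀ r₁ r₂ : ℝ, 0 < r₁ → r₁ ≤ r₂ → h r₂ / r₂ ^ d ≤ h r₁ / r₁ ^ d)
    (hT : ∀ i ≤ T.depth, h (T.scale i) = T.prob i * M₀) (z : EuclideanSpace ℝ (Fin d)) {r : ℝ}
    (hr : 0 < r) :
    T.prob T.depth *
        (Finset.univ.filter fun ω : T.Address => ‖T.point ω - z‖ ≤ r + 2 * T.scale T.depth).card *
        min 1 ((r / (ρ * T.scale T.depth / 4)) ^ d) ≤ (240 * d / ρ) ^ d / M₀ * h r := by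
  set L := T.depth with hL
  set ℓ := T.scale L with hℓ
  have hl : 0 < ℓ := T.scale_pos L
  have hpL := T.prob_pos L
  have hd1 : (1 : ℝ) ≤ d := by exact_mod_cast hd
  set K := (240 * d / ρ) ^ d with hK
  have hdρ : (d : ℝ) ≤ d / ρ := by rw [le_div_iff₀ hρ]; nlinarith
  have hKle : ∀ x : ℝ, 0 ≤ x → x ≤ 240 * d / ρ → x ^ d ≤ K := fun x h0 hx => by
    rw [hK]; gcongr
  have hKd : 240 * d / ρ = 240 * (d / ρ) := by ring
  set m := Finset.univ.filter fun ω : T.Address => ‖T.point ω - z‖ ≤ r + 2 * ℓ with hm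
  have hm1 : T.prob L * m.card ≤ 1 := by
    rw [← T.card_address]
    gcongr
    exact Finset.card_le_univ _
  have hm0 : 0 ≤ T.prob L * m.card := by positivity
  have hlow : ∀ i ≤ L, r ≤ T.scale i → T.prob i * (r / T.scale i) ^ d ≤ h r / M₀ := by
    intro i hi hri
    have hli := T.scale_pos i
    have h1 := hdoub r (T.scale i) hr hri
    rw [hT i hi, div_le_div_iff₀ (by positivity) (by positivity)] at h1
    rw [le_div_iff₀ hM₀, div_pow, mul_div_assoc', div_mul_eq_mul_div,
      div_le_iff₀ (by positivity)]
    linarith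
  have hup : ∀ i ≤ L, T.scale i ≤ r → T.prob i ≤ h r / M₀ := by
    intro i hi hri
    rw [le_div_iff₀ hM₀, ← hT i hi]
    exact hmono (T.scale_pos i).le hr.le hri
  rw [div_mul_eq_mul_div, mul_div_assoc K]
  rcases le_or_gt (T.scale 0) r with h0 | h0
  · have h1 := hup 0 (Nat.zero_le _) h0
    rw [T.prob_zero] at h1
    have h2 : 1 ^ d ≤ K := hKle 1 zero_le_one (by rw [hKd]; linarith)
    rw [one_pow] at h2
    calc _ ≤ 1 * 1 := mul_le_mul hm1 (min_le_left _ _) (by positivity) zero_le_one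
      _ ≤ _ := mul_le_mul h2 h1 zero_le_one (by positivity)
  rcases lt_or_ge r ℓ with hrl | hrl
  · have h1 := hlow L le_rfl hrl.le
    have h2 : T.prob L * m.card ≤ T.prob L * 3 ^ d := by
      rcases Nat.eq_zero_or_pos L with hL0 | hL0
      · have : T.prob L = 1 := by rw [hL0, T.prob_zero]
        rw [this] at hm1 ⊢
        linarith [one_le_pow₀ (show (1 : ℝ) ≤ 3 by norm_num) (n := d)]
      · obtain ⟨i, hi⟩ : ∃ i, L = i + 1 := ⟨L - 1, by omega⟩
        have h3 := T.prob_mul_card_le hd hA ⟨i, by omega⟩ z (R := r + 2 * ℓ) (by positivity)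
        have h4 := T.mul_scale_succ_le_step hd i
        have h5 := T.step_pos hd i
        simp only [← hi, ← hL, ← hℓ] at h3 h4
        refine h3.trans ?_
        gcongr
        rw [div_le_iff₀ (by positivity)]
        nlinarith
    calc _ ≤ T.prob L * 3 ^ d * (r / (ρ * ℓ / 4)) ^ d :=
          mul_le_mul h2 (min_le_right _ _) (by positivity) (by positivity)
      _ = (12 / ρ) ^ d * (T.prob L * (r / ℓ) ^ d) := by
          have : r / (ρ * ℓ / 4) = 4 / ρ * (r / ℓ) := by field_simp
          rw [this, mul_pow, show 12 / ρ = 3 * (4 / ρ) by ring, mul_pow 3]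
          ring
      _ ≤ _ := by
          refine mul_le_mul (hKle _ (by positivity) ?_) h1 (by positivity) (by positivity)
          gcongr
          linarith
  · obtain ⟨i, hiL, hi1, hi2⟩ : ∃ i < L, T.scale (i + 1) ≤ r ∧ r < T.scale i := by
      classical
      have hex : ∃ n, T.scale n ≤ r := ⟨L, hrl⟩
      have hn := Nat.find_spec hex
      have hpos : Nat.find hex ≠ 0 := fun e => by
        rw [e] at hn; linarith
      have hmin := Nat.find_min hex (m := Nat.find hex - 1) (by omega)
      have hle : Nat.find hex ≤ L := Nat.find_min' hex hrl
      refine ⟨Nat.find hex - 1, by omega, ?_, not_le.1 hmin⟩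
      rwa [Nat.sub_add_cancel (by omega)]
    have h3 := T.prob_mul_card_le hd hA ⟨i, hiL⟩ z (R := r + 2 * ℓ) (by positivity)
    have hst := T.step_pos hd i
    have hB := T.branch_pos i
    have hpi := T.prob_pos (i + 1)
    have hpi' := T.prob_pos i
    have hli := T.scale_pos i
    simp only at h3
    have h4 : T.prob L * m.card ≤
        T.prob (i + 1) * ((4 * r + T.step i / 4) / (T.step i / 4)) ^ d := by
      refine h3.trans ?_
      have := T.scale_pos (i + 1)
      gcongr
      linarith
    have h5 : T.prob L * m.card * min 1 ((r / (ρ * ℓ / 4)) ^ d) ≤ T.prob L * m.card * 1 := by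
      gcongr
      exact min_le_left _ _
    rw [mul_one] at h5
    refine h5.trans (h4.trans ?_)
    rcases le_or_gt r (T.step i / 4) with hrs | hrs
    · have h6 : (4 * r + T.step i / 4) / (T.step i / 4) ≤ 5 := by
        rw [div_le_iff₀ (by positivity)]; linarith
      calc _ ≤ T.prob (i + 1) * 5 ^ d := by gcongr
        _ = 5 ^ d * T.prob (i + 1) := mul_comm _ _
        _ ≤ _ := mul_le_mul (hKle 5 (by norm_num) (by rw [hKd]; linarith))
            (hup (i + 1) hiL hi1) hpi.le (by positivity)
    · have h6 : (4 * r + T.step i / 4) / (T.step i / 4) ≤ 20 * d * T.branch i * (r / T.scale i) := by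
        rw [div_le_iff₀ (by positivity), step]
        rw [step] at hrs
        field_simp at hrs ⊢
        linarith
      calc _ ≤ T.prob (i + 1) * (20 * d * T.branch i * (r / T.scale i)) ^ d := by gcongr
        _ = (20 * d) ^ d * (T.prob i * (r / T.scale i) ^ d) := by
            rw [T.prob_succ, mul_pow, mul_pow _ (T.branch i : ℝ)]
            field_simp
        _ ≤ _ := mul_le_mul (hKle _ (by positivity) (by rw [hKd]; linarith))
            (hlow i hiL.le hi2.le) (by positivity) (by positivity)

end GridTree

namespace GridTree

variable {d : ℕ} {A : ℝ} (T : GridTree d A)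

theorem le_hContent (hd : 1 ≤ d) (hA : 8 ≤ A) {h : ℝ → ℝ} {M₀ ρ κ : ℝ} (hM₀ : 0 < M₀)
    (hρ : 0 < ρ) (hρ1 : ρ ≤ 1) (hmono : MonotoneOn h (Ici 0))
    (hdoub : ∀ r₁ r₂ : ℝ, 0 < r₁ → r₁ ≤ r₂ → h r₂ / r₂ ^ d ≤ h r₁ / r₁ ^ d)
    (hT : ∀ i ≤ T.depth, h (T.scale i) = T.prob i * M₀)
    (G : Finset T.Address) (hG : κ ≤ T.prob T.depth * G.card)
    (z : T.Address → EuclideanSpace ℝ (Fin d))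
    (hz : ∀ ω, ‖z ω - T.point ω‖ ≤ ρ * T.scale T.depth) (Z : Set (EuclideanSpace ℝ (Fin d)))
    (hZ : ∀ ω ∈ G, closedBall (z ω) (ρ * T.scale T.depth / 4) ⊆ Z) :
    ENNReal.ofReal (κ * M₀ / (240 * d / ρ) ^ d) ≤ hContent d h Z := by
  have hl := T.scale_pos T.depth
  have hp := T.prob_pos T.depth
  have hd0 : (0 : ℝ) < d := by exact_mod_cast hd
  set K := (240 * d / ρ) ^ d with hK
  have hK0 : 0 < K := by positivity
  set m := ρ * T.scale T.depth / 4 with hm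
  have hm0 : 0 < m := by positivity
  set v := volume.real (ball (0 : EuclideanSpace ℝ (Fin d)) 1) with hv
  have hv0 : 0 < v := volume_real_unit_ball_pos d
  have hvol : ∀ (x : EuclideanSpace ℝ (Fin d)) {r : ℝ}, 0 < r →
      volume (closedBall x r) = ENNReal.ofReal (r ^ d * v) := by
    intro x r hr
    rw [Measure.addHaar_closedBall _ _ hr.le, finrank_euclideanSpace_fin,
      ENNReal.ofReal_mul (by positivity), hv, Measure.real,
      ENNReal.ofReal_toReal measure_ball_lt_top.ne]
  set w : ℝ≥0∞ := ENNReal.ofReal (T.prob T.depth / (m ^ d * v)) with hw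
  -- the mass of one covering ball
  have hball : ∀ (y : EuclideanSpace ℝ (Fin d)) (r : ℝ), 0 < r →
      ∑ ω ∈ G, w * volume (closedBall (z ω) m ∩ closedBall y r) ≤
        ENNReal.ofReal (K / M₀ * h r) := by
    intro y r hr
    have hfrost := T.prob_mul_card_mul_le hd hA hM₀ hρ hρ1 hmono hdoub hT y hr
    rw [← hm] at hfrost
    refine le_trans ?_ (ENNReal.ofReal_le_ofReal hfrost)
    set F := Finset.univ.filter fun ω : T.Address => ‖T.point ω - y‖ ≤ r + 2 * T.scale T.depth
    have hterm : ∀ ω, w * volume (closedBall (z ω) m ∩ closedBall y r) ≤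
        if ω ∈ F then ENNReal.ofReal (T.prob T.depth * min 1 ((r / m) ^ d)) else 0 := by
      intro ω
      split_ifs with hω
      · have h1 : volume (closedBall (z ω) m ∩ closedBall y r) ≤
            ENNReal.ofReal (min (m ^ d * v) (r ^ d * v)) := by
          rw [ENNReal.ofReal_min, ← hvol (z ω) hm0, ← hvol y hr]
          exact le_min (measure_mono inter_subset_left) (measure_mono inter_subset_right)
        refine (mul_le_mul_right h1 w).trans_eq ?_
        rw [hw, ← ENNReal.ofReal_mul (by positivity)]
        congr 1
        have e : r ^ d * v = m ^ d * v * (r / m) ^ d := by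
          rw [mul_right_comm, ← mul_pow, mul_div_cancel₀ _ hm0.ne']
        nth_rewrite 2 [← mul_one (m ^ d * v)]
        rw [e, ← mul_min_of_nonneg _ _ (by positivity)]
        generalize min 1 ((r / m) ^ d) = q
        clear_value m
        field_simp
      · rw [nonpos_iff_eq_zero, mul_eq_zero]
        right
        refine measure_mono_null (t := ∅) (fun x hx => hω ?_) measure_empty
        have h1 := hz ω
        have h2 := mem_closedBall_iff_norm.1 hx.1
        have h3 := mem_closedBall_iff_norm.1 hx.2
        refine Finset.mem_filter.2 ⟨Finset.mem_univ _, ?_⟩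
        have h4 := norm_add₃_le (a := x - y) (b := -(x - z ω)) (c := -(z ω - T.point ω))
        rw [norm_neg, norm_neg] at h4
        have e : x - y + -(x - z ω) + -(z ω - T.point ω) = T.point ω - y := by abel
        rw [e] at h4
        have h5 : ρ * T.scale T.depth ≤ T.scale T.depth := mul_le_of_le_one_left hl.le hρ1
        linarith
    calc _ ≤ ∑ ω, if ω ∈ F then ENNReal.ofReal (T.prob T.depth * min 1 ((r / m) ^ d)) else 0 :=
          (Finset.sum_le_sum fun ω _ => hterm ω).trans
            (Finset.sum_le_sum_of_subset (Finset.subset_univ _))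
      _ = _ := by
          rw [Finset.sum_ite_mem, Finset.univ_inter, Finset.sum_const, nsmul_eq_mul,
            ← ENNReal.ofReal_natCast, ← ENNReal.ofReal_mul (by positivity)]
          congr 1; ring
  refine le_iInf₂ fun y r => le_iInf₂ fun hr hcov => ?_
  have htot : ENNReal.ofReal κ ≤ ∑' j, ENNReal.ofReal (K / M₀ * h (r j)) := by
    calc ENNReal.ofReal κ ≤ ∑ ω ∈ G, w * volume (closedBall (z ω) m) := by
          simp_rw [hvol _ hm0]
          rw [Finset.sum_const, nsmul_eq_mul, hw, ← ENNReal.ofReal_mul (by positivity),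
            ← ENNReal.ofReal_natCast, ← ENNReal.ofReal_mul (by positivity)]
          refine ENNReal.ofReal_le_ofReal (hG.trans_eq ?_)
          field_simp
      _ ≤ ∑ ω ∈ G, w * ∑' j, volume (closedBall (z ω) m ∩ closedBall (y j) (r j)) := by
          gcongr with ω hω
          refine (measure_mono fun x hx => ?_).trans (measure_iUnion_le _)
          rw [← inter_iUnion]
          exact ⟨hx, hcov (hZ ω hω hx)⟩
      _ = ∑' j, ∑ ω ∈ G, w * volume (closedBall (z ω) m ∩ closedBall (y j) (r j)) := by
          simp_rw [← ENNReal.tsum_mul_left]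
          exact (Summable.tsum_finsetSum fun _ _ => ENNReal.summable).symm
      _ ≤ _ := ENNReal.tsum_le_tsum fun j => hball (y j) (r j) (hr j)
  simp_rw [ENNReal.ofReal_mul (show 0 ≤ K / M₀ by positivity)] at htot
  rw [ENNReal.tsum_mul_left] at htot
  have e : κ * M₀ / K = (K / M₀)⁻¹ * κ := by field_simp
  rw [e, ENNReal.ofReal_mul (by positivity), ENNReal.ofReal_inv_of_pos (by positivity),
    mul_comm, ← div_eq_mul_inv]
  exact ENNReal.div_le_of_le_mul' htot

end GridTree

theorem exists_dirac_approx {d : ℕ} (hd : 1 ≤ d) {s : ℝ} (hs : 0 < s) {α : Type*} [Fintype α]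
    {y : α → EuclideanSpace ℝ (Fin d)} (hy : Function.Injective y) {p : ℝ} (hp : 0 < p)
    (hpc : p * Fintype.card α = 1) {R₀ : ℝ} (hyR : ∀ ω, ‖y ω‖ ≤ R₀) {η δ : ℝ} (hη : 0 < η)
    (hδ : 0 < δ) {N : ℕ} (hN : Fintype.card α < N) :
    ∃ (x : Fin N → EuclideanSpace ℝ (Fin d)) (a : Fin N → ℝ), Function.Injective x ∧
      (∀ i, 0 < a i) ∧ ∑ i, a i = η ∧ ∀ z, ‖z‖ ≤ R₀ →
        ‖∑ i, a i • rieszKernel d s (x i - z) -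
          (η / 2) • p • ∑ ω, rieszKernel d s (y ω - z)‖ ≤ δ := by
  obtain ⟨r, hr0, hr⟩ : ∃ r : ℝ, 0 < r ∧ r ^ (-s) < δ / (η / 2) := by
    have h1 := (tendsto_rpow_neg_atTop hs).eventually_lt_const
      (show 0 < δ / (η / 2) by positivity)
    obtain ⟨r, h2, h3⟩ := (h1.and (eventually_gt_atTop 0)).exists
    exact ⟨r, h3, h2⟩
  set m := N - Fintype.card α with hm
  have hm0 : (0 : ℝ) < m := by exact_mod_cast (by omega : 0 < m)
  let e : Fin N ≃ α ⊕ Fin m := Fintype.equivOfCardEq (by simp; omega)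
  obtain ⟨e₀, he₀⟩ : ∃ e₀ : EuclideanSpace ℝ (Fin d), ‖e₀‖ = 1 :=
    ⟨EuclideanSpace.single ⟨0, hd⟩ 1, by simp⟩
  have hR₀ : 0 ≤ R₀ := by
    have : Nonempty α := by
      by_contra hα
      rw [not_nonempty_iff] at hα
      simp at hpc
    exact (norm_nonneg _).trans (hyR (Classical.arbitrary α))
  let f : Fin m → EuclideanSpace ℝ (Fin d) := fun j => (2 * R₀ + r + (j : ℕ)) • e₀
  have hf : ∀ j, 2 * R₀ + r ≤ ‖f j‖ := by
    intro j
    have : (0 : ℝ) ≤ (j : ℕ) := Nat.cast_nonneg _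
    rw [norm_smul, he₀, mul_one, Real.norm_of_nonneg (by positivity)]
    linarith
  refine ⟨Sum.elim y f ∘ e, Sum.elim (fun _ => η / 2 * p) (fun _ => η / 2 / m) ∘ e, ?_, ?_, ?_, ?_⟩
  · refine (hy.sumElim (fun j k hjk => ?_) fun ω j h => ?_).comp e.injective
    · have he : e₀ ≠ 0 := norm_pos_iff.1 (by rw [he₀]; exact one_pos)
      have := smul_left_injective ℝ he hjk
      exact Fin.ext (by exact_mod_cast add_left_cancel this)
    · have h1 := hyR ω
      have h2 := hf j
      rw [← h] at h2
      linarith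
  · intro i
    rcases h : e i with ω | j <;> simp [h] <;> positivity
  · simp_rw [Function.comp_apply]
    rw [Equiv.sum_comp e (Sum.elim (fun _ => η / 2 * p) (fun _ => η / 2 / m)),
      Fintype.sum_sum_type]
    simp only [Sum.elim_inl, Sum.elim_inr, Finset.sum_const, Finset.card_univ, Fintype.card_fin,
      nsmul_eq_mul]
    field_simp
    linear_combination hpc
  · intro z hz
    simp_rw [Function.comp_apply]
    rw [Equiv.sum_comp e fun i => Sum.elim (fun _ => η / 2 * p) (fun _ => η / 2 / m) i •
      rieszKernel d s (Sum.elim y f i - z), Fintype.sum_sum_type]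
    simp only [Sum.elim_inl, Sum.elim_inr]
    rw [← Finset.smul_sum, mul_smul, add_sub_cancel_left]
    have hterm : ∀ j ∈ Finset.univ, ‖(η / 2 / m) • rieszKernel d s (f j - z)‖ ≤ δ / m := by
      intro j _
      have h1 : r ≤ ‖f j - z‖ := by
        have := norm_sub_norm_le (f j) z
        linarith [hf j]
      rw [norm_smul, norm_rieszKernel (hr0.trans_le h1), Real.norm_of_nonneg (by positivity)]
      have h2 : ‖f j - z‖ ^ (-s) ≤ r ^ (-s) :=
        Real.rpow_le_rpow_of_nonpos hr0 h1 (by linarith)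
      calc _ ≤ η / 2 / m * (δ / (η / 2)) := by gcongr; exact h2.trans hr.le
        _ = _ := by field_simp
    refine (norm_sum_le_of_le _ hterm).trans_eq ?_
    rw [Finset.sum_const, Finset.card_univ, Fintype.card_fin, nsmul_eq_mul]
    field_simp

namespace GridTree

variable {d : ℕ} {A : ℝ} (T : GridTree d A)

theorem point_injective (hd : 1 ≤ d) (hA : 8 ≤ A) : Function.Injective T.point := by
  intro ω ω' h
  by_contra hne
  obtain ⟨k, hk⟩ := T.exists_splits hne
  have h0 := T.scale_pos (k + 1)
  have h1 := (T.norm_bounds_of_splits hd hA hk (x := T.point ω)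
    ((T.norm_point_sub_centre_le hd hA k.2 ω).trans (by linarith))).1
  rw [h, sub_self, norm_zero] at h1
  have h2 := T.one_le_norm_vec_sub k hk.2.symm
  have h3 := T.step_pos hd k
  nlinarith

theorem exists_combination_large_content (hd : 1 ≤ d) {s : ℝ} (hs : 0 < s) (hsd : s < d) :
    ∃ A c₁ c₂ : ℝ, 8 ≤ A ∧ 0 < c₁ ∧ 0 < c₂ ∧ ∀ (T : GridTree d A) (h : ℝ → ℝ) (M₀ : ℝ), 0 < M₀ →
      MonotoneOn h (Ici 0) →
      (∀ r₁ r₂ : ℝ, 0 < r₁ → r₁ ≤ r₂ → h r₂ / r₂ ^ d ≤ h r₁ / r₁ ^ d) →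
      (∀ i ≤ T.depth, h (T.scale i) = T.prob i * M₀) →
      ∀ η P : ℝ, 0 < η → P < c₁ * η * √(T.density s T.depth ^ 2 + T.energy s) →
      ∀ N : ℕ, Fintype.card T.Address < N →
      ∃ (x : Fin N → EuclideanSpace ℝ (Fin d)) (a : Fin N → ℝ), Function.Injective x ∧
        (∀ i, 0 < a i) ∧ ∑ i, a i = η ∧
        ENNReal.ofReal (c₂ * M₀) ≤ hContent d h
          {z | rieszExists d s (∑ i, ENNReal.ofReal (a i) • Measure.dirac (x i)) z ∧
            P < ‖rieszTransform d s (∑ i, ENNReal.ofReal (a i) • Measure.dirac (x i)) z‖} := by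
  obtain ⟨A, ρ, c, κ, hA, hρ, hρ1, hc, hκ, H⟩ := exists_large_riesz hd hs hsd
  have hd0 : (0 : ℝ) < d := by exact_mod_cast hd
  refine ⟨A, c / 2, κ / (240 * d / ρ) ^ d, hA, by positivity, by positivity, ?_⟩
  intro T h M₀ hM₀ hmono hdoub hT η P hη hP N hN
  obtain ⟨G, z, hG, hz, hfield⟩ := H T
  set S := √(T.density s T.depth ^ 2 + T.energy s)
  have hl := T.scale_pos T.depth
  obtain ⟨R, hR⟩ : ∃ R, ∀ ω, ‖T.point ω‖ ≤ R :=
    ⟨∑ ω, ‖T.point ω‖, fun ω =>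
      Finset.single_le_sum (f := fun ω => ‖T.point ω‖) (fun _ _ => norm_nonneg _)
        (Finset.mem_univ ω)⟩
  obtain ⟨x, a, hx, ha, hsum, hxa⟩ := exists_dirac_approx hd hs (T.point_injective hd hA)
    (T.prob_pos _) T.card_address (R₀ := R + 2 * T.scale T.depth)
    (fun ω => (hR ω).trans (by linarith)) hη (δ := (c / 2 * η * S - P) / 2) (by linarith) hN
  refine ⟨x, a, hx, ha, hsum, ?_⟩
  rw [div_mul_eq_mul_div]
  refine T.le_hContent hd hA hM₀ hρ hρ1 hmono hdoub hT G hG z hz _ fun ω hω y hy => ?_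
  refine ⟨rieszExists_sum_dirac a (fun i => (ha i).le) x y, ?_⟩
  rw [rieszTransform_sum_dirac a (fun i => (ha i).le) x y]
  have hyR : ‖y‖ ≤ R + 2 * T.scale T.depth := by
    have h1 := hz ω
    have h2 := mem_closedBall_iff_norm.1 hy
    have h3 : ρ * T.scale T.depth ≤ T.scale T.depth := mul_le_of_le_one_left hl.le hρ1
    have h4 := norm_add₃_le (a := y - z ω) (b := z ω - T.point ω) (c := T.point ω)
    rw [sub_add_sub_cancel, sub_add_cancel] at h4
    linarith [hR ω]
  have h1 := hxa y hyR
  have h2 := mul_le_mul_of_nonneg_left (hfield ω hω y hy) (by positivity : 0 ≤ η / 2)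
  have h3 := norm_sub_norm_le ((η / 2) • T.prob T.depth • ∑ ω', rieszKernel d s (T.point ω' - y))
    (∑ i, a i • rieszKernel d s (x i - y))
  rw [norm_sub_rev, norm_smul, Real.norm_of_nonneg (by positivity : 0 ≤ η / 2)] at h3
  linarith

end GridTree

/-- A measure function `h` with `h r / r ^ d` nonincreasing, together with its inverse. -/
structure IsGauge (d : ℕ) (h hinv : ℝ → ℝ) : Prop where
  continuousOn : ContinuousOn h (Ici 0)
  strictMonoOn : StrictMonoOn h (Ici 0)
  map_zero : h 0 = 0
  div_pow_le : ∀ r₁ r₂ : ℝ, 0 < r₁ → r₁ ≤ r₂ → h r₂ / r₂ ^ d ≤ h r₁ / r₁ ^ d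
  left_inv : ∀ t, 0 ≤ t → hinv (h t) = t
  right_inv : ∀ u, 0 ≤ u → 0 ≤ hinv u ∧ h (hinv u) = u

namespace IsGauge

variable {d : ℕ} {h hinv : ℝ → ℝ}

theorem mono (hh : IsGauge d h hinv) {t u : ℝ} (ht : 0 ≤ t) (htu : t ≤ u) : h t ≤ h u :=
  hh.strictMonoOn.monotoneOn ht (ht.trans htu) htu

theorem pos (hh : IsGauge d h hinv) {t : ℝ} (ht : 0 < t) : 0 < h t := by
  have := hh.strictMonoOn self_mem_Ici ht.le ht
  rwa [hh.map_zero] at this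

theorem inv_pos (hh : IsGauge d h hinv) {u : ℝ} (hu : 0 < u) : 0 < hinv u := by
  obtain ⟨h1, h2⟩ := hh.right_inv u hu.le
  refine h1.lt_of_ne fun h0 => ?_
  rw [← h0, hh.map_zero] at h2
  exact hu.ne h2

theorem inv_le_iff (hh : IsGauge d h hinv) {u t : ℝ} (hu : 0 ≤ u) (ht : 0 ≤ t) : hinv u ≤ t ↔ u ≤ h t := by
  obtain ⟨h1, h2⟩ := hh.right_inv u hu
  rw [← hh.strictMonoOn.le_iff_le h1 ht, h2]

theorem inv_mono (hh : IsGauge d h hinv) {u v : ℝ} (hu : 0 ≤ u) (huv : u ≤ v) : hinv u ≤ hinv v := by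
  obtain ⟨h1, h2⟩ := hh.right_inv v (hu.trans huv)
  rwa [hh.inv_le_iff hu h1, h2]

theorem continuousOn_integrand (hh : IsGauge d h hinv) (s : ℝ) :
    ContinuousOn (fun t => (h t / t ^ s) ^ 2 / t) (Ioi 0) := by
  refine (((hh.continuousOn.mono Ioi_subset_Ici_self).div
    (continuousOn_id.rpow_const fun t ht => Or.inl (ne_of_gt ht)) fun t ht => ?_).pow 2).div
    continuousOn_id fun t ht => ne_of_gt ht
  exact (Real.rpow_pos_of_pos ht s).ne'

theorem intervalIntegrable_integrand (hh : IsGauge d h hinv) (s : ℝ) {a b : ℝ} (ha : 0 < a) (hb : 0 < b) :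
    IntervalIntegrable (fun t => (h t / t ^ s) ^ 2 / t) volume a b :=
  ((hh.continuousOn_integrand s).mono fun _ ht =>
    (lt_min ha hb).trans_le ht.1).intervalIntegrable

theorem integral_le_of_le_mul_pow (hh : IsGauge d h hinv) {s : ℝ} (hsd : s < d) {a b K : ℝ} (ha : 0 < a) (hab : a ≤ b)
    (hK : ∀ t ∈ Icc a b, h t ≤ K * t ^ d) :
    ∫ t in a..b, (h t / t ^ s) ^ 2 / t ≤ K ^ 2 * (b ^ d / b ^ s) ^ 2 / (2 * (d - s)) := by
  have hb : 0 < b := ha.trans_le hab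
  have hq : 0 < 2 * (d - s) := by linarith
  have key : ∀ t : ℝ, 0 < t → (t ^ d / t ^ s) ^ 2 = t ^ (2 * (d - s)) := by
    intro t ht
    rw [← Real.rpow_natCast t d, ← Real.rpow_sub ht, ← Real.rpow_natCast, ← Real.rpow_mul ht.le]
    congr 1; push_cast; ring
  calc _ ≤ ∫ t in a..b, K ^ 2 * t ^ (2 * (d - s) - 1) := by
        refine intervalIntegral.integral_mono_on hab (hh.intervalIntegrable_integrand s ha hb)
          ((intervalIntegral.intervalIntegrable_rpow' (by linarith)).const_mul _) fun t ht => ?_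
        have ht0 : 0 < t := ha.trans_le ht.1
        have := hh.pos ht0
        rw [Real.rpow_sub_one ht0.ne', ← key t ht0, ← mul_div_assoc, ← mul_pow, ← mul_div_assoc]
        gcongr
        exact hK t ht
    _ = K ^ 2 * ((b ^ (2 * (d - s)) - a ^ (2 * (d - s))) / (2 * (d - s))) := by
        rw [intervalIntegral.integral_const_mul, integral_rpow (Or.inl (by linarith)),
          sub_add_cancel]
    _ ≤ K ^ 2 * (b ^ (2 * (d - s)) / (2 * (d - s))) := by
        gcongr
        linarith [Real.rpow_nonneg ha.le (2 * (d - s))]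
    _ = _ := by rw [key b hb, mul_div_assoc]

theorem integral_le_of_le (hh : IsGauge d h hinv) {s : ℝ} (hs : 0 < s) {a b K : ℝ} (ha : 0 < a) (hab : a ≤ b)
    (hK : ∀ t ∈ Icc a b, h t ≤ K) :
    ∫ t in a..b, (h t / t ^ s) ^ 2 / t ≤ (K / a ^ s) ^ 2 / (2 * s) := by
  have hb : 0 < b := ha.trans_le hab
  have key : ∀ t : ℝ, 0 < t → (K / t ^ s) ^ 2 = K ^ 2 * t ^ (-2 * s) := by
    intro t ht
    rw [div_pow, ← Real.rpow_natCast (t ^ s), ← Real.rpow_mul ht.le, neg_mul, Real.rpow_neg ht.le,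
      div_eq_mul_inv, mul_comm s]
    norm_num
  have h0 : (0 : ℝ) ∉ uIcc a b := by
    rw [uIcc_of_le hab]; exact fun h => absurd h.1 (by linarith)
  calc _ ≤ ∫ t in a..b, K ^ 2 * t ^ (-2 * s - 1) := by
        refine intervalIntegral.integral_mono_on hab (hh.intervalIntegrable_integrand s ha hb)
          ((intervalIntegral.intervalIntegrable_rpow (Or.inr h0)).const_mul _) fun t ht => ?_
        have ht0 : 0 < t := ha.trans_le ht.1
        have := hh.pos ht0
        rw [Real.rpow_sub_one ht0.ne', ← mul_div_assoc, ← key t ht0]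
        gcongr
        exact hK t ht
    _ = K ^ 2 * ((a ^ (-2 * s) - b ^ (-2 * s)) / (2 * s)) := by
        rw [intervalIntegral.integral_const_mul,
          integral_rpow (Or.inr ⟨by linarith, h0⟩), sub_add_cancel]
        congr 1
        rw [neg_mul, div_neg, ← neg_div, neg_sub]
    _ ≤ K ^ 2 * (a ^ (-2 * s) / (2 * s)) := by
        gcongr
        linarith [Real.rpow_nonneg hb.le (-2 * s)]
    _ = _ := by rw [key a ha, mul_div_assoc]

/-- If no admissible branching number is smaller than `B`, then `h` decays like `t ^ d` down to
the scale corresponding to `B`. -/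
theorem le_mul_pow_of_forall_lt (hh : IsGauge d h hinv) {D ℓ : ℝ} (hD : 0 < D) (hℓ : 0 < ℓ) {B : ℕ}
    (hB : ∀ b : ℕ, 2 ≤ b → b < B → h (ℓ / (D * b)) ≤ h ℓ / b ^ d) {t : ℝ} (ht0 : 0 < t)
    (ht : ℓ ≤ D * B * t) (htℓ : t ≤ ℓ) : h t ≤ (2 * D / ℓ) ^ d * h ℓ * t ^ d := by
  set m := ⌈ℓ / (D * t)⌉₊ with hm
  have hm0 : 0 < m := Nat.ceil_pos.2 (by positivity)
  have hmr : (0 : ℝ) < m := by exact_mod_cast hm0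
  have hhℓ := hh.pos hℓ
  have hmB : m ≤ B := Nat.ceil_le.2 ((div_le_iff₀ (by positivity)).2 (by linarith))
  have h1 : ℓ ≤ m * (D * t) := (div_le_iff₀ (by positivity)).1 (Nat.le_ceil (ℓ / (D * t)))
  suffices h2 : h t ≤ (2 / m) ^ d * h ℓ by
    refine h2.trans ?_
    rw [mul_right_comm, ← mul_pow]
    gcongr ?_ ^ d * h ℓ
    rw [div_mul_eq_mul_div, div_le_div_iff₀ hmr hℓ]
    linarith
  rcases le_or_gt m 2 with hm2 | hm2
  · have h3 : (1 : ℝ) ≤ 2 / m := by rw [le_div_iff₀ hmr, one_mul]; exact_mod_cast hm2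
    have h4 := one_le_pow₀ h3 (n := d)
    nlinarith [hh.mono ht0.le htℓ]
  · have h3 := hB (m - 1) (by omega) (by omega)
    have hm1 : ((m - 1 : ℕ) : ℝ) = m - 1 := by push_cast [Nat.one_le_iff_ne_zero.2 hm0.ne']; ring
    have hm3 : (3 : ℝ) ≤ m := by exact_mod_cast hm2
    have h4 : ((m - 1 : ℕ) : ℝ) < ℓ / (D * t) := Nat.lt_ceil.1 (by omega)
    rw [hm1] at h3 h4
    have hp : (0 : ℝ) < m - 1 := by linarith
    rw [lt_div_iff₀ (by positivity)] at h4
    have h5 : t ≤ ℓ / (D * (m - 1)) := by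
      rw [le_div_iff₀ (by positivity)]; linarith
    refine (hh.mono ht0.le h5).trans (h3.trans ?_)
    rw [div_eq_inv_mul, ← inv_pow]
    gcongr
    rw [inv_eq_one_div, div_le_div_iff₀ hp hmr]
    linarith

end IsGauge

namespace GridTree

variable {d : ℕ} {A : ℝ}

/-- A tree without branching. -/
def leaf (hd : 1 ≤ d) (hA : 8 ≤ A) (ℓ : ℝ) (hℓ : 0 < ℓ) : GridTree d A where
  depth := 0
  branch _ := 2
  scale i := ℓ * (2 * A * d)⁻¹ ^ i
  two_le_branch _ := le_rfl
  scale_pos i := by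
    have : (0 : ℝ) < d := by exact_mod_cast hd
    positivity
  scale_succ_le i := by
    have : (0 : ℝ) < d := by exact_mod_cast hd
    have hA0 : 0 < A := by linarith
    rw [pow_succ]
    apply le_of_eq
    push_cast
    field_simp

/-- The tree all of whose first generation subtrees are copies of `T`. -/
def cons (T : GridTree d A) (B : ℕ) (hB : 2 ≤ B) (ℓ : ℝ) (hℓ : A * (d * B) * T.scale 0 ≤ ℓ)
    (hℓ₀ : 0 < ℓ) : GridTree d A where
  depth := T.depth + 1
  branch i := Nat.casesOn i B T.branch
  scale i := Nat.casesOn i ℓ T.scale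
  two_le_branch i := by cases i; exacts [hB, T.two_le_branch _]
  scale_pos i := by cases i; exacts [hℓ₀, T.scale_pos _]
  scale_succ_le i := by cases i; exacts [hℓ, T.scale_succ_le _]

theorem prob_cons_succ (T : GridTree d A) (B : ℕ) (hB : 2 ≤ B) (ℓ : ℝ)
    (hℓ : A * (d * B) * T.scale 0 ≤ ℓ) (hℓ₀ : 0 < ℓ) (i : ℕ) :
    (T.cons B hB ℓ hℓ hℓ₀).prob (i + 1) = ((B : ℝ) ^ d)⁻¹ * T.prob i := by
  rw [prob, Finset.prod_range_succ', mul_comm]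
  rfl

end GridTree

/-- The constant in the comparison of an integral of `(h t / t ^ s) ^ 2 / t` with a sum. -/
def integralConst (d : ℕ) (A s : ℝ) : ℝ :=
  ((2 * (A * d)) ^ d) ^ 2 / (2 * (d - s)) + (2 ^ d) ^ 2 / (2 * s)

theorem integralConst_pos {d : ℕ} {A s : ℝ} (hs : 0 < s) (hsd : s < d) :
    0 < integralConst d A s := by
  have : 0 < (d : ℝ) - s := by linarith
  exact add_pos_of_nonneg_of_pos (by positivity) (by positivity)

theorem IsGauge.integral_le_of_forall_lt {d : ℕ} {h hinv : ℝ → ℝ} (hh : IsGauge d h hinv)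
    {s : ℝ} (hsd : s < d) {D ℓ : ℝ} (hD : 0 < D) (hℓ : 0 < ℓ) {B : ℕ}
    (hB : ∀ b : ℕ, 2 ≤ b → b < B → h (ℓ / (D * b)) ≤ h ℓ / b ^ d) {t : ℝ} (ht0 : 0 < t)
    (ht : ℓ ≤ D * B * t) (htℓ : t ≤ ℓ) :
    ∫ u in t..ℓ, (h u / u ^ s) ^ 2 / u ≤
      ((2 * D) ^ d) ^ 2 / (2 * (d - s)) * (h ℓ / ℓ ^ s) ^ 2 := by
  refine (hh.integral_le_of_le_mul_pow hsd ht0 htℓ (K := (2 * D / ℓ) ^ d * h ℓ)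
    fun u hu => ?_).trans_eq ?_
  · exact hh.le_mul_pow_of_forall_lt hD hℓ hB (ht0.trans_le hu.1)
      (ht.trans (mul_le_mul_of_nonneg_left hu.1 (by positivity))) hu.2
  · rw [div_pow (2 * D)]
    field_simp

theorem IsGauge.le_div_pow_of_forall_lt {d : ℕ} {h hinv : ℝ → ℝ} (hh : IsGauge d h hinv)
    {D ℓ : ℝ} (hD : 1 ≤ D) (hℓ : 0 < ℓ) {B : ℕ} (hB1 : 1 ≤ B)
    (hB : ∀ b : ℕ, 2 ≤ b → b < B → h (ℓ / (D * b)) ≤ h ℓ / b ^ d) :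
    h (ℓ / (D * B)) ≤ 2 ^ d * (h ℓ / B ^ d) := by
  have hB0 : (1 : ℝ) ≤ B := by exact_mod_cast hB1
  refine (hh.le_mul_pow_of_forall_lt (by linarith) hℓ hB (by positivity)
    (mul_div_cancel₀ _ (by positivity)).ge
    (div_le_self hℓ.le (one_le_mul_of_one_le_of_one_le hD hB0))).trans_eq ?_
  rw [mul_right_comm, ← mul_pow, show 2 * D / ℓ * (ℓ / (D * B)) = 2 / B by field_simp, div_pow]
  ring

namespace GridTree

variable {d : ℕ} {A : ℝ}

theorem exists_integral_le (hd : 1 ≤ d) (hA : 8 ≤ A) {s : ℝ} (hs : 0 < s) (hsd : s < d)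
    {h hinv : ℝ → ℝ} (hh : IsGauge d h hinv) (k : ℕ) :
    ∀ n ℓ : ℝ, 1 ≤ n → n < 2 ^ k → 0 < ℓ → ∃ T : GridTree d A, T.scale 0 = ℓ ∧
      (∀ i ≤ T.depth, h (T.scale i) = T.prob i * h ℓ) ∧ 1 ≤ n * T.prob T.depth ∧
      ∀ τ, 0 < τ → τ ≤ ℓ → 2 ^ d * h ℓ ≤ n * h τ →
        ∫ t in τ..ℓ, (h t / t ^ s) ^ 2 / t ≤ integralConst d A s *
          (2 * ∑ i ∈ Finset.range (T.depth + 1), (h (T.scale i) / T.scale i ^ s) ^ 2 -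
            (h ℓ / ℓ ^ s) ^ 2) := by
  have hd0 : (0 : ℝ) < d := by exact_mod_cast hd
  have hds : 0 < (d : ℝ) - s := by linarith
  have hD1 : 1 ≤ A * d :=
    one_le_mul_of_one_le_of_one_le (by linarith) (by exact_mod_cast hd)
  have hD : 0 < A * d := by linarith
  set C₁ := ((2 * (A * d)) ^ d) ^ 2 / (2 * (d - s)) with hC₁
  set C₂ : ℝ := (2 ^ d) ^ 2 / (2 * s) with hC₂
  have hC₁0 : 0 < C₁ := by positivity
  have hC₂0 : 0 < C₂ := by positivity
  have hC : integralConst d A s = C₁ + C₂ := rfl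
  induction k with
  | zero => intro n ℓ h1 h2; norm_num at h2; linarith
  | succ k ih =>
  intro n ℓ hn hnk hℓ
  have hhℓ := hh.pos hℓ
  by_cases hex : ∃ B : ℕ, 2 ≤ B ∧ (B : ℝ) ^ d ≤ n ∧ A * (d * B) * hinv (h ℓ / B ^ d) ≤ ℓ
  · classical
    obtain ⟨hB2, hBn, hBℓ⟩ := Nat.find_spec hex
    have hmin : ∀ b < Nat.find hex, _ := fun b hb => Nat.find_min hex hb
    generalize Nat.find hex = B at *
    have hB0 : (2 : ℝ) ≤ B := by exact_mod_cast hB2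
    have hB1 : (2 : ℝ) ≤ B ^ d :=
      (pow_le_pow_left₀ (by norm_num) hB0 d).trans' (le_self_pow₀ (by norm_num) (by omega))
    set ℓ₁ := hinv (h ℓ / B ^ d) with hℓ₁
    have hℓ₁0 : 0 < ℓ₁ := hh.inv_pos (by positivity)
    have hhℓ₁ : h ℓ₁ = h ℓ / B ^ d := (hh.right_inv _ (by positivity)).2
    obtain ⟨T, hT0, hTh, hTn, hTint⟩ := ih (n / B ^ d) ℓ₁
      ((one_le_div (by positivity)).2 hBn)
      ((div_lt_iff₀ (by positivity)).2 (hnk.trans_le (by rw [pow_succ]; gcongr))) hℓ₁0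
    refine ⟨T.cons B hB2 ℓ (by rwa [hT0]) hℓ, rfl, ?_, ?_, ?_⟩
    · intro i hi
      cases i with
      | zero => rw [prob_zero, one_mul]; rfl
      | succ i =>
        rw [prob_cons_succ]
        refine (hTh i (Nat.le_of_succ_le_succ hi)).trans ?_
        rw [hhℓ₁]; field_simp
    · refine hTn.trans_eq ?_
      rw [show (T.cons B hB2 ℓ (by rwa [hT0]) hℓ).depth = T.depth + 1 from rfl, prob_cons_succ]
      field_simp
    · intro τ hτ hτℓ hτn
      have hb : ∀ b : ℕ, 2 ≤ b → b < B → h (ℓ / (A * d * b)) ≤ h ℓ / b ^ d := by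
        intro b hb2 hbB
        have h0 : (0 : ℝ) < b := by exact_mod_cast (by omega : 0 < b)
        have h1 : (b : ℝ) ^ d ≤ n := hBn.trans' (by gcongr)
        by_contra! h2
        refine hmin b hbB ⟨hb2, h1, ?_⟩
        have h3 := (hh.inv_le_iff (by positivity) (by positivity)).2 h2.le
        rw [le_div_iff₀ (by positivity)] at h3
        linarith
      set t₀ := ℓ / (A * d * B) with ht₀
      have ht₀0 : 0 < t₀ := by positivity
      have ht₀ℓ : t₀ ≤ ℓ :=
        div_le_self hℓ.le (one_le_mul_of_one_le_of_one_le hD1 (by linarith))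
      have ht₀B : A * d * B * t₀ = ℓ := mul_div_cancel₀ _ (by positivity)
      have h1 : ∀ t, t₀ ≤ t → t ≤ ℓ → ∫ u in t..ℓ, (h u / u ^ s) ^ 2 / u ≤
          C₁ * (h ℓ / ℓ ^ s) ^ 2 := fun t ht htℓ =>
        hh.integral_le_of_forall_lt hsd hD hℓ hb (ht₀0.trans_le ht)
          (ht₀B.ge.trans (by gcongr)) htℓ
      have h2 : h t₀ ≤ 2 ^ d * h ℓ₁ := by
        rw [hhℓ₁]
        exact hh.le_div_pow_of_forall_lt hD1 hℓ (by omega) hb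
      have hℓ₁t₀ : ℓ₁ ≤ t₀ := by rw [ht₀, le_div_iff₀ (by positivity)]; linarith
      have h3 : ∀ t, ℓ₁ ≤ t → t ≤ t₀ → ∫ u in t..t₀, (h u / u ^ s) ^ 2 / u ≤
          C₂ * (h ℓ₁ / ℓ₁ ^ s) ^ 2 := by
        intro t ht htt
        refine (hh.integral_le_of_le hs (hℓ₁0.trans_le ht) htt (K := 2 ^ d * h ℓ₁)
          fun u hu => (hh.mono (by linarith [hu.1]) hu.2).trans h2).trans ?_
        have := hh.pos hℓ₁0
        have ht0 : 0 < t := hℓ₁0.trans_le ht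
        rw [hC₂, div_mul_eq_mul_div, ← mul_pow, ← mul_div_assoc]
        gcongr
      have h4 : ∀ t, ℓ₁ ≤ t → t ≤ ℓ → ∫ u in t..ℓ, (h u / u ^ s) ^ 2 / u ≤
          C₁ * (h ℓ / ℓ ^ s) ^ 2 + C₂ * (h ℓ₁ / ℓ₁ ^ s) ^ 2 := by
        intro t ht htℓ
        rcases le_total t₀ t with h5 | h5
        · exact (h1 t h5 htℓ).trans (le_add_of_nonneg_right (by positivity))
        · rw [← intervalIntegral.integral_add_adjacent_intervals
            (hh.intervalIntegrable_integrand s (hℓ₁0.trans_le ht) ht₀0)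
            (hh.intervalIntegrable_integrand s ht₀0 hℓ)]
          linarith [h3 t ht h5, h1 t₀ le_rfl ht₀ℓ]
      have hsum : ∑ i ∈ Finset.range (T.depth + 1 + 1),
          (h ((T.cons B hB2 ℓ (by rwa [hT0]) hℓ).scale i) /
            (T.cons B hB2 ℓ (by rwa [hT0]) hℓ).scale i ^ s) ^ 2 =
          ∑ i ∈ Finset.range (T.depth + 1), (h (T.scale i) / T.scale i ^ s) ^ 2 +
            (h ℓ / ℓ ^ s) ^ 2 := by
        rw [Finset.sum_range_succ']; rfl
      rw [show (T.cons B hB2 ℓ (by rwa [hT0]) hℓ).depth = T.depth + 1 from rfl, hsum, hC]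
      set S := ∑ i ∈ Finset.range (T.depth + 1), (h (T.scale i) / T.scale i ^ s) ^ 2
      have hS : (h ℓ₁ / ℓ₁ ^ s) ^ 2 ≤ S := by
        rw [← hT0]
        exact Finset.single_le_sum (f := fun i => (h (T.scale i) / T.scale i ^ s) ^ 2)
          (fun _ _ => sq_nonneg _) (by simp)
      set X := (h ℓ / ℓ ^ s) ^ 2
      set Y := (h ℓ₁ / ℓ₁ ^ s) ^ 2
      have hX : 0 ≤ X := sq_nonneg _
      have hY : 0 ≤ Y := sq_nonneg _
      rcases le_total ℓ₁ τ with h5 | h5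
      · nlinarith [h4 τ h5 hτℓ]
      · rw [← intervalIntegral.integral_add_adjacent_intervals
          (hh.intervalIntegrable_integrand s hτ hℓ₁0)
          (hh.intervalIntegrable_integrand s hℓ₁0 hℓ)]
        have h6 := h4 ℓ₁ le_rfl (hℓ₁t₀.trans ht₀ℓ)
        have h7 := hTint τ hτ h5 (by
          rw [hhℓ₁, ← mul_div_assoc, div_mul_eq_mul_div]; gcongr)
        rw [hC] at h7
        nlinarith
  · push Not at hex
    refine ⟨leaf hd hA ℓ hℓ, by simp [leaf], ?_, by simpa [leaf, prob_zero] using hn, ?_⟩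
    · intro i hi
      obtain rfl : i = 0 := Nat.le_zero.1 hi
      rw [prob_zero, one_mul]; simp [leaf]
    intro τ hτ hτℓ hτn
    have hB : ∃ B : ℕ, n < (B : ℝ) ^ d := by
      obtain ⟨B, hB⟩ := exists_nat_gt n
      refine ⟨B, hB.trans_le (le_self_pow₀ (by linarith) (by omega))⟩
    classical
    have hBn := Nat.find_spec hB
    have hmin : ∀ b < Nat.find hB, _ := fun b hb => Nat.find_min hB hb
    generalize Nat.find hB = B at *
    have hb : ∀ b : ℕ, 2 ≤ b → b < B → h (ℓ / (A * d * b)) ≤ h ℓ / b ^ d := by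
      intro b hb2 hbB
      have h0 : (0 : ℝ) < b := by exact_mod_cast (by omega : 0 < b)
      by_contra! h2
      have h3 := (hh.inv_le_iff (by positivity) (by positivity)).2 h2.le
      rw [le_div_iff₀ (by positivity)] at h3
      linarith [hex b hb2 (not_lt.1 (hmin b hbB))]
    have hB0 : (0 : ℝ) < B := by
      refine Nat.cast_pos.2 (Nat.pos_of_ne_zero fun h0 => ?_)
      rw [h0, Nat.cast_zero, zero_pow (by omega)] at hBn
      linarith
    set t₀ := ℓ / (A * d * B) with ht₀
    have ht₀0 : 0 < t₀ := by positivity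
    have ht₀B : A * d * B * t₀ = ℓ := mul_div_cancel₀ _ (by positivity)
    have hτt₀ : t₀ ≤ τ := by
      by_contra! hlt
      have h1 := (hh.mono hτ.le hlt.le).trans
        (hh.le_div_pow_of_forall_lt hD1 hℓ (by exact_mod_cast hB0) hb)
      rw [← mul_div_assoc, le_div_iff₀ (by positivity)] at h1
      nlinarith [hh.pos hτ]
    have h1 := hh.integral_le_of_forall_lt hsd hD hℓ hb hτ
      (ht₀B.ge.trans (by gcongr)) hτℓ
    have h2 : ∑ i ∈ Finset.range ((leaf (A := A) hd hA ℓ hℓ).depth + 1),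
        (h ((leaf (A := A) hd hA ℓ hℓ).scale i) / (leaf (A := A) hd hA ℓ hℓ).scale i ^ s) ^ 2 =
        (h ℓ / ℓ ^ s) ^ 2 := by
      rw [show (leaf (A := A) hd hA ℓ hℓ).depth + 1 = 1 from rfl, Finset.sum_range_one,
        show (leaf (A := A) hd hA ℓ hℓ).scale 0 = ℓ by simp [leaf]]
    have hX : 0 ≤ (h ℓ / ℓ ^ s) ^ 2 := sq_nonneg _
    rw [hC, h2, two_mul, add_sub_cancel_right]
    exact h1.trans (mul_le_mul_of_nonneg_right (le_add_of_nonneg_right hC₂0.le) hX)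

end GridTree

theorem GridTree.density_zero {d : ℕ} {A : ℝ} (T : GridTree d A) (s : ℝ) :
    T.density s 0 = T.scale 0 ^ (-s) := by
  rw [density, prob_zero, one_mul]

theorem GridTree.sum_density_sq {d : ℕ} {A : ℝ} (T : GridTree d A) (s : ℝ) :
    ∑ i ∈ Finset.range (T.depth + 1), T.density s i ^ 2 =
      T.density s T.depth ^ 2 + T.energy s := by
  rw [Finset.sum_range_succ, add_comm, energy, Finset.sum_range]

/-- At every scale `ℓ` there is a combination of point masses whose Riesz transform is large on a
set of content comparable to `h ℓ`. The number `S` measures the size of the Riesz transform. -/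
theorem IsGauge.exists_combination {d : ℕ} (hd : 1 ≤ d) {s : ℝ} (hs : 0 < s) (hsd : s < d) :
    ∃ c₁ c₂ C : ℝ, 0 < c₁ ∧ 0 < c₂ ∧ 0 < C ∧ ∀ h hinv : ℝ → ℝ, IsGauge d h hinv →
      ∀ ℓ : ℝ, 0 < ℓ → ∀ N : ℕ, 2 ≤ N → ∃ S : ℝ, ℓ ^ (-s) ≤ S ∧
        (∀ τ, 0 < τ → τ ≤ ℓ → 2 ^ (d + 1) * h ℓ ≤ N * h τ →
          √(∫ t in τ..ℓ, (h t / t ^ s) ^ 2 / t) ≤ C * h ℓ * S) ∧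
        ∀ η P : ℝ, 0 < η → P < c₁ * η * S →
          ∃ (x : Fin N → EuclideanSpace ℝ (Fin d)) (a : Fin N → ℝ), Function.Injective x ∧
            (∀ i, 0 < a i) ∧ ∑ i, a i = η ∧
            ENNReal.ofReal (c₂ * h ℓ) ≤ hContent d h
              {z | rieszExists d s (∑ i, ENNReal.ofReal (a i) • Measure.dirac (x i)) z ∧
                P < ‖rieszTransform d s (∑ i, ENNReal.ofReal (a i) • Measure.dirac (x i)) z‖} := by
  obtain ⟨A, c₁, c₂, hA, hc₁, hc₂, H⟩ := GridTree.exists_combination_large_content hd hs hsd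
  have hI := integralConst_pos (A := A) hs hsd
  refine ⟨c₁, c₂, √(2 * integralConst d A s), hc₁, hc₂, by positivity, ?_⟩
  intro h hinv hh ℓ hℓ N hN
  have hN' : (2 : ℝ) ≤ N := by exact_mod_cast hN
  obtain ⟨k, hk⟩ := pow_unbounded_of_one_lt ((N : ℝ) - 1) one_lt_two
  obtain ⟨T, hT0, hTh, hTn, hTint⟩ := GridTree.exists_integral_le hd hA hs hsd hh k (N - 1) ℓ
    (by linarith) hk hℓ
  have hhℓ := hh.pos hℓ
  have hS : ∑ i ∈ Finset.range (T.depth + 1), (h (T.scale i) / T.scale i ^ s) ^ 2 =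
      h ℓ ^ 2 * (T.density s T.depth ^ 2 + T.energy s) := by
    rw [← T.sum_density_sq, Finset.mul_sum]
    refine Finset.sum_congr rfl fun i hi => ?_
    rw [hTh i (by simpa [Nat.lt_succ_iff] using hi), GridTree.density,
      Real.rpow_neg (T.scale_pos i).le]
    ring
  refine ⟨√(T.density s T.depth ^ 2 + T.energy s), ?_, ?_, ?_⟩
  · refine Real.le_sqrt_of_sq_le ?_
    rw [← T.sum_density_sq, ← hT0, ← T.density_zero]
    exact Finset.single_le_sum (f := fun i => T.density s i ^ 2) (fun _ _ => sq_nonneg _) (by simp)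
  · intro τ hτ hτℓ hτN
    have h1 := hh.pos hτ
    have h2 := hTint τ hτ hτℓ (by rw [pow_succ] at hτN; nlinarith)
    rw [hS] at h2
    refine Real.sqrt_le_iff.2 ⟨by positivity, h2.trans ?_⟩
    have h3 : 0 ≤ T.density s T.depth ^ 2 + T.energy s := by
      rw [← T.sum_density_sq]; exact Finset.sum_nonneg fun _ _ => sq_nonneg _
    rw [mul_pow, mul_pow, Real.sq_sqrt h3, Real.sq_sqrt (by positivity)]
    have h4 := mul_nonneg hI.le (sq_nonneg (h ℓ / ℓ ^ s))
    linarith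
  · intro η P hη hP
    refine H T h (h ℓ) hhℓ hh.strictMonoOn.monotoneOn hh.div_pow_le hTh η P hη hP N ?_
    have h1 := T.card_address
    have h2 : (Fintype.card T.Address : ℝ) ≤ N - 1 := by
      calc (Fintype.card T.Address : ℝ) ≤ Fintype.card T.Address * ((N - 1) * T.prob T.depth) :=
            le_mul_of_one_le_right (Nat.cast_nonneg _) hTn
        _ = _ := by linear_combination ((N : ℝ) - 1) * h1
    exact_mod_cast (show (Fintype.card T.Address : ℝ) < N by linarith)

theorem IsGauge.integral_mono_interval {d : ℕ} {h hinv : ℝ → ℝ} (hh : IsGauge d h hinv) (s : ℝ)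
    {a b c : ℝ} (ha : 0 < a) (hab : a ≤ b) (hbc : b ≤ c) :
    ∫ t in a..b, (h t / t ^ s) ^ 2 / t ≤ ∫ t in a..c, (h t / t ^ s) ^ 2 / t := by
  have hb := ha.trans_le hab
  rw [← intervalIntegral.integral_add_adjacent_intervals
    (hh.intervalIntegrable_integrand s ha hb)
    (hh.intervalIntegrable_integrand s hb (hb.trans_le hbc))]
  refine le_add_of_nonneg_right (intervalIntegral.integral_nonneg hbc fun t ht => ?_)
  have : 0 < t := hb.trans_le ht.1
  positivity

/-- The solutions `M` of the inequality opposite to the desired one are bounded. -/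
theorem IsGauge.bddAbove {d : ℕ} {h hinv : ℝ → ℝ} (hh : IsGauge d h hinv) {s : ℝ} (hs : 0 < s)
    {α β : ℝ} (hα : 0 < α) (hβ : 0 < β) (hβ1 : β ≤ 1) :
    BddAbove {M | 0 < M ∧ M ≤ α * √(∫ t in (hinv (β * M))..(hinv M), (h t / t ^ s) ^ 2 / t)} := by
  refine ⟨h ((α / √(2 * s)) ^ s⁻¹) / β, fun M ⟨hM, hle⟩ => ?_⟩
  have hu := hh.inv_pos (mul_pos hβ hM)
  set u := hinv (β * M)
  have hus : 0 < u ^ s := Real.rpow_pos_of_pos hu s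
  have h1 : √(∫ t in u..(hinv M), (h t / t ^ s) ^ 2 / t) ≤ M / u ^ s / √(2 * s) := by
    rw [Real.sqrt_le_iff]
    refine ⟨by positivity, ?_⟩
    rw [div_pow _ √(2 * s), Real.sq_sqrt (by positivity)]
    refine hh.integral_le_of_le hs hu (hh.inv_mono (by positivity) (by nlinarith)) fun t ht => ?_
    exact (hh.mono (hu.le.trans ht.1) ht.2).trans_eq (hh.right_inv M hM.le).2
  have h2 : u ^ s ≤ α / √(2 * s) := by
    have h3 := hle.trans (mul_le_mul_of_nonneg_left h1 hα.le)
    have h4 : α * (M / u ^ s / √(2 * s)) = M * (α / √(2 * s) / u ^ s) := by ring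
    rw [h4] at h3
    exact (one_le_div hus).1 (le_of_mul_le_mul_left ((mul_one M).le.trans h3) hM)
  rw [le_div_iff₀ hβ, mul_comm, ← hh.inv_le_iff (by positivity) (by positivity)]
  exact (Real.le_rpow_inv_iff_of_pos hu.le (by positivity) hs).2 h2

/-- Proposition 7.2: for any gauge function `h` with `h(r)/r^d` nonincreasing, any
`η, P > 0` and `N ≥ N₀(d,s)` there is a positive combination `ν` of `N` Dirac masses with
`‖ν‖ = η` such that every `M ≥ M_h(Z(ν,P))` satisfies
`M > c (‖ν‖/P) [∫_{h⁻¹(C M/N)}^{h⁻¹(M)} (h(t)/t^s)² dt/t]^{1/2}`. -/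
theorem statement16 (d : ℕ) (hd : 1 ≤ d) (s : ℝ) (hs : 0 < s) (hsd : s < d) :
    ∃ (N₀ : ℕ) (c C : ℝ), 0 < c ∧ 1 ≤ C ∧
      ∀ h hinv : ℝ → ℝ,
        ContinuousOn h (Ici 0) → StrictMonoOn h (Ici 0) → h 0 = 0 →
        Tendsto h atTop atTop →
        (∀ r₁ r₂ : ℝ, 0 < r₁ → r₁ ≤ r₂ → h r₂ / r₂ ^ d ≤ h r₁ / r₁ ^ d) →
        (∀ t, 0 ≤ t → hinv (h t) = t) → (∀ u, 0 ≤ u → 0 ≤ hinv u ∧ h (hinv u) = u) →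
      ∀ η P : ℝ, 0 < η → 0 < P → ∀ N : ℕ, N₀ ≤ N →
      ∃ (ν : Measure (EuclideanSpace ℝ (Fin d))) (x : Fin N → EuclideanSpace ℝ (Fin d))
        (a : Fin N → ℝ),
        Function.Injective x ∧ (∀ i, 0 < a i) ∧
        ν = ∑ i, ENNReal.ofReal (a i) • Measure.dirac (x i) ∧
        (ν univ).toReal = η ∧
        ∀ M : ℝ,
          hContent d h {z | rieszExists d s ν z ∧ P < ‖rieszTransform d s ν z‖} ≤
            ENNReal.ofReal M →
          c * (η / P) *
              (∫ t in (hinv (C * M / N))..(hinv M), (h t / t ^ s) ^ 2 / t) ^ ((1 : ℝ) / 2) <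
            M := by
  obtain ⟨c₁, c₂, C₁, hc₁, hc₂, hC₁, H⟩ := IsGauge.exists_combination hd hs hsd
  set K := 2 / c₂ + 1 with hK
  have hK1 : 1 ≤ K := le_add_of_nonneg_left (by positivity)
  have hK0 : 0 < K := by positivity
  have hKc : 2 ≤ c₂ * K := by
    rw [hK, mul_add, mul_div_cancel₀ _ hc₂.ne']; linarith
  set C : ℝ := 2 ^ (d + 1) * K with hC
  have hC1 : 1 ≤ C := one_le_mul_of_one_le_of_one_le (one_le_pow₀ one_le_two) hK1
  set c := c₁ / (2 * C₁ * K) with hc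
  have hc0 : 0 < c := by positivity
  refine ⟨max 2 ⌈C⌉₊, c, C, hc0, hC1, ?_⟩
  intro h hinv hcont hstrict hzero _ hdiv hleft hright η P hη hP N hN
  have hh : IsGauge d h hinv := ⟨hcont, hstrict, hzero, hdiv, hleft, hright⟩
  have hN2 : 2 ≤ N := (le_max_left _ _).trans hN
  have hNC : C ≤ N := Nat.ceil_le.1 ((le_max_right _ _).trans hN)
  have hN0 : (0 : ℝ) < N := by positivity
  set α := c * (η / P) with hα
  have hα0 : 0 < α := by positivity
  set 𝓐 := {M | 0 < M ∧ M ≤ α * √(∫ t in (hinv (C / N * M))..(hinv M), (h t / t ^ s) ^ 2 / t)}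
    with h𝓐
  have hbdd : BddAbove 𝓐 :=
    hh.bddAbove hs hα0 (by positivity) ((div_le_one hN0).2 hNC)
  obtain ⟨M₀, hM₀, hM₀lt, x, a, hx, ha, hsum, hcontent⟩ : ∃ M₀ : ℝ, 0 < M₀ ∧
      (∀ M ∈ 𝓐, M < M₀) ∧
      ∃ (x : Fin N → EuclideanSpace ℝ (Fin d)) (a : Fin N → ℝ), Function.Injective x ∧
        (∀ i, 0 < a i) ∧ ∑ i, a i = η ∧ ENNReal.ofReal M₀ ≤ hContent d h
          {z | rieszExists d s (∑ i, ENNReal.ofReal (a i) • Measure.dirac (x i)) z ∧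
            P < ‖rieszTransform d s (∑ i, ENNReal.ofReal (a i) • Measure.dirac (x i)) z‖} := by
    rcases 𝓐.eq_empty_or_nonempty with hempty | hne
    · set R := P / (c₁ * η) + 1 with hR
      have hR0 : 0 < R := by positivity
      have hℓ : 0 < R ^ (-s⁻¹) := Real.rpow_pos_of_pos hR0 _
      obtain ⟨S, hS, -, hcomb⟩ := H h hinv hh (R ^ (-s⁻¹)) hℓ N hN2
      have := hh.pos hℓ
      refine ⟨c₂ * h (R ^ (-s⁻¹)), by positivity, by simp [hempty], hcomb η P hη ?_⟩
      rw [← Real.rpow_mul hR0.le, neg_mul_neg, inv_mul_cancel₀ hs.ne', Real.rpow_one] at hS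
      calc P = c₁ * η * (P / (c₁ * η)) := by field_simp
        _ < c₁ * η * S := by gcongr; linarith
    · have hpos : 0 < sSup 𝓐 := by
        obtain ⟨M, hM⟩ := hne
        exact hM.1.trans_le (le_csSup hbdd hM)
      obtain ⟨M₁, hM₁, hM₁lt⟩ := exists_lt_of_lt_csSup hne (half_lt_self hpos)
      have hM₁0 : 0 < M₁ := hM₁.1
      have hu : 0 ≤ K * M₁ := by positivity
      have hℓ : 0 < hinv (K * M₁) := hh.inv_pos (by positivity)
      obtain ⟨S, hS, hint_le, hcomb⟩ := H h hinv hh _ hℓ N hN2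
      rw [(hh.right_inv _ hu).2] at hint_le hcomb
      refine ⟨c₂ * (K * M₁), by positivity, fun M hM => ?_, hcomb η P hη ?_⟩
      · have := le_csSup hbdd hM
        nlinarith
      have hS0 : 0 < S := (Real.rpow_pos_of_pos hℓ _).trans_le hS
      have hτ0 : 0 < C / N * M₁ := by positivity
      have hle1 : C / N * M₁ ≤ M₁ := mul_le_of_le_one_left hM₁0.le ((div_le_one hN0).2 hNC)
      have hle2 : M₁ ≤ K * M₁ := le_mul_of_one_le_left hM₁0.le hK1
      have h1 := hint_le (hinv (C / N * M₁)) (hh.inv_pos hτ0) (hh.inv_mono hτ0.le (hle1.trans hle2))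
        (by rw [(hh.right_inv _ hτ0.le).2, hC]; exact le_of_eq (by field_simp))
      have h2 := (Real.sqrt_le_sqrt (hh.integral_mono_interval s (hh.inv_pos hτ0)
        (hh.inv_mono hτ0.le hle1) (hh.inv_mono hM₁0.le hle2))).trans h1
      have h3 := hM₁.2.trans (mul_le_mul_of_nonneg_left h2 hα0.le)
      have h4 : α * (C₁ * (K * M₁) * S) = M₁ * (c₁ * η * S / 2 / P) := by
        rw [hα, hc]; field_simp
      rw [h4] at h3
      have h5 := (one_le_div hP).1 (le_of_mul_le_mul_left ((mul_one M₁).le.trans h3) hM₁0)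
      have h6 : 0 < c₁ * η * S := by positivity
      linarith
  refine ⟨_, x, a, hx, ha, rfl, ?_, fun M hM => ?_⟩
  · rw [Measure.finsetSum_apply, ENNReal.toReal_sum (by simp), ← hsum]
    simp [ENNReal.toReal_ofReal (ha _).le]
  · have hM' := (ENNReal.ofReal_le_ofReal_iff' .. ).1 (hcontent.trans hM)
    have hMM : M₀ ≤ M := hM'.resolve_right (by linarith)
    by_contra! hlt
    rw [← Real.sqrt_eq_rpow, mul_div_right_comm] at hlt
    exact (hM₀lt M ⟨hM₀.trans_le hMM, hlt⟩).not_ge hMM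
end
end
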